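/- Let n ≥ 5 and let N be a non-perfect group of order n!. Suppose f : Sₙ → Aut(N) is a group homomorphism and g : Sₙ → N is a bijective map satisfying g(στ) = g(σ) · f(σ)(g(τ)) for all σ, τ ∈ Sₙ. Let M be a maximal proper characteristic subgroup of N containing the commutator subgroup [N,N]. Then g⁻¹(M) = Aₙ, so g restricts to a bijection from Aₙ onto M, and M is isomorphic to Aₙ. -/

import Mathlib

set_option linter.style.haveILetI false

namespace Stmt15
open Module

lemma e1K {K V : Type*} [Field K] [IsAlgClosed K] [AddCommGroup V] [Module K V]
    [FiniteDimensional K V] [Nontrivial V] (s : ℕ) (hs : s.Prime) (hsK : (s : K) ≠ 0)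
    (x : Module.End K V) (hgeom : ∑ i ∈ Finset.range s, x ^ i = 0)
    (hrat : ∀ j : ℕ, j.Coprime s → ∃ y : Module.End K V, Function.Injective y ∧ y * x = x ^ j * y) :
    s - 1 ≤ finrank K V := by
  have hxs : x ^ s = 1 := by
    have := geom_sum_mul x s
    rw [hgeom, zero_mul] at this
    exact (sub_eq_zero.mp this.symm)
  obtain ⟨μ, hμ⟩ := Module.End.exists_eigenvalue x
  obtain ⟨v, hv⟩ := hμ.exists_hasEigenvector
  have hpow : ∀ i : ℕ, (x ^ i) v = μ ^ i • v := fun i => hv.pow_apply i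
  have hμs : μ ^ s = 1 := by
    have h1 := hpow s
    rw [hxs] at h1
    have h2 : (μ ^ s - 1) • v = 0 := by
      rw [sub_smul, ← h1]; simp
    rcases smul_eq_zero.mp h2 with h | h
    · exact sub_eq_zero.mp h
    · exact absurd h hv.2
  have hμ1 : μ ≠ 1 := by
    rintro rfl
    have h1 : (∑ i ∈ Finset.range s, x ^ i) v = 0 := by rw [hgeom]; rfl
    rw [LinearMap.sum_apply] at h1
    simp only [hpow, one_pow, one_smul, Finset.sum_const, Finset.card_range] at h1
    rw [← Nat.cast_smul_eq_nsmul K] at h1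
    rcases smul_eq_zero.mp h1 with h | h
    · exact hsK h
    · exact hv.2 h
  haveI := Fact.mk hs
  have hprim : IsPrimitiveRoot μ s := by
    have := orderOf_eq_prime hμs hμ1
    exact IsPrimitiveRoot.iff_orderOf.mpr this
  have hall : ∀ ν : ((primitiveRoots s K : Finset K) : Set K), ∃ w : V, x.HasEigenvector ν w := by
    rintro ⟨ν, hν⟩
    have hν' : IsPrimitiveRoot ν s := (mem_primitiveRoots hs.pos).mp hν
    obtain ⟨i, hi, hic, rfl⟩ := (hprim.isPrimitiveRoot_iff).mp hν'
    obtain ⟨j, -, hj⟩ := Nat.exists_mul_mod_eq_one_of_coprime hic hs.one_lt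
    have hjc : j.Coprime s := by
      have : (i * j).Coprime s := by
        rw [Nat.Coprime, Nat.gcd_comm, Nat.gcd_rec, hj]; simp
      exact Nat.Coprime.coprime_mul_left this
    obtain ⟨y, hy, hyx⟩ := hrat j hjc
    refine ⟨y v, ?_⟩
    have h1 : (x ^ j) (y v) = μ • y v := by
      have := congrArg (fun z => z v) hyx
      simp only [Module.End.mul_apply] at this
      rw [← this, hv.apply_eq_smul, map_smul]
    have h2 : ∀ k : ℕ, ((x ^ j) ^ k) (y v) = μ ^ k • y v := by
      intro k
      induction k with
      | zero => simp
      | succ k ih => rw [pow_succ, Module.End.mul_apply, h1, map_smul, ih, smul_smul, pow_succ, mul_comm]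
    have h3 : (x ^ j) ^ i = x := by
      rw [← pow_mul, mul_comm, ← Nat.mod_add_div (i * j) s, hj, pow_add, pow_mul, hxs]; simp
    refine ⟨?_, ?_⟩
    · rw [Module.End.mem_eigenspace_iff]
      have := h2 i
      rwa [h3] at this
    · intro h0
      exact hv.2 (hy (by rw [h0, map_zero]))
  choose w hw using hall
  have hli := Module.End.eigenvectors_linearIndependent x _ w hw
  have := hli.fintype_card_le_finrank
  simpa [hprim.card_primitiveRoots, Nat.totient_prime hs] using this

lemma restrict_pow_coe {K V : Type*} [Field K] [AddCommGroup V] [Module K V]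
    (U : Submodule K V) (x : Module.End K V) (hx : ∀ u ∈ U, x u ∈ U) (i : ℕ) (u : U) :
    (((x.restrict hx : Module.End K U) ^ i) u : V) = (x ^ i) u := by
  induction i generalizing u with
  | zero => simp
  | succ i ih => rw [pow_succ, Module.End.mul_apply, ih, pow_succ, Module.End.mul_apply]; rfl

lemma restrict_geom {K V : Type*} [Field K] [AddCommGroup V] [Module K V]
    (U : Submodule K V) (x : Module.End K V) (hx : ∀ u ∈ U, x u ∈ U) (s : ℕ)
    (hgeom : ∀ u ∈ U, (∑ i ∈ Finset.range s, x ^ i) u = 0) :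
    ∑ i ∈ Finset.range s, (x.restrict hx : Module.End K U) ^ i = 0 := by
  ext u
  have := hgeom u u.2
  rw [LinearMap.sum_apply] at this ⊢
  rw [Submodule.coe_sum]
  simp only [restrict_pow_coe]
  exact this

lemma e1K_sub {K V : Type*} [Field K] [IsAlgClosed K] [AddCommGroup V] [Module K V]
    [FiniteDimensional K V] (s : ℕ) (hs : s.Prime) (hsK : (s : K) ≠ 0)
    (U : Submodule K V) (hU : U ≠ ⊥)
    (x : Module.End K V) (hx : ∀ u ∈ U, x u ∈ U) (hgeom : ∑ i ∈ Finset.range s, x ^ i = 0)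
    (hrat : ∀ j : ℕ, j.Coprime s → ∃ y : Module.End K V, Function.Injective y ∧ y * x = x ^ j * y ∧
      ∀ u ∈ U, y u ∈ U) :
    s - 1 ≤ finrank K U := by
  haveI : Nontrivial U := (Submodule.nontrivial_iff_ne_bot).mpr hU
  refine e1K s hs hsK (x.restrict hx) (restrict_geom U x hx s (by simp [hgeom])) ?_
  intro j hj
  obtain ⟨y, hy, hyx, hyU⟩ := hrat j hj
  refine ⟨y.restrict hyU, ?_, ?_⟩
  · intro a b hab
    have := congrArg Subtype.val hab
    exact Subtype.ext (hy this)
  · ext u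
    have := congrArg (fun z => z (u : V)) hyx
    simp only [Module.End.mul_apply] at this ⊢
    rw [restrict_pow_coe]
    exact this

lemma baseChange_geom {k V : Type*} (K : Type*) [Field k] [Field K] [Algebra k K] [AddCommGroup V]
    [Module k V] (x : Module.End k V) (s : ℕ) (h : ∑ i ∈ Finset.range s, x ^ i = 0) :
    ∑ i ∈ Finset.range s, (x.baseChange K : Module.End K (TensorProduct k K V)) ^ i = 0 := by
  have := congrArg (Module.End.baseChangeHom k K V) h
  rw [map_sum, map_zero] at this
  simp only [map_pow] at this
  exact this

lemma baseChange_inj {k V : Type*} (K : Type*) [Field k] [Field K] [Algebra k K] [AddCommGroup V]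
    [Module k V] (x : Module.End k V) (h : Function.Injective x) :
    Function.Injective (x.baseChange K) := Module.Flat.lTensor_preserves_injective_linearMap x h

lemma castK_ne (q s : ℕ) [Fact q.Prime] (hs : s.Prime) (hqs : s ≠ q) :
    (s : AlgebraicClosure (ZMod q)) ≠ 0 := by
  haveI : CharP (AlgebraicClosure (ZMod q)) q := charP_of_injective_algebraMap' (ZMod q) q
  intro h
  rw [CharP.cast_eq_zero_iff (AlgebraicClosure (ZMod q)) q] at h
  exact hqs ((Nat.prime_dvd_prime_iff_eq (Fact.out) hs).mp h).symm

/-- E1, fixed point free form. -/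
lemma e1F {V : Type*} (q : ℕ) [Fact q.Prime] [AddCommGroup V] [Module (ZMod q) V]
    [FiniteDimensional (ZMod q) V] [Nontrivial V] (s : ℕ) (hs : s.Prime) (hqs : s ≠ q)
    (x : Module.End (ZMod q) V) (hgeom : ∑ i ∈ Finset.range s, x ^ i = 0)
    (hrat : ∀ j : ℕ, j.Coprime s → ∃ y : Module.End (ZMod q) V,
      Function.Injective y ∧ y * x = x ^ j * y) :
    s - 1 ≤ finrank (ZMod q) V := by
  have := e1K (K := AlgebraicClosure (ZMod q))
    (V := TensorProduct (ZMod q) (AlgebraicClosure (ZMod q)) V) s hs (castK_ne q s hs hqs)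
    (x.baseChange _) (baseChange_geom _ x s hgeom) ?_
  · rwa [Module.finrank_baseChange] at this
  · intro j hj
    obtain ⟨y, hy, hyx⟩ := hrat j hj
    refine ⟨y.baseChange _, baseChange_inj _ y hy, ?_⟩
    rw [← LinearMap.baseChange_mul, hyx, LinearMap.baseChange_mul, LinearMap.baseChange_pow]

/-- E1 on an invariant submodule. -/
lemma e1S {V : Type*} (q : ℕ) [Fact q.Prime] [AddCommGroup V] [Module (ZMod q) V]
    [FiniteDimensional (ZMod q) V] (s : ℕ) (hs : s.Prime) (hqs : s ≠ q)
    (U : Submodule (ZMod q) V) (hU : U ≠ ⊥)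
    (x : Module.End (ZMod q) V) (hx : ∀ u ∈ U, x u ∈ U)
    (hgeom : ∀ u ∈ U, (∑ i ∈ Finset.range s, x ^ i) u = 0)
    (hrat : ∀ j : ℕ, j.Coprime s → ∃ y : Module.End (ZMod q) V,
      Function.Injective y ∧ y * x = x ^ j * y ∧ ∀ u ∈ U, y u ∈ U) :
    s - 1 ≤ finrank (ZMod q) U := by
  haveI : Nontrivial U := (Submodule.nontrivial_iff_ne_bot).mpr hU
  refine e1F q s hs hqs (x.restrict hx) (restrict_geom U x hx s hgeom) ?_
  intro j hj
  obtain ⟨y, hy, hyx, hyU⟩ := hrat j hj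
  refine ⟨y.restrict hyU, ?_, ?_⟩
  · intro a b hab
    have := congrArg Subtype.val hab
    exact Subtype.ext (hy this)
  · ext u
    have := congrArg (fun z => z (u : V)) hyx
    simp only [Module.End.mul_apply] at this ⊢
    rw [restrict_pow_coe]
    exact this

lemma pow_sub_one_factor {A : Type*} [Ring A] (x : A) (j : ℕ) :
    x ^ j - 1 = (x - 1) * ∑ i ∈ Finset.range j, x ^ i := (mul_geom_sum x j).symm

/-- E1. -/
lemma e1 {V : Type*} (q : ℕ) [Fact q.Prime] [AddCommGroup V] [Module (ZMod q) V]
    [FiniteDimensional (ZMod q) V] (s : ℕ) (hs : s.Prime) (hqs : s ≠ q)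
    (x : Module.End (ZMod q) V) (hxs : x ^ s = 1) (hx1 : x ≠ 1)
    (hrat : ∀ j : ℕ, j.Coprime s → ∃ y : Module.End (ZMod q) V,
      Function.Injective y ∧ y * x = x ^ j * y) :
    s - 1 ≤ finrank (ZMod q) V := by
  refine le_trans (e1S q s hs hqs (LinearMap.range (x - 1)) ?_ x ?_ ?_ ?_) (Submodule.finrank_le _)
  · rw [Ne, LinearMap.range_eq_bot]; exact sub_ne_zero.mpr hx1
  · rintro _ ⟨v, rfl⟩; exact ⟨x v, by simp⟩
  · rintro _ ⟨v, rfl⟩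
    rw [← Module.End.mul_apply, geom_sum_mul, hxs]; simp
  · intro j hj
    obtain ⟨y, hy, hyx⟩ := hrat j hj
    refine ⟨y, hy, hyx, ?_⟩
    rintro _ ⟨v, rfl⟩
    refine ⟨(∑ i ∈ Finset.range j, x ^ i) (y v), ?_⟩
    have h : (x - 1) * (∑ i ∈ Finset.range j, x ^ i) * y = y * (x - 1) := by
      rw [← pow_sub_one_factor, sub_mul, mul_sub, hyx]; simp
    exact congrArg (fun z => z v) h

/-- E2, fixed point free form. -/
lemma e2F {V : Type*} [AddCommGroup V] [Module (ZMod 2) V]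
    [FiniteDimensional (ZMod 2) V] [Nontrivial V] (s : ℕ) (hs : s.Prime) (hqs : s ≠ 2)
    (x d : Module.End (ZMod 2) V) (hgeom : ∑ i ∈ Finset.range s, x ^ i = 0)
    (o : ℕ) (ho : Odd o) (hgd : ∑ i ∈ Finset.range o, d ^ i = 0) (hdx : d * x = x * d)
    (hrat : ∀ j : ℕ, j.Coprime s → ∃ y : Module.End (ZMod 2) V,
      Function.Injective y ∧ y * x = x ^ j * y ∧ d * y = y * d) :
    2 * (s - 1) ≤ finrank (ZMod 2) V := by
  set K := AlgebraicClosure (ZMod 2) with hK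
  haveI : CharP K 2 := charP_of_injective_algebraMap' (ZMod 2) 2
  set V' := TensorProduct (ZMod 2) K V with hV'
  set d' : Module.End K V' := d.baseChange K with hd'
  set x' : Module.End K V' := x.baseChange K with hx'
  have hgd' := baseChange_geom K d o hgd
  have hgx' := baseChange_geom K x s hgeom
  have key : ∀ lam : K, d'.HasEigenvalue lam → s - 1 ≤ finrank K (d'.eigenspace lam) := by
    intro lam hlam
    have hinv : ∀ y : Module.End (ZMod 2) V, d * y = y * d →
        ∀ u ∈ d'.eigenspace lam, (y.baseChange K) u ∈ d'.eigenspace lam := by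
      intro y hy u hu
      rw [Module.End.mem_eigenspace_iff] at hu ⊢
      rw [← Module.End.mul_apply, hd', ← LinearMap.baseChange_mul, hy, LinearMap.baseChange_mul,
        Module.End.mul_apply, ← hd', hu, map_smul]
    refine e1K_sub s hs (castK_ne 2 s hs hqs) _ hlam x' (hinv x hdx) hgx' ?_
    intro j hj
    obtain ⟨y, hy, hyx, hyd⟩ := hrat j hj
    refine ⟨y.baseChange _, baseChange_inj _ y hy, ?_, hinv y hyd⟩
    rw [← LinearMap.baseChange_mul, hyx, LinearMap.baseChange_mul, LinearMap.baseChange_pow]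
  obtain ⟨lam, hlam⟩ := Module.End.exists_eigenvalue d'
  have hlam2 : d'.HasEigenvalue (lam ^ 2) := by
    rw [Module.End.hasEigenvalue_iff_isRoot_charpoly, hd', LinearMap.charpoly_baseChange] at hlam ⊢
    rw [Polynomial.IsRoot, Polynomial.eval_map] at hlam ⊢
    have h := congrArg (frobenius K 2) hlam
    rw [Polynomial.hom_eval₂, map_zero] at h
    have he : (frobenius K 2).comp (algebraMap (ZMod 2) K) = algebraMap (ZMod 2) K := Subsingleton.elim _ _
    rwa [he, frobenius_def] at h
  have hne : lam ≠ lam ^ 2 := by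
    obtain ⟨v, hv⟩ := hlam.exists_hasEigenvector
    have hpow : ∀ i : ℕ, (d' ^ i) v = lam ^ i • v := fun i => hv.pow_apply i
    have h1 : (∑ i ∈ Finset.range o, d' ^ i) v = 0 := by rw [hgd']; rfl
    rw [LinearMap.sum_apply] at h1
    simp only [hpow] at h1
    rw [← Finset.sum_smul] at h1
    have h2 : ∑ i ∈ Finset.range o, lam ^ i = 0 := by
      rcases smul_eq_zero.mp h1 with h | h
      · exact h
      · exact absurd h hv.2
    intro h
    have h3 : lam * (lam - 1) = 0 := by linear_combination -h
    rcases mul_eq_zero.mp h3 with h | h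
    · rw [h] at h2
      obtain ⟨k, rfl⟩ := ho
      rw [Finset.sum_range_succ'] at h2
      simp at h2
    · rw [sub_eq_zero.mp h] at h2
      simp only [one_pow, Finset.sum_const, Finset.card_range, nsmul_eq_mul, mul_one] at h2
      rw [CharP.cast_eq_zero_iff K 2] at h2
      exact (Nat.not_even_iff_odd.mpr ho) (even_iff_two_dvd.mpr h2)
  have h1 := key _ hlam
  have h2 := key _ hlam2
  have hdisj : d'.eigenspace lam ⊓ d'.eigenspace (lam ^ 2) = ⊥ :=
    ((Module.End.eigenspaces_iSupIndep d').pairwiseDisjoint hne).eq_bot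
  have h3 := Submodule.finrank_sup_add_finrank_inf_eq (d'.eigenspace lam) (d'.eigenspace (lam ^ 2))
  rw [hdisj, finrank_bot] at h3
  have h4 := Submodule.finrank_le (d'.eigenspace lam ⊔ d'.eigenspace (lam ^ 2))
  have h5 : finrank K V' = finrank (ZMod 2) V := Module.finrank_baseChange
  omega

/-- E2. -/
lemma e2 {V : Type*} [AddCommGroup V] [Module (ZMod 2) V]
    [FiniteDimensional (ZMod 2) V] (s : ℕ) (hs : s.Prime) (hqs : s ≠ 2)
    (x d : Module.End (ZMod 2) V) (hxs : x ^ s = 1) (o : ℕ) (ho : Odd o) (hdo : d ^ o = 1)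
    (hdx : d * x = x * d) (hne : (x - 1) * (d - 1) ≠ 0)
    (hrat : ∀ j : ℕ, j.Coprime s → ∃ y : Module.End (ZMod 2) V,
      Function.Injective y ∧ y * x = x ^ j * y ∧ d * y = y * d) :
    2 * (s - 1) ≤ finrank (ZMod 2) V := by
  set U := LinearMap.range ((x - 1) * (d - 1)) with hUdef
  have hcom : Commute d x := hdx
  have hcom' : (x - 1) * (d - 1) = (d - 1) * (x - 1) :=
    ((hcom.symm.sub_left (Commute.one_left _)).sub_right (Commute.one_right _)).eq
  have hxU : ∀ u ∈ U, x u ∈ U := by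
    rintro _ ⟨v, rfl⟩
    refine ⟨x v, ?_⟩
    rw [← Module.End.mul_apply, ← Module.End.mul_apply]
    congr 1
    rw [mul_assoc, sub_mul d, hdx, one_mul]
    noncomm_ring
  have hdU : ∀ u ∈ U, d u ∈ U := by
    rintro _ ⟨v, rfl⟩
    refine ⟨d v, ?_⟩
    rw [← Module.End.mul_apply, ← Module.End.mul_apply]
    congr 1
    rw [hcom', mul_assoc, sub_mul x, ← hdx, one_mul]
    noncomm_ring
  haveI : Nontrivial U := (Submodule.nontrivial_iff_ne_bot).mpr (by
    rw [Ne, hUdef, LinearMap.range_eq_bot]; exact hne)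
  refine le_trans (e2F s hs hqs (x.restrict hxU) (d.restrict hdU) (restrict_geom U x hxU s ?_) o ho
    (restrict_geom U d hdU o ?_) ?_ ?_) (Submodule.finrank_le U)
  · rintro _ ⟨v, rfl⟩
    rw [← Module.End.mul_apply, ← mul_assoc, geom_sum_mul, hxs]; simp
  · rintro _ ⟨v, rfl⟩
    rw [← Module.End.mul_apply, hcom', ← mul_assoc, geom_sum_mul, hdo]; simp
  · ext u
    exact congrArg (fun z => z (u : V)) hdx
  · intro j hj
    obtain ⟨y, hy, hyx, hyd⟩ := hrat j hj
    have hyU : ∀ u ∈ U, y u ∈ U := by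
      rintro _ ⟨v, rfl⟩
      refine ⟨(∑ i ∈ Finset.range j, x ^ i) (y v), ?_⟩
      have e1 : y * (x - 1) = (x - 1) * (∑ i ∈ Finset.range j, x ^ i) * y := by
        rw [← pow_sub_one_factor, sub_mul, mul_sub, hyx]; simp
      have e2 : y * (d - 1) = (d - 1) * y := by rw [mul_sub, sub_mul, hyd]; simp
      have e3 : (d - 1) * (∑ i ∈ Finset.range j, x ^ i) = (∑ i ∈ Finset.range j, x ^ i) * (d - 1) := by
        have : Commute (d - 1) (∑ i ∈ Finset.range j, x ^ i) :=
          Commute.sum_right _ _ _ (fun i _ => (hcom.sub_left (Commute.one_left _)).pow_right i)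
        exact this.eq
      have h : (x - 1) * (d - 1) * ((∑ i ∈ Finset.range j, x ^ i) * y) = y * ((x - 1) * (d - 1)) := by
        rw [← mul_assoc y, e1, mul_assoc (x - 1), ← mul_assoc (d - 1), e3]
        simp only [mul_assoc]
        rw [e2]
      exact congrArg (fun z => z v) h
    refine ⟨y.restrict hyU, ?_, ?_, ?_⟩
    · intro a b hab
      have := congrArg Subtype.val hab
      exact Subtype.ext (hy this)
    · ext u
      have := congrArg (fun z => z (u : V)) hyx
      simp only [Module.End.mul_apply] at this ⊢
      rw [restrict_pow_coe]
      exact this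
    · ext u
      exact congrArg (fun z => z (u : V)) hyd

end Stmt15

set_option linter.style.haveILetI false
namespace Stmt15
open Module Equiv

/-- the rotation of `ZMod s` -/
def rot (s : ℕ) : Perm (ZMod s) := Equiv.addRight 1

lemma rot_pow (s j : ℕ) : (rot s) ^ j = Equiv.addRight (j : ZMod s) := by
  induction j with
  | zero => ext a; simp
  | succ j ih =>
    rw [pow_succ, ih]; ext a
    change a + 1 + (j : ZMod s) = a + ((j + 1 : ℕ) : ZMod s)
    push_cast; ring

lemma rot_pow_s (s : ℕ) : (rot s) ^ s = 1 := by rw [rot_pow]; ext a; simp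

lemma rot_rat (s j : ℕ) (hj : j.Coprime s) : ∃ y : Perm (ZMod s), y * rot s = rot s ^ j * y := by
  refine ⟨Units.mulLeft (ZMod.unitOfCoprime j hj), ?_⟩
  rw [rot_pow]; ext a; simp [rot, mul_add]

/-- the `s`-cycle given by an embedding -/
noncomputable def cyc {n s : ℕ} (ι : ZMod s ↪ Fin n) : Perm (Fin n) := Equiv.Perm.viaEmbeddingHom ι (rot s)

lemma cyc_pow {n s : ℕ} (ι : ZMod s ↪ Fin n) : cyc ι ^ s = 1 := by
  rw [cyc, ← map_pow, rot_pow_s, map_one]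

lemma cyc_apply {n s : ℕ} (ι : ZMod s ↪ Fin n) (i : ZMod s) : cyc ι (ι i) = ι (i + 1) := by
  rw [cyc, Equiv.Perm.viaEmbeddingHom_apply, Equiv.Perm.viaEmbedding_apply]; rfl

lemma cyc_ne_one {n s : ℕ} (hs : s.Prime) (ι : ZMod s ↪ Fin n) : cyc ι ≠ 1 := by
  haveI := Fact.mk hs
  intro h
  have := cyc_apply ι 0
  rw [h] at this
  have := ι.injective this
  simp at this

lemma cyc_rat {n s : ℕ} (ι : ZMod s ↪ Fin n) (j : ℕ) (hj : j.Coprime s) :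
    ∃ y : Perm (Fin n), y * cyc ι = cyc ι ^ j * y ∧ ∀ a, a ∉ Set.range ι → y a = a := by
  obtain ⟨y, hy⟩ := rot_rat s j hj
  refine ⟨Equiv.Perm.viaEmbeddingHom ι y, ?_, ?_⟩
  · rw [cyc, ← map_mul, hy, map_mul, map_pow]
  · intro a ha
    rw [Equiv.Perm.viaEmbeddingHom_apply, Equiv.Perm.viaEmbedding_apply_of_notMem _ _ _ ha]

lemma cyc_even {n s : ℕ} (hs : Odd s) (ι : ZMod s ↪ Fin n) : cyc ι ∈ alternatingGroup (Fin n) := by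
  rw [Equiv.Perm.mem_alternatingGroup]
  have h := congrArg Equiv.Perm.sign (cyc_pow ι)
  rw [map_pow, map_one] at h
  rcases Int.units_eq_one_or (Equiv.Perm.sign (cyc ι)) with h1 | h1
  · exact h1
  · rw [h1, hs.neg_one_pow] at h
    exact absurd h (by decide)

lemma exists_outside {n s : ℕ} [NeZero s] (hsn : s + 2 ≤ n) (ι : ZMod s ↪ Fin n) :
    ∃ a b : Fin n, a ≠ b ∧ a ∉ Set.range ι ∧ b ∉ Set.range ι := by
  classical
  have h1 : (Finset.univ.map ι).card = s := by rw [Finset.card_map, Finset.card_univ, ZMod.card]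
  have h2 : 1 < ((Finset.univ.map ι)ᶜ).card := by
    rw [Finset.card_compl, h1, Fintype.card_fin]; omega
  obtain ⟨a, ha, b, hb, hab⟩ := Finset.one_lt_card.mp h2
  exact ⟨a, b, hab, by simpa using ha, by simpa using hb⟩

lemma swap_comm_of_fix {α : Type*} [DecidableEq α] (y : Perm α) (a b : α) (ha : y a = a) (hb : y b = b) :
    swap a b * y = y * swap a b := by
  rw [Equiv.swap_mul_eq_mul_swap]
  congr 2
  · rw [Equiv.Perm.inv_eq_iff_eq, ha]
  · rw [Equiv.Perm.inv_eq_iff_eq, hb]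

lemma cyc_fix {n s : ℕ} (ι : ZMod s ↪ Fin n) (a : Fin n) (ha : a ∉ Set.range ι) : cyc ι a = a := by
  rw [cyc, Equiv.Perm.viaEmbeddingHom_apply, Equiv.Perm.viaEmbedding_apply_of_notMem _ _ _ ha]

lemma cyc_rat_even {n s : ℕ} [NeZero s] (hsn : s + 2 ≤ n) (ι : ZMod s ↪ Fin n) (j : ℕ) (hj : j.Coprime s) :
    ∃ y ∈ alternatingGroup (Fin n), y * cyc ι = cyc ι ^ j * y := by
  obtain ⟨y, hy, hya⟩ := cyc_rat ι j hj
  obtain ⟨a, b, hab, ha, hb⟩ := exists_outside hsn ι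
  rcases Int.units_eq_one_or (Equiv.Perm.sign y) with h1 | h1
  · exact ⟨y, Equiv.Perm.mem_alternatingGroup.mpr h1, hy⟩
  · refine ⟨y * swap a b, ?_, ?_⟩
    · rw [Equiv.Perm.mem_alternatingGroup, map_mul, h1, Equiv.Perm.sign_swap hab]; decide
    · rw [mul_assoc, swap_comm_of_fix _ _ _ (cyc_fix ι a ha) (cyc_fix ι b hb), ← mul_assoc, hy, mul_assoc]

lemma alt_le {n : ℕ} (hn : 5 ≤ n) (H : Subgroup (Perm (Fin n))) [H.Normal] (x : Perm (Fin n)) (hx : x ∈ H)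
    (hx1 : x ≠ 1) : alternatingGroup (Fin n) ≤ H := by
  apply Equiv.Perm.alternatingGroup_le_of_normal (by simpa using hn)
  rw [Subgroup.nontrivial_iff_exists_ne_one]
  exact ⟨x, hx, hx1⟩

end Stmt15

set_option linter.style.haveILetI false
namespace Stmt15
open Module Equiv

section W
variable {V : Type*} [AddCommGroup V] [Module (ZMod 2) V]

lemma two_zero (v : V) : v + v = 0 := by
  rw [← two_smul (ZMod 2) v]
  have : (2 : ZMod 2) = 0 := by decide
  rw [this, zero_smul]

variable {n : ℕ} (ρ : Perm (Fin n) →* Module.End (ZMod 2) V)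

lemma rho_inj (π : Perm (Fin n)) : Function.Injective (ρ π) := by
  intro a b hab
  have := congrArg (ρ π⁻¹) hab
  rw [← Module.End.mul_apply, ← Module.End.mul_apply, ← map_mul, inv_mul_cancel, map_one] at this
  exact this

variable [FiniteDimensional (ZMod 2) V]

lemma w1 (s : ℕ) (hs : s.Prime) (hs2 : s ≠ 2) (ι : ZMod s ↪ Fin n)
    (hdim : finrank (ZMod 2) V < 2 * (s - 1)) (a b : Fin n) (ha : a ∉ Set.range ι) (hb : b ∉ Set.range ι) :
    (ρ (swap a b) - 1) * (ρ (cyc ι) - 1) = 0 := by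
  by_contra hne
  set T := ρ (swap a b) with hT
  set X := ρ (cyc ι) with hX
  have hTX : T * X = X * T := by
    rw [hT, hX, ← map_mul, swap_comm_of_fix _ _ _ (cyc_fix ι a ha) (cyc_fix ι b hb), map_mul]
  have hXs : X ^ s = 1 := by rw [hX, ← map_pow, cyc_pow, map_one]
  have hTT : T * T = 1 := by rw [hT, ← map_mul, swap_mul_self, map_one]
  have hcom : (T - 1) * (X - 1) = (X - 1) * (T - 1) := by
    have hc : Commute T X := hTX
    exact ((hc.sub_left (Commute.one_left _)).sub_right (Commute.one_right _)).eq
  have h1 := e1S 2 s hs hs2 (LinearMap.range ((T - 1) * (X - 1))) (by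
    rw [Ne, LinearMap.range_eq_bot]; exact hne) X ?_ ?_ ?_
  · have hsq : (T - 1) * (T - 1) = 0 := by
      ext v
      have : (T * T) v = v := by rw [hTT]; rfl
      simp only [Module.End.mul_apply, LinearMap.sub_apply, Module.End.one_apply, map_sub] at this ⊢
      rw [this]
      have h := two_zero (v - T v)
      have e : v - T v - (T v - v) = v - T v + (v - T v) := by abel
      rw [e, h]; rfl
    have hle : LinearMap.range (T - 1) ≤ LinearMap.ker (T - 1) := by
      rintro _ ⟨v, rfl⟩
      exact congrArg (fun z => z v) hsq
    have h2 := LinearMap.finrank_range_add_finrank_ker (T - 1)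
    have h3 := Submodule.finrank_mono hle
    have h4 : LinearMap.range ((T - 1) * (X - 1)) ≤ LinearMap.range (T - 1) := by
      rintro _ ⟨v, rfl⟩
      exact ⟨(X - 1) v, rfl⟩
    have h5 := Submodule.finrank_mono h4
    omega
  · rintro _ ⟨v, rfl⟩
    refine ⟨X v, ?_⟩
    have h : (T - 1) * (X - 1) * X = X * ((T - 1) * (X - 1)) := by
      rw [hcom, mul_assoc, sub_mul T, hTX]; noncomm_ring
    exact congrArg (fun z => z v) h
  · rintro _ ⟨v, rfl⟩
    rw [← Module.End.mul_apply, hcom, ← mul_assoc, geom_sum_mul, hXs]; simp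
  · intro j hj
    obtain ⟨y, hy, hya⟩ := cyc_rat ι j hj
    refine ⟨ρ y, rho_inj ρ y, by rw [hX, ← map_mul, hy, map_mul, map_pow], ?_⟩
    have hTy : T * ρ y = ρ y * T := by
      rw [hT, ← map_mul, swap_comm_of_fix _ _ _ (hya a ha) (hya b hb), map_mul]
    have hyX : ρ y * X = X ^ j * ρ y := by rw [hX, ← map_mul, hy, map_mul, map_pow]
    rintro _ ⟨v, rfl⟩
    refine ⟨(∑ i ∈ Finset.range j, X ^ i) (ρ y v), ?_⟩
    have h : (T - 1) * (X - 1) * ((∑ i ∈ Finset.range j, X ^ i) * ρ y) = ρ y * ((T - 1) * (X - 1)) := by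
      have e1 : (X - 1) * ((∑ i ∈ Finset.range j, X ^ i) * ρ y) = ρ y * (X - 1) := by
        rw [← mul_assoc, ← pow_sub_one_factor, sub_mul, mul_sub, hyX]; simp
      have e2 : (T - 1) * ρ y = ρ y * (T - 1) := by rw [sub_mul, mul_sub, hTy]; simp
      rw [mul_assoc, e1, ← mul_assoc, ← mul_assoc, e2]
    exact congrArg (fun z => z v) h

lemma w2 (s : ℕ) (hs : s.Prime) (hs5 : 5 ≤ s) (hsn : s + 2 ≤ n) (ι : ZMod s ↪ Fin n)
    (hdim : finrank (ZMod 2) V < 2 * (s - 1)) (u : Fin 5 ↪ Fin n) :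
    (ρ (swap (u 0) (u 1)) - 1) * (ρ (swap (u 2) (u 3) * swap (u 3) (u 4)) - 1) = 0 := by
  haveI := Fact.mk hs
  obtain ⟨a, b, hab, ha, hb⟩ := exists_outside hsn ι
  set c := ι 0 with hc
  set d := ι 1 with hd
  set e := ι 2 with he
  have hcd : (0 : ZMod s) ≠ 1 := zero_ne_one
  have h02 : (0 : ZMod s) ≠ 2 := by
    intro h
    have : ((2 : ℕ) : ZMod s) = 0 := by simpa using h.symm
    rw [ZMod.natCast_eq_zero_iff] at this
    have := Nat.le_of_dvd (by norm_num) this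
    omega
  have h12 : (1 : ZMod s) ≠ 2 := by
    intro h
    apply hcd
    have : (1 : ZMod s) + 0 = 1 + 1 := by rw [add_zero, one_add_one_eq_two]; exact h
    exact add_left_cancel this
  have hac : ∀ i, a ≠ ι i := fun i h => ha ⟨i, h.symm⟩
  have hbc : ∀ i, b ≠ ι i := fun i h => hb ⟨i, h.symm⟩
  have hmain : (ρ (swap a b) - 1) * (ρ (swap c d * swap d e) - 1) = 0 := by
    have hz : swap c d * swap d e = (swap c d * cyc ι * swap c d) * (cyc ι)⁻¹ := by
      have h1 : cyc ι c = d := by rw [hc, cyc_apply, zero_add]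
      have h2 : cyc ι d = e := by rw [hd, cyc_apply, one_add_one_eq_two]
      rw [← h2, ← h1, mul_assoc, mul_assoc, ← mul_assoc (cyc ι), Equiv.swap_apply_apply (cyc ι), h1]
    have hX := w1 ρ s hs (by omega) ι hdim a b ha hb
    set T := ρ (swap a b) with hT
    have hTc : T * ρ (swap c d) = ρ (swap c d) * T := by
      rw [hT, ← map_mul, swap_comm_of_fix (swap c d) a b
        (swap_apply_of_ne_of_ne (hac _) (hac _)) (swap_apply_of_ne_of_ne (hbc _) (hbc _)), map_mul]
    have hTY : (T - 1) * (ρ (swap c d * cyc ι * swap c d) - 1) = 0 := by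
      have hcc : ρ (swap c d) * ρ (swap c d) = 1 := by rw [← map_mul, swap_mul_self, map_one]
      have e1 : ρ (swap c d * cyc ι * swap c d) - 1 = ρ (swap c d) * (ρ (cyc ι) - 1) * ρ (swap c d) := by
        rw [map_mul, map_mul, mul_sub, sub_mul, mul_one, hcc]
      rw [e1, ← mul_assoc, ← mul_assoc, sub_mul, hTc, one_mul]
      have e2 : ρ (swap c d) * T - ρ (swap c d) = ρ (swap c d) * (T - 1) := by rw [mul_sub, mul_one]
      rw [e2, mul_assoc (ρ (swap c d)), hX]; simp
    have e3 : ρ (swap c d * swap d e) - 1 =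
        ((ρ (swap c d * cyc ι * swap c d) - 1) - (ρ (cyc ι) - 1)) * ρ ((cyc ι)⁻¹) := by
      rw [hz, map_mul _ _ (cyc ι)⁻¹, sub_sub_sub_cancel_right, sub_mul, ← map_mul ρ (cyc ι),
        mul_inv_cancel, map_one]
    rw [e3, ← mul_assoc, mul_sub, hTY, hX]; simp
  have hcinj : Function.Injective (![a, b, c, d, e] : Fin 5 → Fin n) := by
    have e1 : c ≠ d := fun h => hcd (ι.injective h)
    have e2 : c ≠ e := fun h => h02 (ι.injective h)
    have e3 : d ≠ e := fun h => h12 (ι.injective h)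
    have := hac 0
    have := hac 1
    have := hac 2
    have := hbc 0
    have := hbc 1
    have := hbc 2
    intro i j hij
    fin_cases i <;> fin_cases j <;> simp_all
  obtain ⟨π, hπ⟩ := (MulAction.isMultiplyPretransitive_iff.mp
    (Equiv.Perm.isMultiplyPretransitive (Fin n) 5)) ⟨_, hcinj⟩ u
  have hπi : ∀ i, π ((![a, b, c, d, e] : Fin 5 → Fin n) i) = u i := fun i =>
    congrArg (fun w : Fin 5 ↪ Fin n => w i) hπ
  have p0 : π a = u 0 := hπi 0
  have p1 : π b = u 1 := hπi 1
  have p2 : π c = u 2 := hπi 2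
  have p3 : π d = u 3 := hπi 3
  have p4 : π e = u 4 := hπi 4
  rw [← p0, ← p1, ← p2, ← p3, ← p4, Equiv.swap_apply_apply, Equiv.swap_apply_apply, Equiv.swap_apply_apply]
  have conj : ∀ w : Perm (Fin n), ρ (π * w * π⁻¹) - 1 = ρ π * (ρ w - 1) * ρ π⁻¹ := by
    intro w
    rw [map_mul, map_mul, mul_sub, sub_mul, mul_one, ← map_mul ρ π π⁻¹, mul_inv_cancel, map_one]
  have e5 : π * swap c d * π⁻¹ * (π * swap d e * π⁻¹) = π * (swap c d * swap d e) * π⁻¹ := by group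
  rw [e5, conj, conj]
  have e6 : ρ π⁻¹ * ρ π = 1 := by rw [← map_mul, inv_mul_cancel, map_one]
  calc _ = ρ π * ((ρ (swap a b) - 1) * ((ρ π⁻¹ * ρ π) * (ρ (swap c d * swap d e) - 1))) * ρ π⁻¹ := by
        noncomm_ring
    _ = 0 := by rw [e6, one_mul, hmain]; simp

end W
end Stmt15

set_option linter.style.haveILetI false
namespace Stmt15
open Module Equiv

/-- stabilizer of a vector -/
def stabV {V : Type*} [AddCommGroup V] [Module (ZMod 2) V] {n : ℕ}
    (ρ : Perm (Fin n) →* Module.End (ZMod 2) V) (v : V) : Subgroup (Perm (Fin n)) where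
  carrier := {π | ρ π v = v}
  one_mem' := by simp
  mul_mem' := by
    intro a b ha hb
    simp only [Set.mem_ofPred_eq] at *
    rw [map_mul, Module.End.mul_apply, hb, ha]
  inv_mem' := by
    intro a ha
    simp only [Set.mem_ofPred_eq] at *
    nth_rewrite 1 [← ha]
    rw [← Module.End.mul_apply, ← map_mul, inv_mul_cancel, map_one]; rfl

lemma mem_stabV {V : Type*} [AddCommGroup V] [Module (ZMod 2) V] {n : ℕ}
    (ρ : Perm (Fin n) →* Module.End (ZMod 2) V) (v : V) (π : Perm (Fin n)) :
    π ∈ stabV ρ v ↔ ρ π v = v := Iff.rfl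

lemma swap_conj' {n : ℕ} (H : Subgroup (Perm (Fin n))) (π : Perm (Fin n)) (hπ : π ∈ H) (a b : Fin n)
    (h : swap a b ∈ H) : swap (π a) (π b) ∈ H := by
  rw [Equiv.swap_apply_apply]
  exact H.mul_mem (H.mul_mem hπ h) (H.inv_mem hπ)

/-- from a good vector to the dimension bound -/
lemma w4 {V : Type*} [AddCommGroup V] [Module (ZMod 2) V] [FiniteDimensional (ZMod 2) V] {n : ℕ}
    (ρ : Perm (Fin n) →* Module.End (ZMod 2) V) (v : V) (p q l : Fin n) (hpq : p ≠ q) (hpl : p ≠ l)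
    (hql : q ≠ l) (h1 : swap p q ∈ stabV ρ v)
    (h2 : ∀ a b, a ≠ p → a ≠ q → b ≠ p → b ≠ q → swap a b ∈ stabV ρ v)
    (h3 : swap q l ∉ stabV ρ v) : n - 2 ≤ finrank (ZMod 2) V := by
  classical
  let w : Fin n → V := fun i => ρ (swap q i) v
  have hli : LinearIndependent (ZMod 2) (fun i : {i : Fin n // i ≠ p ∧ i ≠ l} => w i) := by
    rw [linearIndependent_iff']
    intro S g hg i0 hi0
    by_contra hgi
    have hi0p := i0.2.1
    have hi0l := i0.2.2
    have hfix : ∀ i : {i : Fin n // i ≠ p ∧ i ≠ l}, i ≠ i0 → ρ (swap i0.1 l) (w i) = w i := by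
      intro i hi
      have hi' : i.1 ≠ i0.1 := fun h => hi (Subtype.ext h)
      change ρ (swap i0.1 l) (ρ (swap q i) v) = ρ (swap q i) v
      rw [← Module.End.mul_apply, ← map_mul]
      rw [Equiv.swap_mul_eq_mul_swap, map_mul, Module.End.mul_apply]
      congr 1
      rw [← mem_stabV, swap_inv]
      rw [swap_apply_of_ne_of_ne hql.symm i.2.2.symm]
      apply h2
      · intro h
        have : i0.1 = swap q i.1 p := ((swap q i.1).symm_apply_eq.mpr h.symm).symm.trans (by rw [symm_swap])
        rw [swap_apply_of_ne_of_ne hpq i.2.1.symm] at this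
        exact hi0p this
      · intro h
        have : i0.1 = swap q i.1 q := ((swap q i.1).symm_apply_eq.mpr h.symm).symm.trans (by rw [symm_swap])
        rw [swap_apply_left] at this
        exact hi' this.symm
      · exact hpl.symm
      · exact hql.symm
    have hmov : ρ (swap i0.1 l) (w i0) = w l := by
      change ρ (swap i0.1 l) (ρ (swap q i0) v) = ρ (swap q l) v
      by_cases hq : i0.1 = q
      · rw [hq, swap_self]; change ρ _ (ρ 1 v) = _; simp
      · rw [← Module.End.mul_apply, ← map_mul]
        have : swap i0.1 l * swap q i0.1 = swap q l * swap i0.1 l := by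
          rw [Equiv.mul_swap_eq_swap_mul, swap_apply_of_ne_of_ne (Ne.symm hq) hql, swap_apply_left]
        rw [this, map_mul, Module.End.mul_apply]
        congr 1
        exact h2 _ _ hi0p hq hpl.symm hql.symm
    have hsum := congrArg (ρ (swap i0.1 l)) hg
    rw [map_sum, map_zero] at hsum
    have hdiff : ∑ i ∈ S, (ρ (swap i0.1 l) (g i • w i) - g i • w i) = 0 := by
      rw [Finset.sum_sub_distrib, hsum, hg, sub_zero]
    rw [Finset.sum_eq_single i0] at hdiff
    · rw [map_smul, hmov, ← smul_sub] at hdiff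
      rcases smul_eq_zero.mp hdiff with h | h
      · exact hgi h
      · have hwl : ρ (swap q l) v = ρ (swap q i0) v := sub_eq_zero.mp h
        by_cases hq : i0.1 = q
        · apply h3
          rw [mem_stabV, hwl, hq, swap_self]; change ρ 1 v = _; simp
        · have hc : swap q i0.1 * swap q l ∈ stabV ρ v := by
            rw [mem_stabV, map_mul, Module.End.mul_apply, hwl, ← Module.End.mul_apply, ← map_mul]; simp
          have h5 := swap_conj' _ _ hc p q h1
          have e1 : (swap q i0.1 * swap q l) p = p := by
            rw [Equiv.Perm.mul_apply, swap_apply_of_ne_of_ne hpq hpl, swap_apply_of_ne_of_ne hpq hi0p.symm]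
          have e2 : (swap q i0.1 * swap q l) q = l := by
            rw [Equiv.Perm.mul_apply, swap_apply_left, swap_apply_of_ne_of_ne hql.symm hi0l.symm]
          rw [e1, e2] at h5
          have h6 := swap_conj' _ _ h1 p l h5
          rw [swap_apply_left, swap_apply_of_ne_of_ne hpl.symm hql.symm] at h6
          exact h3 h6
    · intro b _ hb
      rw [map_smul, hfix b hb, sub_self]
    · intro h; exact absurd hi0 h
  have hcard := hli.fintype_card_le_finrank
  have : Fintype.card {i : Fin n // i ≠ p ∧ i ≠ l} = n - 2 := by
    rw [Fintype.card_subtype]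
    have : (Finset.univ.filter (fun i : Fin n => i ≠ p ∧ i ≠ l)) = ({p, l} : Finset (Fin n))ᶜ := by
      ext i; simp
    rw [this, Finset.card_compl, Finset.card_pair hpl, Fintype.card_fin]
  omega

lemma w5 {V : Type*} [AddCommGroup V] [Module (ZMod 2) V] [FiniteDimensional (ZMod 2) V] {n : ℕ}
    (hn : 5 ≤ n) (ρ : Perm (Fin n) →* Module.End (ZMod 2) V)
    (hA : ∀ u : Fin 5 ↪ Fin n,
      (ρ (swap (u 0) (u 1)) - 1) * (ρ (swap (u 2) (u 3) * swap (u 3) (u 4)) - 1) = 0)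
    (p q l : Fin n) (hpq : p ≠ q) (hpl : p ≠ l) (hql : q ≠ l)
    (hz1 : ρ (swap p q * swap q l) ≠ 1) : n - 2 ≤ finrank (ZMod 2) V := by
  classical
  have hA' : ∀ a b c d e : Fin n, a ≠ b → a ≠ c → a ≠ d → a ≠ e → b ≠ c → b ≠ d → b ≠ e → c ≠ d → c ≠ e →
      d ≠ e → ∀ w : V, ρ (swap a b) ((ρ (swap c d * swap d e) - 1) w) = (ρ (swap c d * swap d e) - 1) w := by
    intro a b c d e h1 h2 h3 h4 h5 h6 h7 h8 h9 h10 w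
    have hinj : Function.Injective (![a, b, c, d, e] : Fin 5 → Fin n) := by
      intro i j hij
      fin_cases i <;> fin_cases j <;> simp_all
    have := congrArg (fun z => z w) (hA ⟨_, hinj⟩)
    have this : (ρ (swap a b) - 1) ((ρ (swap c d * swap d e) - 1) w) = 0 := this
    rw [LinearMap.sub_apply, Module.End.one_apply] at this
    exact sub_eq_zero.mp this
  set t := swap p q with ht
  set z := swap p q * swap q l with hz
  set D := LinearMap.range (ρ z - 1) with hD
  have hz3 : z * z * z = 1 := by
    have e : swap q l * swap p q * swap q l = swap p q * swap q l * swap p q := by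
      have a1 : swap q l * swap p q * swap q l = swap p l := by
        have := Equiv.swap_apply_apply (swap q l) p q
        rw [swap_apply_of_ne_of_ne hpq hpl, swap_apply_left, swap_inv] at this
        exact this.symm
      have a2 : swap p q * swap q l * swap p q = swap p l := by
        have := Equiv.swap_apply_apply (swap p q) q l
        rw [swap_apply_right, swap_apply_of_ne_of_ne hpl.symm hql.symm, swap_inv] at this
        exact this.symm
      rw [a1, a2]
    calc z * z * z = swap p q * (swap q l * swap p q * swap q l) * swap p q * swap q l := by
          rw [hz]; group
      _ = (swap p q * swap p q) * swap q l * (swap p q * swap p q) * swap q l := by rw [e]; group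
      _ = 1 := by simp
  have hDfix : ∀ v ∈ D, ρ z v = v → v = 0 := by
    rintro _ ⟨w, rfl⟩ hv
    set v := (ρ z - 1) w with hvd
    have e1 : ρ z w = w + v := by rw [hvd]; simp
    have e2 : ρ (z * z * z) w = w + v + v + v := by
      rw [map_mul, map_mul, Module.End.mul_apply, Module.End.mul_apply, e1, map_add, e1, hv, map_add,
        map_add, e1, hv]
    rw [hz3, map_one, Module.End.one_apply, add_assoc (w + v), two_zero, add_zero] at e2
    exact left_eq_add.mp e2
  have hDz : ∀ e ∈ D, ρ z⁻¹ e ∈ D := by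
    rintro _ ⟨w, rfl⟩
    refine ⟨ρ z⁻¹ w, ?_⟩
    simp only [LinearMap.sub_apply, Module.End.one_apply, map_sub]
    rw [← Module.End.mul_apply, ← Module.End.mul_apply, ← map_mul, ← map_mul]; simp
  have htz : t * z = z⁻¹ * t := by
    rw [hz, ht, mul_inv_rev, swap_inv, swap_inv]; simp
  have hDt : ∀ e ∈ D, ρ t e ∈ D := by
    rintro _ ⟨w, rfl⟩
    have h : ρ t ((ρ z - 1) w) = - (ρ z⁻¹ ((ρ z - 1) (ρ t w))) := by
      simp only [LinearMap.sub_apply, Module.End.one_apply, map_sub]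
      rw [← Module.End.mul_apply, ← Module.End.mul_apply, ← Module.End.mul_apply, ← Module.End.mul_apply,
        ← map_mul, ← map_mul, ← map_mul, ← map_mul, htz]
      simp
    rw [h]
    exact D.neg_mem (hDz _ ⟨_, rfl⟩)
  obtain ⟨e, heD, he⟩ : ∃ e ∈ D, ρ t e ≠ e := by
    by_contra hcon
    push Not at hcon
    apply hz1
    have hall : ∀ e ∈ D, ρ z e = e := by
      intro e he
      have e1 : z = t * z * t * z⁻¹ := by
        have htt : t * t = 1 := swap_mul_self _ _
        rw [htz, mul_assoc z⁻¹, htt, mul_one, eq_mul_inv_iff_mul_eq, eq_inv_iff_mul_eq_one]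
        exact hz3
      have h1 := hcon _ (hDz e he)
      have h2 : ρ (z * t * z⁻¹) e = e := by
        rw [map_mul, map_mul, Module.End.mul_apply, Module.End.mul_apply, h1, ← Module.End.mul_apply,
          ← map_mul]; simp
      have e2 : z = t * (z * t * z⁻¹) := by rw [← mul_assoc, ← mul_assoc, ← e1]
      rw [e2, map_mul, Module.End.mul_apply, h2, hcon e he]
    ext w
    have h0 := hDfix _ ⟨w, rfl⟩ (hall _ ⟨w, rfl⟩)
    rw [LinearMap.sub_apply] at h0
    exact sub_eq_zero.mp h0
  set v := ρ t e - e with hv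
  have hvD : v ∈ D := D.sub_mem (hDt e heD) heD
  have hv0 : v ≠ 0 := sub_ne_zero.mpr he
  have hst : t ∈ stabV ρ v := by
    rw [mem_stabV, hv, map_sub, ← Module.End.mul_apply, ← map_mul, ht, swap_mul_self, map_one,
      Module.End.one_apply]
    have := two_zero (e - ρ (swap p q) e)
    rw [← sub_eq_zero]
    rw [← this]; abel
  have hsw : ∀ a b, a ≠ b → a ≠ p → a ≠ q → a ≠ l → b ≠ p → b ≠ q → b ≠ l → swap a b ∈ stabV ρ v := by
    intro a b h0 h1 h2 h3 h4 h5 h6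
    obtain ⟨w, hw⟩ := hvD
    rw [mem_stabV, ← hw]
    exact hA' a b p q l h0 h1 h2 h3 h4 h5 h6 hpq hpl hql w
  have hsl : ∀ b, b ≠ p → b ≠ q → b ≠ l → swap l b ∈ stabV ρ v := by
    intro b h1 h2 h3
    obtain ⟨c, hc⟩ : ∃ c, c ∉ ({p, q, l, b} : Finset (Fin n)) := by
      by_contra hcon
      push Not at hcon
      have h : (Finset.univ : Finset (Fin n)) ⊆ {p, q, l, b} := fun c _ => hcon c
      have h := Finset.card_le_card h
      rw [Finset.card_univ, Fintype.card_fin] at h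
      have := Finset.card_le_four (a := p) (b := q) (c := l) (d := b)
      omega
    simp only [Finset.mem_insert, Finset.mem_singleton, not_or] at hc
    obtain ⟨c1, c2, c3, c4⟩ := hc
    have hz' : swap l b * swap b c ∈ stabV ρ v := by
      have hcomm : t * (swap l b * swap b c) = (swap l b * swap b c) * t := by
        apply swap_comm_of_fix
        · rw [Equiv.Perm.mul_apply, swap_apply_of_ne_of_ne h1.symm (Ne.symm c1),
            swap_apply_of_ne_of_ne hpl h1.symm]
        · rw [Equiv.Perm.mul_apply, swap_apply_of_ne_of_ne h2.symm (Ne.symm c2),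
            swap_apply_of_ne_of_ne hql h2.symm]
      have h := hA' p q l b c hpq hpl h1.symm (Ne.symm c1) hql h2.symm (Ne.symm c2) h3.symm (Ne.symm c3)
        (Ne.symm c4) e
      rw [← ht, LinearMap.sub_apply, Module.End.one_apply, map_sub, ← Module.End.mul_apply, ← map_mul,
        hcomm, map_mul, Module.End.mul_apply] at h
      rw [mem_stabV, hv, map_sub]
      have h' := sub_eq_sub_iff_sub_eq_sub.mp h
      exact h'
    have h := (stabV ρ v).mul_mem hz' (hsw b c (Ne.symm c4) h1 h2 h3 c1 c2 c3)
    rwa [mul_assoc, swap_mul_self, mul_one] at h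
  refine w4 ρ v p q l hpq hpl hql hst ?_ ?_
  · intro a b h1 h2 h3 h4
    by_cases hab : a = b
    · rw [hab, swap_self]; exact (stabV ρ v).one_mem
    by_cases ha : a = l
    · rw [ha]; exact hsl b h3 h4 (fun h => hab (ha.trans h.symm))
    by_cases hb : b = l
    · rw [hb, swap_comm]; exact hsl a h1 h2 ha
    exact hsw a b hab h1 h2 ha h3 h4 hb
  · intro h
    have hzs : z ∈ stabV ρ v := (stabV ρ v).mul_mem hst h
    exact hv0 (hDfix v hvD hzs)

lemma wagner {V : Type*} [AddCommGroup V] [Module (ZMod 2) V] [FiniteDimensional (ZMod 2) V] {n : ℕ}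
    (hn : 5 ≤ n) (ρ : Perm (Fin n) →* Module.End (ZMod 2) V) (s : ℕ) (hs : s.Prime) (hs5 : 5 ≤ s)
    (ι : ZMod s ↪ Fin n) (hdim : finrank (ZMod 2) V < 2 * (s - 1)) (hx : ρ (cyc ι) ≠ 1) :
    n - 2 ≤ finrank (ZMod 2) V := by
  by_cases hsn : s + 2 ≤ n
  · let p : Fin n := ⟨0, by omega⟩
    let q : Fin n := ⟨1, by omega⟩
    let l : Fin n := ⟨2, by omega⟩
    have hpq : p ≠ q := by simp [p, q]
    have hpl : p ≠ l := by simp [p, l]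
    have hql : q ≠ l := by simp [q, l]
    refine w5 hn ρ (w2 ρ s hs hs5 hsn ι hdim) p q l hpq hpl hql ?_
    intro h
    apply hx
    have := alt_le hn ρ.ker (swap p q * swap q l) h (by
      intro h1
      have := congrArg (fun z => z p) h1
      simp only [Equiv.Perm.mul_apply, Equiv.Perm.one_apply] at this
      rw [swap_apply_of_ne_of_ne hpq hpl, swap_apply_left] at this
      exact hpq this.symm)
    exact this (cyc_even (hs.odd_of_ne_two (by omega)) ι)
  · have := e1 2 s hs (by omega) (ρ (cyc ι)) (by rw [← map_pow, cyc_pow, map_one]) hx (by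
      intro j hj
      obtain ⟨y, hy, -⟩ := cyc_rat ι j hj
      exact ⟨ρ y, rho_inj ρ y, by rw [← map_mul, hy, map_mul, map_pow]⟩)
    omega

end Stmt15

set_option linter.style.haveILetI false
namespace Stmt15
open Module
universe u

lemma vle (q n k : ℕ) (hq : q.Prime) (hn : n ≠ 0) (h : q ^ k ∣ n.factorial) : (q - 1) * k < n := by
  haveI := Fact.mk hq
  have h1 := sub_one_mul_padicValNat_factorial_lt_of_ne_zero (p := q) hn
  have h2 : k ≤ padicValNat q n.factorial :=
    (padicValNat_dvd_iff_le n.factorial_ne_zero).mp h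
  exact lt_of_le_of_lt (Nat.mul_le_mul_left _ h2) h1

section act
variable {Y : Type*} [Group Y] {R : Type u} [Group R] (ρ : Y →* MulAut R)

/-- invariant subgroup -/
def Inv (W : Subgroup R) : Prop := ∀ y, ∀ w ∈ W, ρ y w ∈ W

/-- no proper nontrivial invariant normal subgroups -/
def Irr : Prop := ∀ W : Subgroup R, W.Normal → Inv ρ W → W = ⊥ ∨ W = ⊤

lemma act_inv_act (y : Y) (r : R) : ρ y⁻¹ (ρ y r) = r := by
  rw [← MulAut.mul_apply, ← map_mul]; simp

lemma act_act_inv (y : Y) (r : R) : ρ y (ρ y⁻¹ r) = r := by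
  rw [← MulAut.mul_apply, ← map_mul]; simp

/-- restricted action -/
def resAct (W : Subgroup R) (h : Inv ρ W) : Y →* MulAut W where
  toFun y :=
    { toFun := fun w => ⟨ρ y w, h y w w.2⟩
      invFun := fun w => ⟨ρ y⁻¹ w, h y⁻¹ w w.2⟩
      left_inv := fun w => Subtype.ext (act_inv_act ρ y w)
      right_inv := fun w => Subtype.ext (act_act_inv ρ y w)
      map_mul' := fun a b => Subtype.ext (map_mul (ρ y) (a : R) (b : R)) }
  map_one' := by ext w; simp
  map_mul' := fun a b => by ext w; simp

lemma resAct_apply (W : Subgroup R) (h : Inv ρ W) (y : Y) (w : W) : (resAct ρ W h y w : R) = ρ y w := rfl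

/-- quotient action -/
def quoAct (W : Subgroup R) [W.Normal] (h : Inv ρ W) : Y →* MulAut (R ⧸ W) where
  toFun y := QuotientGroup.congr W W (ρ y) (by
    apply le_antisymm
    · rintro _ ⟨w, hw, rfl⟩; exact h y w hw
    · intro w hw; exact ⟨ρ y⁻¹ w, h y⁻¹ w hw, act_act_inv ρ y w⟩)
  map_one' := by
    ext w; induction w using QuotientGroup.induction_on with | _ w => simp
  map_mul' := fun a b => by
    ext w; induction w using QuotientGroup.induction_on with | _ w => simp

lemma quoAct_apply (W : Subgroup R) [W.Normal] (h : Inv ρ W) (y : Y) (r : R) :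
    quoAct ρ W h y (r : R ⧸ W) = ((ρ y r : R) : R ⧸ W) := rfl

end act

theorem red (q s : ℕ) [Fact q.Prime] (hs : s.Prime) (hqs : s ≠ q) {Y : Type*} [Group Y] (x : Y)
    (hx : x ^ s = 1) : ∀ m : ℕ, ∀ (R : Type u) [Group R] [Finite R], IsPGroup q R →
    ∀ (ρ : Y →* MulAut R), ρ x ≠ 1 → Nat.card R = m →
    ∃ (V : Type u) (_ : CommGroup V) (_ : Finite V) (ρ' : Y →* MulAut V), (∀ v : V, v ^ q = 1) ∧ Irr ρ' ∧
      ρ' x ≠ 1 ∧ Nat.card V ≤ Nat.card R ∧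
      (Nat.card V = Nat.card R → ∃ e : R ≃* V, ∀ y r, e (ρ y r) = ρ' y (e r)) := by
  intro m
  induction m using Nat.strong_induction_on with
  | _ m IH =>
  intro R _ _ hR ρ hρx hm
  by_cases hirr : Irr ρ
  · haveI : Nontrivial R := by
      by_contra h
      rw [not_nontrivial_iff_subsingleton] at h
      exact hρx (by ext r; exact Subsingleton.elim _ _)
    have hcen : Subgroup.center R = ⊤ := by
      rcases hirr (Subgroup.center R) inferInstance (by
        intro y w hw
        rw [Subgroup.mem_center_iff] at hw ⊢
        intro g
        have := congrArg (ρ y) (hw (ρ y⁻¹ g))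
        rwa [map_mul, map_mul, act_act_inv] at this) with h | h
      · have := hR.center_nontrivial
        rw [h] at this
        exact absurd this (by simpa using not_nontrivial (⊥ : Subgroup R))
      · exact h
    have hcomm : ∀ a b : R, a * b = b * a := by
      intro a b
      have : b ∈ Subgroup.center R := by rw [hcen]; trivial
      exact (Subgroup.mem_center_iff.mp this a)
    let cg : CommGroup R := { ‹Group R› with mul_comm := hcomm }
    have hexp : ∀ v : R, v ^ q = 1 := by
      let W : Subgroup R :=
        { carrier := {v | v ^ q = 1}
          one_mem' := one_pow q
          mul_mem' := by
            intro a b ha hb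
            simp only [Set.mem_ofPred_eq] at *
            rw [(show Commute a b from hcomm a b).mul_pow, ha, hb, one_mul]
          inv_mem' := by
            intro a ha
            simp only [Set.mem_ofPred_eq] at *
            rw [inv_pow, ha, inv_one] }
      have hW : W.Normal := ⟨fun a ha g => by rw [hcomm g a]; simpa using ha⟩
      rcases hirr W hW (by
        intro y w hw
        change (ρ y w) ^ q = 1
        rw [← map_pow, show w ^ q = 1 from hw, map_one]) with h | h
      · obtain ⟨k, hk0, hk⟩ := (hR.nontrivial_iff_card).mp inferInstance
        have hdvd : q ∣ Nat.card R := by rw [hk]; exact dvd_pow_self q (by omega)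
        obtain ⟨g, hg⟩ := exists_prime_orderOf_dvd_card' q hdvd
        have : g ∈ W := by
          change g ^ q = 1
          rw [← hg, pow_orderOf_eq_one]
        rw [h, Subgroup.mem_bot] at this
        rw [this, orderOf_one] at hg
        exact absurd hg.symm (Fact.out : q.Prime).one_lt.ne'
      · intro v
        have : v ∈ W := by rw [h]; trivial
        exact this
    exact ⟨R, cg, inferInstance, ρ, hexp, hirr, hρx, le_rfl, fun _ => ⟨MulEquiv.refl R, fun y r => rfl⟩⟩
  · unfold Irr at hirr
    push Not at hirr
    obtain ⟨W, hWn, hWi, hWb, hWt⟩ := hirr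
    have hmul := W.card_mul_index
    have hc1 : Nat.card W ≠ 1 := fun h => hWb (Subgroup.card_eq_one.mp h)
    have hi1 : W.index ≠ 1 := fun h => hWt (Subgroup.index_eq_one.mp h)
    have hcpos : 0 < Nat.card W := Nat.card_pos
    have hipos : 0 < W.index := Nat.pos_of_ne_zero W.index_ne_zero_of_finite
    have hcW : Nat.card W < Nat.card R := by
      rw [← hmul]; nlinarith [Nat.lt_of_le_of_ne hipos (Ne.symm hi1)]
    have hcQ : Nat.card (R ⧸ W) < Nat.card R := by
      change W.index < _
      rw [← hmul]; nlinarith [Nat.lt_of_le_of_ne hcpos (Ne.symm hc1)]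
    by_cases hxW : resAct ρ W hWi x = 1
    · have hxQ : quoAct ρ W hWi x ≠ 1 := by
        intro hxQ
        apply hρx
        ext r
        have h1 : ((ρ x r : R) : R ⧸ W) = r := by
          rw [← quoAct_apply ρ W hWi, hxQ]; rfl
        set z := r⁻¹ * ρ x r with hz
        have hzW : z ∈ W := QuotientGroup.eq.mp h1.symm
        have hxz : ρ x z = z := by
          have := congrArg (fun a => ((a ⟨z, hzW⟩ : W) : R)) hxW
          exact this
        have hxr : ρ x r = r * z := by rw [hz]; group
        have hk : ∀ k : ℕ, ρ (x ^ k) r = r * z ^ k := by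
          intro k
          induction k with
          | zero => simp
          | succ k ih =>
            rw [pow_succ', map_mul, MulAut.mul_apply, ih, map_mul, map_pow, hxr, hxz, mul_assoc, ← pow_succ']
        have hzs := hk s
        rw [hx, map_one, MulAut.one_apply] at hzs
        have hzs : z ^ s = 1 := left_eq_mul.mp hzs
        obtain ⟨k, hk'⟩ := hR z
        have hco : Nat.Coprime s (q ^ k) :=
          Nat.Coprime.pow_right k ((Nat.coprime_primes hs Fact.out).mpr hqs)
        have hz1 : z = 1 := by
          have h1 := orderOf_dvd_of_pow_eq_one hzs
          have h2 := orderOf_dvd_of_pow_eq_one hk'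
          have := Nat.dvd_gcd h1 h2
          rw [hco] at this
          exact orderOf_eq_one_iff.mp (Nat.dvd_one.mp this)
        rw [hxr, hz1, mul_one]; rfl
      obtain ⟨V, i1, i2, ρ', h1, h2, h3, h4, h5⟩ := IH _ (hm ▸ hcQ) (R ⧸ W) (hR.to_quotient W)
        (quoAct ρ W hWi) hxQ rfl
      exact ⟨V, i1, i2, ρ', h1, h2, h3, h4.trans hcQ.le, fun h => absurd h (by omega)⟩
    · obtain ⟨V, i1, i2, ρ', h1, h2, h3, h4, h5⟩ := IH _ (hm ▸ hcW) W (hR.to_subgroup W)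
        (resAct ρ W hWi) hxW rfl
      exact ⟨V, i1, i2, ρ', h1, h2, h3, h4.trans hcW.le, fun h => absurd h (by omega)⟩

/-- additive copy -/
def Ad (V : Type*) := Additive V

instance (V : Type*) [CommGroup V] : AddCommGroup (Ad V) := inferInstanceAs (AddCommGroup (Additive V))
instance (V : Type*) [Finite V] : Finite (Ad V) := inferInstanceAs (Finite V)

/-- module structure on an elementary abelian group -/
@[reducible] def elMod (q : ℕ) (V : Type*) [CommGroup V] (h : ∀ v : V, v ^ q = 1) : Module (ZMod q) (Ad V) :=
  AddCommGroup.zmodModule (G := Ad V) (fun v => h v)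

/-- to the additive copy -/
def toAd {V : Type*} (v : V) : Ad V := Additive.ofMul v

lemma toAd_mul {V : Type*} [CommGroup V] (v w : V) : toAd (v * w) = toAd v + toAd w := rfl
lemma toAd_inv {V : Type*} [CommGroup V] (v : V) : toAd (v⁻¹) = - toAd v := rfl
lemma toAd_one {V : Type*} [CommGroup V] : toAd (1 : V) = 0 := rfl
lemma toAd_inj {V : Type*} {v w : V} (h : toAd v = toAd w) : v = w := h

/-- automorphisms as linear maps -/
def toEnd (q : ℕ) (V : Type*) [CommGroup V] [Module (ZMod q) (Ad V)] :
    MulAut V →* Module.End (ZMod q) (Ad V) where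
  toFun a := AddMonoidHom.toZModLinearMap q
    { toFun := fun v => toAd (a v)
      map_zero' := map_one a
      map_add' := fun v w => map_mul a (show V from v) (show V from w) }
  map_one' := by ext v; rfl
  map_mul' := fun a b => by ext v; rfl

lemma toEnd_apply (q : ℕ) (V : Type*) [CommGroup V] [Module (ZMod q) (Ad V)] (a : MulAut V)
    (v : V) : toEnd q V a (toAd v) = toAd (a v) := rfl

lemma toEnd_inj (q : ℕ) (V : Type*) [CommGroup V] [Module (ZMod q) (Ad V)] :
    Function.Injective (toEnd q V) := by
  intro a b h
  ext v
  exact congrArg (fun z => (z (toAd v) : Ad V)) h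

lemma toEnd_apply_inj (q : ℕ) (V : Type*) [CommGroup V] [Module (ZMod q) (Ad V)] (a : MulAut V) :
    Function.Injective (toEnd q V a) := by
  intro v w h
  exact a.injective h

lemma card_Ad (q : ℕ) [Fact q.Prime] (V : Type*) [CommGroup V] [Finite V] [Module (ZMod q) (Ad V)] :
    Nat.card V = q ^ finrank (ZMod q) (Ad V) := by
  have := Module.natCard_eq_pow_finrank (K := ZMod q) (V := Ad V)
  rw [Nat.card_zmod] at this
  exact this

/-- `x` is conjugate to its powers -/
def Rat (s : ℕ) {Y : Type*} [Group Y] (x : Y) : Prop := ∀ j : ℕ, j.Coprime s → ∃ y, y * x = x ^ j * y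

lemma e1G (q s : ℕ) [Fact q.Prime] (hs : s.Prime) (hqs : s ≠ q) {Y : Type*} [Group Y] (x : Y)
    (hx : x ^ s = 1) (hr : Rat s x) (V : Type*) [CommGroup V] [Finite V] (hV : ∀ v : V, v ^ q = 1)
    (ρ : Y →* MulAut V) (hρ : ρ x ≠ 1) : ∃ k, Nat.card V = q ^ k ∧ s - 1 ≤ k := by
  letI := elMod q V hV
  haveI : FiniteDimensional (ZMod q) (Ad V) := Module.Finite.of_finite
  refine ⟨finrank (ZMod q) (Ad V), card_Ad q V, ?_⟩
  · refine e1 (V := Ad V) q s hs hqs (toEnd q V (ρ x)) (by rw [← map_pow, ← map_pow, hx, map_one, map_one]) ?_ ?_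
    · intro h
      exact hρ (toEnd_inj q V (h.trans (map_one _).symm))
    · intro j hj
      obtain ⟨y, hy⟩ := hr j hj
      refine ⟨toEnd q V (ρ y), toEnd_apply_inj q V _, ?_⟩
      rw [← map_mul, ← map_mul, hy]; simp only [map_mul, map_pow]

theorem oddAct (n s : ℕ) (hs : s.Prime) (hsn : n + 2 ≤ 2 * s) (hn : 5 ≤ n) {Y : Type*} [Group Y] (x : Y)
    (hx : x ^ s = 1) (hr : Rat s x) (q : ℕ) (hq : q.Prime) (hq2 : q ≠ 2) (D : Type u) [Group D] [Finite D]
    (hD : IsPGroup q D) (hcard : Nat.card D ∣ n.factorial) (ρ : Y →* MulAut D) : ρ x = 1 := by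
  haveI := Fact.mk hq
  have hq3 : 3 ≤ q := by have := hq.two_le; omega
  by_contra hρ
  obtain ⟨k0, hk0⟩ := hD.exists_card_eq
  rw [hk0] at hcard
  have hv := vle q n k0 hq (by omega) hcard
  by_cases hqs : s = q
  · subst hqs
    have hk1 : k0 ≤ 1 := by
      by_contra h
      have : (s - 1) * 2 ≤ (s - 1) * k0 := Nat.mul_le_mul_left _ (by omega)
      omega
    haveI : IsCyclic D := by
      interval_cases k0
      · rw [pow_zero] at hk0
        haveI := (Nat.card_eq_one_iff_unique.mp hk0).1
        exact isCyclic_of_subsingleton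
      · exact isCyclic_of_prime_card (p := s) (by simpa using hk0)
    obtain ⟨y, hy⟩ := hr 2 ((Nat.coprime_primes Nat.prime_two hs).mpr (Ne.symm hq2))
    have h1 := congrArg (fun z => IsCyclic.mulAutMulEquiv D (ρ z)) hy
    simp only [map_mul, map_pow] at h1
    rw [mul_comm, pow_two] at h1
    have h2 : IsCyclic.mulAutMulEquiv D (ρ x) = 1 := by
      have := mul_right_cancel h1
      exact left_eq_mul.mp this
    exact hρ ((MulEquiv.map_eq_one_iff _).mp h2)
  · obtain ⟨V, i1, i2, ρ', h1, h2, h3, h4, h5⟩ := red q s hs hqs x hx _ D hD ρ hρ rfl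
    obtain ⟨k, hk, hsk⟩ := e1G q s hs hqs x hx hr V h1 ρ' h3
    rw [hk, hk0] at h4
    have hkk : k ≤ k0 := (Nat.pow_le_pow_iff_right hq.one_lt).mp h4
    have : 2 * k0 ≤ (q - 1) * k0 := Nat.mul_le_mul_right _ (by omega)
    omega

end Stmt15

set_option linter.style.haveILetI false
set_option linter.unusedSectionVars false
namespace Stmt15
open Module Subgroup

section syl
variable {X : Type*} [Group X] [Finite X]

/-- `R` is a Sylow `q`-subgroup of `H` -/
def Syl (q : ℕ) (H R : Subgroup X) : Prop := R ≤ H ∧ Nat.card R = q ^ (Nat.card H).factorization q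

lemma Syl.isPGroup {q : ℕ} {H R : Subgroup X} (h : Syl q H R) : IsPGroup q R := IsPGroup.of_card h.2

lemma card_subgroupOf {H R : Subgroup X} (h : R ≤ H) : Nat.card (R.subgroupOf H) = Nat.card R :=
  Nat.card_congr (Subgroup.subgroupOfEquivOfLe h).toEquiv

lemma card_map_subtype {H : Subgroup X} (P : Subgroup H) : Nat.card (P.map H.subtype) = Nat.card P :=
  Nat.card_congr (P.equivMapOfInjective _ H.subtype_injective).toEquiv.symm

/-- associated bundled Sylow subgroup -/
noncomputable def Syl.toSylow {q : ℕ} [Fact q.Prime] {H R : Subgroup X} (h : Syl q H R) : Sylow q H :=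
  Sylow.ofCard (R.subgroupOf H) (by rw [card_subgroupOf h.1, h.2])

lemma Syl.coe_toSylow {q : ℕ} [Fact q.Prime] {H R : Subgroup X} (h : Syl q H R) :
    (h.toSylow : Subgroup H) = R.subgroupOf H := rfl

lemma syl_map {q : ℕ} [Fact q.Prime] {H : Subgroup X} (P : Sylow q H) :
    Syl q H ((P : Subgroup H).map H.subtype) :=
  ⟨Subgroup.map_subtype_le _, by rw [card_map_subtype, P.card_eq_multiplicity]⟩

lemma syl_exists_le {q : ℕ} [Fact q.Prime] {H P : Subgroup X} (hPH : P ≤ H) (hP : IsPGroup q P) :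
    ∃ R, Syl q H R ∧ P ≤ R := by
  have h1 : IsPGroup q (P.subgroupOf H) := hP.of_equiv (Subgroup.subgroupOfEquivOfLe hPH).symm
  obtain ⟨Q, hQ⟩ := h1.exists_le_sylow
  refine ⟨_, syl_map Q, ?_⟩
  rw [← Subgroup.map_subgroupOf_eq_of_le hPH]
  exact Subgroup.map_mono hQ

lemma syl_exists (q : ℕ) [Fact q.Prime] (H : Subgroup X) : ∃ R, Syl q H R := by
  obtain ⟨R, h, _⟩ := syl_exists_le (bot_le : (⊥ : Subgroup X) ≤ H) (IsPGroup.of_bot (p := q))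
  exact ⟨R, h⟩

lemma syl_conj {q : ℕ} [Fact q.Prime] {H R R' : Subgroup X} (h : Syl q H R) (h' : Syl q H R') :
    ∃ a ∈ H, ∀ r, r ∈ R ↔ a * r * a⁻¹ ∈ R' := by
  obtain ⟨a, ha⟩ := MulAction.exists_smul_eq H h.toSylow h'.toSylow
  refine ⟨a, a.2, fun r => ?_⟩
  have key : ∀ r : H, r ∈ (h.toSylow : Subgroup H) ↔ a * r * a⁻¹ ∈ (h'.toSylow : Subgroup H) := by
    intro r
    rw [← ha]
    constructor
    · intro hr
      exact ⟨r, hr, by simp⟩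
    · rintro ⟨r', hr', he⟩
      have : r' = r := by
        simp only [MulDistribMulAction.toMonoidEnd_apply, MulDistribMulAction.toMonoidHom_apply, MulAut.smul_def, MulAut.conj_apply] at he
        simpa using he
      exact this ▸ hr'
  constructor
  · intro hr
    exact (key ⟨r, h.1 hr⟩).mp hr
  · intro hr
    have hrH : r ∈ H := by
      have := H.mul_mem (H.mul_mem (H.inv_mem a.2) (h'.1 hr)) a.2
      simpa [mul_assoc] using this
    exact (key ⟨r, hrH⟩).mpr hr

lemma syl_conj_le {q : ℕ} [Fact q.Prime] {H P R : Subgroup X} (hPH : P ≤ H) (hP : IsPGroup q P)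
    (h : Syl q H R) : ∃ a ∈ H, ∀ r ∈ P, a * r * a⁻¹ ∈ R := by
  obtain ⟨R', hR', hle⟩ := syl_exists_le hPH hP
  obtain ⟨a, ha, h2⟩ := syl_conj hR' h
  exact ⟨a, ha, fun r hr => (h2 r).mp (hle hr)⟩

/-- conjugate subgroup -/
def cj (a : X) (R : Subgroup X) : Subgroup X := R.map (MulAut.conj a).toMonoidHom

lemma mem_cj {a : X} {R : Subgroup X} {x : X} : x ∈ cj a R ↔ a⁻¹ * x * a ∈ R := by
  rw [cj, Subgroup.mem_map_equiv]; simp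

lemma cj_mem {a : X} {R : Subgroup X} {x : X} (h : x ∈ R) : a * x * a⁻¹ ∈ cj a R := by
  rw [mem_cj]; simpa [mul_assoc] using h

lemma card_cj (a : X) (R : Subgroup X) : Nat.card (cj a R) = Nat.card R :=
  Nat.card_congr (R.equivMapOfInjective _ (MulAut.conj a).injective).toEquiv.symm

lemma syl_cj {q : ℕ} {H R : Subgroup X} (h : Syl q H R) (a : X) (ha : ∀ r ∈ H, a * r * a⁻¹ ∈ H) :
    Syl q H (cj a R) := by
  refine ⟨?_, by rw [card_cj, h.2]⟩
  rintro _ ⟨r, hr, rfl⟩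
  exact ha r (h.1 hr)

/-- Frattini argument -/
lemma frattini {q : ℕ} [Fact q.Prime] {K D : Subgroup X} (hD : Syl q K D) (y : X)
    (hy : ∀ r ∈ K, y * r * y⁻¹ ∈ K) : ∃ m ∈ K, m * y ∈ normalizer (D : Set X) := by
  obtain ⟨m, hm, h⟩ := syl_conj (syl_cj hD y hy) hD
  refine ⟨m, hm, ?_⟩
  rw [Subgroup.mem_normalizer_iff]
  intro r
  have := h (y * r * y⁻¹)
  rw [mem_cj] at this
  simp only [mul_assoc, mul_inv_rev, inv_mul_cancel_left, inv_mul_cancel, mul_one] at this ⊢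
  exact this

lemma conj_mem_iff_of_finite {K : Subgroup X} (y : X) (hy : ∀ r ∈ K, y * r * y⁻¹ ∈ K) (r : X) :
    r ∈ K ↔ y * r * y⁻¹ ∈ K := by
  have : y ∈ normalizer (K : Set X) := by
    have h1 : cj y K ≤ K := by
      rintro _ ⟨r, hr, rfl⟩
      exact hy r hr
    have h2 : cj y K = K := Subgroup.eq_of_le_of_card_ge h1 (card_cj y K).ge
    rw [Subgroup.mem_normalizer_iff]
    intro r
    constructor
    · exact hy r
    · intro h
      rw [← h2, mem_cj] at h
      simpa [mul_assoc] using h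
  exact Subgroup.mem_normalizer_iff.mp this r

lemma le_of_syl (H B : Subgroup X) (h : ∀ q : ℕ, q.Prime → ∃ R, Syl q H R ∧ R ≤ B) : H ≤ B := by
  have h1 : Nat.card H ∣ Nat.card (H ⊓ B : Subgroup X) := by
    rw [← Nat.factorization_prime_le_iff_dvd Nat.card_pos.ne' Nat.card_pos.ne']
    intro q hq
    obtain ⟨R, hR, hRB⟩ := h q hq
    rw [← hq.pow_dvd_iff_le_factorization Nat.card_pos.ne', ← hR.2]
    exact Subgroup.card_dvd_of_le (le_inf hR.1 hRB)
  have h2 : H ⊓ B = H := Subgroup.eq_of_le_of_card_ge inf_le_left (Nat.le_of_dvd Nat.card_pos h1)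
  exact inf_eq_left.mp h2

end syl

/-- transfer: central elements of the derived group -/
lemma tr {G : Type*} [Group G] [Finite G] (s : ℕ) [hs : Fact s.Prime] (P : Sylow s G)
    (hP : ∀ a ∈ P, ∀ b ∈ P, a * b = b * a) (z : G) (hz : ∀ g, g * z = z * g) (hzc : z ∈ commutator G)
    (hzs : z ^ s = 1) : z = 1 := by
  letI cg : CommGroup (P : Subgroup G) :=
    { (inferInstance : Group (P : Subgroup G)) with
      mul_comm := fun a b => Subtype.ext (hP a a.2 b b.2) }
  have h1 := MonoidHom.transfer_eq_pow (H := (P : Subgroup G)) (MonoidHom.id (P : Subgroup G)) z (by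
    intro k g _
    have : g⁻¹ * z ^ k = z ^ k * g⁻¹ := (show Commute g⁻¹ z from hz g⁻¹).pow_right k
    rw [this]; simp)
  have h2 : (MonoidHom.transfer (H := (P : Subgroup G)) (MonoidHom.id (P : Subgroup G))) z = 1 :=
    Abelianization.commutator_subset_ker _ hzc
  rw [h2] at h1
  have h3 : z ^ (P : Subgroup G).index = 1 := (congrArg Subtype.val h1).symm
  have hco : Nat.Coprime s (P : Subgroup G).index := (Nat.Prime.coprime_iff_not_dvd hs.out).mpr P.not_dvd_index
  have := Nat.dvd_gcd (orderOf_dvd_of_pow_eq_one hzs) (orderOf_dvd_of_pow_eq_one h3)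
  rw [hco] at this
  exact orderOf_eq_one_iff.mp (Nat.dvd_one.mp this)

end Stmt15

set_option linter.style.haveILetI false
set_option linter.unusedSectionVars false
namespace Stmt15
open Module Subgroup Equiv

lemma s0 (n : ℕ) (hn : 5 ≤ n) : ∃ s : ℕ, s.Prime ∧ n + 2 ≤ 2 * s ∧ s ≤ n ∧
    (s + 2 ≤ n ∨ s = n ∨ (s + 1 = n ∧ ¬ 2 ^ (n - 1) ∣ n.factorial)) := by
  rcases Nat.even_or_odd' n with ⟨k, hk | hk⟩
  · obtain ⟨p, hp, h1, h2⟩ := Nat.exists_prime_lt_and_le_two_mul (k - 1) (by omega)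
    by_cases hpk : p = k
    · obtain ⟨s, hs, h3, h4⟩ := Nat.exists_prime_lt_and_le_two_mul k (by omega)
      have hs2 : s ≠ 2 * k := by
        intro h
        have := (Nat.prime_dvd_prime_iff_eq Nat.prime_two hs).mp ⟨k, h⟩
        omega
      refine ⟨s, hs, by omega, by omega, ?_⟩
      by_cases hs1 : s + 1 = n
      · right; right
        refine ⟨hs1, fun hdvd => ?_⟩
        haveI : Fact (Nat.Prime 2) := ⟨Nat.prime_two⟩
        have h5 : n - 1 ≤ padicValNat 2 n.factorial := (padicValNat_dvd_iff_le n.factorial_ne_zero).mp hdvd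
        have h6 : padicValNat 2 (2 * k).factorial = padicValNat 2 k.factorial + k := padicValNat_factorial_mul k
        rw [← hk] at h6
        obtain ⟨j, hj⟩ : ∃ j, k = j + 1 := ⟨k - 1, by omega⟩
        have h7 : padicValNat 2 k.factorial = padicValNat 2 j.factorial := by
          rw [hj, Nat.factorial_succ, padicValNat.mul (by omega) j.factorial_ne_zero, ← hj]
          have : padicValNat 2 k = 0 := by
            apply padicValNat.eq_zero_of_not_dvd
            intro h
            have := (Nat.prime_dvd_prime_iff_eq Nat.prime_two (hpk ▸ hp)).mp h
            omega
          omega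
        have h8 := sub_one_mul_padicValNat_factorial_lt_of_ne_zero (p := 2) (n := j) (by omega)
        omega
      · left; omega
    · exact ⟨p, hp, by omega, by omega, by omega⟩
  · obtain ⟨s, hs, h3, h4⟩ := Nat.exists_prime_lt_and_le_two_mul (k + 1) (by omega)
    have hodd : ∀ m, s ≠ 2 * m := by
      intro m h
      have := (Nat.prime_dvd_prime_iff_eq Nat.prime_two hs).mp ⟨m, h⟩
      omega
    have := hodd (k + 1)
    have := hodd k
    exact ⟨s, hs, by omega, by omega, by omega⟩

/-- standing assumptions -/
structure Ctx (n s : ℕ) {X : Type*} [Group X] (π : X →* Perm (Fin n)) (ι : ZMod s ↪ Fin n) : Prop where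
  hn : 5 ≤ n
  hs : s.Prime
  hsn : n + 2 ≤ 2 * s
  hle : s ≤ n
  hsc : s + 2 ≤ n ∨ s = n ∨ (s + 1 = n ∧ ¬ 2 ^ (n - 1) ∣ n.factorial)
  hπ : Function.Surjective π
  hcard : 2 * Nat.card π.ker ∣ n.factorial

/-- the subgroup of products -/
def QT {X : Type*} [Group X] (Q T : Subgroup X) (h : T ≤ normalizer (Q : Set X)) : Subgroup X where
  carrier := {x | ∃ q ∈ Q, ∃ t ∈ T, x = q * t}
  one_mem' := ⟨1, Q.one_mem, 1, T.one_mem, by simp⟩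
  mul_mem' := by
    rintro _ _ ⟨q, hq, t, ht, rfl⟩ ⟨q', hq', t', ht', rfl⟩
    refine ⟨q * (t * q' * t⁻¹), Q.mul_mem hq ((mem_normalizer_iff.mp (h ht) q').mp hq'), t * t', T.mul_mem ht ht', by group⟩
  inv_mem' := by
    rintro _ ⟨q, hq, t, ht, rfl⟩
    refine ⟨t⁻¹ * q⁻¹ * t, ?_, t⁻¹, T.inv_mem ht, by group⟩
    have := (mem_normalizer_iff.mp (h (T.inv_mem ht)) q⁻¹).mp (Q.inv_mem hq)
    simpa using this

section ctx
variable {n s : ℕ} {X : Type*} [Group X] [Finite X] {π : X →* Perm (Fin n)} {ι : ZMod s ↪ Fin n}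

lemma Syl.mono {q : ℕ} {K K' D : Subgroup X} (h : Syl q K D) (h1 : D ≤ K') (h2 : K' ≤ K) (hq : q.Prime) : Syl q K' D := by
  refine ⟨h1, Nat.dvd_antisymm ?_ ?_⟩
  · have : Nat.card D ∣ Nat.card K' := Subgroup.card_dvd_of_le h1
    rw [h.2] at this ⊢
    exact (Nat.pow_dvd_pow_iff_le_right hq.one_lt).mpr ((hq.pow_dvd_iff_le_factorization Nat.card_pos.ne').mp this)
  · rw [h.2]
    apply pow_dvd_pow
    exact (Nat.factorization_le_iff_dvd Nat.card_pos.ne' Nat.card_pos.ne').mpr (Subgroup.card_dvd_of_le h2) q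

lemma isP_zpowers {q : ℕ} [Fact q.Prime] {w : X} (hw : w ^ q = 1) : IsPGroup q (zpowers w) := by
  rintro ⟨a, ha⟩
  obtain ⟨i, hi⟩ := mem_zpowers_iff.mp ha
  refine ⟨1, Subtype.ext ?_⟩
  simp only [pow_one, SubmonoidClass.mk_pow, OneMemClass.coe_one]
  rw [← hi, ← zpow_natCast, ← zpow_mul, mul_comm, zpow_mul, zpow_natCast, hw, one_zpow]

lemma mem_of_norm {q : ℕ} [hq : Fact q.Prime] {K D P : Subgroup X} (hD : Syl q K D) (hPK : P ≤ K) (hP : IsPGroup q P)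
    (hn : P ≤ normalizer (D : Set X)) : P ≤ D := by
  have h1 : Syl q (K ⊓ normalizer (D : Set X)) D := hD.mono (le_inf hD.1 le_normalizer) inf_le_left hq.out
  obtain ⟨a, ha, h2⟩ := syl_conj_le (le_inf hPK hn) hP h1
  intro r hr
  exact (mem_normalizer_iff.mp ha.2 r).mpr (h2 r hr)

lemma not_dvd_of {q : ℕ} (hq : q.Prime) {K : Subgroup X} (h : ∀ w ∈ K, w ^ q = 1 → w = 1) : ¬ q ∣ Nat.card K := by
  intro hd
  haveI := Fact.mk hq
  obtain ⟨w, hw⟩ := exists_prime_orderOf_dvd_card' q hd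
  have h1 : (w : X) = 1 := h w w.2 (by
    have := pow_orderOf_eq_one w
    rw [hw] at this
    exact_mod_cast congrArg Subtype.val this)
  rw [show w = 1 from Subtype.ext h1, orderOf_one] at hw
  exact hq.one_lt.ne hw

lemma of_not_dvd {q : ℕ} (hq : q.Prime) {K : Subgroup X} (h : ¬ q ∣ Nat.card K) {w : X} (hw : w ∈ K) (hw1 : w ^ q = 1) : w = 1 := by
  have h1 := orderOf_dvd_of_pow_eq_one hw1
  have h2 : orderOf w ∣ Nat.card K := Subgroup.orderOf_dvd_natCard K hw
  have := Nat.dvd_gcd h1 h2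
  rw [(Nat.Prime.coprime_iff_not_dvd hq).mpr h] at this
  exact orderOf_eq_one_iff.mp (Nat.dvd_one.mp this)

/-- covering -/
def Cov (π : X →* Perm (Fin n)) (Y : Subgroup X) : Prop := ∀ τ, ∃ y ∈ Y, π y = τ
/-- covering the alternating group -/
def ACov (π : X →* Perm (Fin n)) (Y : Subgroup X) : Prop := ∀ τ ∈ alternatingGroup (Fin n), ∃ y ∈ Y, π y = τ

lemma Cov.acov {Y : Subgroup X} (h : Cov π Y) : ACov π Y := fun τ _ => h τ
lemma ACov.mono {Y Z : Subgroup X} (h : ACov π Y) (hle : Y ≤ Z) : ACov π Z := fun τ ht => by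
  obtain ⟨y, hy, h1⟩ := h τ ht
  exact ⟨y, hle hy, h1⟩
lemma acov_iff {Y : Subgroup X} : ACov π Y ↔ alternatingGroup (Fin n) ≤ Y.map π := Iff.rfl

lemma acov_comm (hn : 5 ≤ n) {Y : Subgroup X} (h : ACov π Y) : ACov π ⁅Y, Y⁆ := by
  rw [acov_iff] at *
  rw [Subgroup.map_commutator, ← commutator_alternatingGroup_eq_self (α := Fin n) (by simpa using hn)]
  exact Subgroup.commutator_mono h h

lemma cov_comm (hn : 5 ≤ n) {Y : Subgroup X} (h : Cov π Y) : ACov π ⁅Y, Y⁆ := acov_comm hn h.acov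

lemma acov_of_norm (hn : 5 ≤ n) {Y C : Subgroup X} (h : Cov π Y) (hC : ∀ y ∈ Y, ∀ c ∈ C, y * c * y⁻¹ ∈ C) {x : X} (hx : x ∈ C)
    (hx1 : π x ≠ 1) : ACov π C := by
  rw [acov_iff]
  haveI : (C.map π).Normal := ⟨by
    rintro _ ⟨c, hc, rfl⟩ τ
    obtain ⟨y, hy, rfl⟩ := h τ
    exact ⟨y * c * y⁻¹, hC y hy c hc, by simp⟩⟩
  exact alt_le hn (C.map π) (π x) ⟨x, hx, rfl⟩ hx1

lemma frat_cov {q : ℕ} [Fact q.Prime] {Y D : Subgroup X} (h : Cov π Y) (hD : Syl q (Y ⊓ π.ker) D) :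
    Cov π (Y ⊓ normalizer (D : Set X)) := by
  intro τ
  obtain ⟨y, hy, rfl⟩ := h τ
  obtain ⟨m, hm, h1⟩ := frattini hD y (by
    intro r hr
    exact ⟨Y.mul_mem (Y.mul_mem hy hr.1) (Y.inv_mem hy), (inferInstance : π.ker.Normal).conj_mem r hr.2 y⟩)
  refine ⟨m * y, ⟨Y.mul_mem hm.1 hy, h1⟩, ?_⟩
  rw [map_mul, (show π m = 1 from hm.2), one_mul]

lemma frat_acov {q : ℕ} [Fact q.Prime] {Y D : Subgroup X} (h : ACov π Y) (hD : Syl q (Y ⊓ π.ker) D) :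
    ACov π (Y ⊓ normalizer (D : Set X)) := by
  intro τ ht
  obtain ⟨y, hy, rfl⟩ := h τ ht
  obtain ⟨m, hm, h1⟩ := frattini hD y (by
    intro r hr
    exact ⟨Y.mul_mem (Y.mul_mem hy hr.1) (Y.inv_mem hy), (inferInstance : π.ker.Normal).conj_mem r hr.2 y⟩)
  refine ⟨m * y, ⟨Y.mul_mem hm.1 hy, h1⟩, ?_⟩
  rw [map_mul, (show π m = 1 from hm.2), one_mul]

lemma Ctx.fac (c : Ctx n s π ι) : n.factorial.factorization s = 1 := by
  have h1 : s ^ 1 ∣ n.factorial := by rw [pow_one]; exact (c.hs.dvd_factorial).mpr c.hle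
  have h1 := (c.hs.pow_dvd_iff_le_factorization n.factorial_ne_zero).mp h1
  have h2 : ¬ s ^ 2 ∣ n.factorial := by
    intro h
    have := vle s n 2 c.hs (by have := c.hn; omega) h
    have := c.hsn; omega
  rw [c.hs.pow_dvd_iff_le_factorization n.factorial_ne_zero] at h2
  omega

lemma Ctx.cardX (c : Ctx n s π ι) : Nat.card X = n.factorial * Nat.card π.ker := by
  have h1 := π.ker.card_mul_index
  rw [Subgroup.index_ker, MonoidHom.range_eq_top.mpr c.hπ, Subgroup.card_top, Nat.card_perm, Nat.card_fin] at h1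
  rw [← h1, mul_comm]

lemma Ctx.facM (c : Ctx n s π ι) : (Nat.card π.ker).factorization s ≤ 1 := by
  rw [← c.fac]
  exact (Nat.factorization_le_iff_dvd Nat.card_pos.ne' n.factorial_ne_zero).mpr ((dvd_mul_left _ _).trans c.hcard) s

lemma Ctx.facX (c : Ctx n s π ι) : (Nat.card X).factorization s ≤ 2 := by
  rw [c.cardX, Nat.factorization_mul n.factorial_ne_zero Nat.card_pos.ne', Finsupp.add_apply, c.fac]
  have := c.facM; omega

lemma Ctx.s5 (c : Ctx n s π ι) : 5 ≤ s := by
  have := c.hsn; have := c.hn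
  have h4 : s ≠ 4 := by rintro rfl; exact absurd c.hs (by decide)
  omega

/-- `s`-subgroups are commutative -/
lemma Ctx.sab (c : Ctx n s π ι) (S : Subgroup X) (hS : IsPGroup s S) : ∀ a ∈ S, ∀ b ∈ S, a * b = b * a := by
  haveI := Fact.mk c.hs
  obtain ⟨k, hk⟩ := hS.exists_card_eq
  have h1 : s ^ k ∣ Nat.card X := hk ▸ Subgroup.card_subgroup_dvd_card S
  have h2 : k ≤ 2 := ((c.hs.pow_dvd_iff_le_factorization Nat.card_pos.ne').mp h1).trans c.facX
  intro a ha b hb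
  have : (⟨a, ha⟩ : S) * ⟨b, hb⟩ = ⟨b, hb⟩ * ⟨a, ha⟩ := by
    interval_cases k
    · rw [pow_zero] at hk
      haveI := (Nat.card_eq_one_iff_unique.mp hk).1
      exact Subsingleton.elim _ _
    · haveI : IsCyclic S := isCyclic_of_prime_card (p := s) (by simpa using hk)
      letI := IsCyclic.commGroup (α := S); exact mul_comm _ _
    · letI := IsPGroup.commGroupOfCardEqPrimeSq hk; exact mul_comm _ _
  exact congrArg Subtype.val this

/-- Sylow conjugacy for elements of order `s` -/
lemma Ctx.conjS (c : Ctx n s π ι) {A : Subgroup X} (hA : ¬ s ∣ Nat.card (A ⊓ π.ker : Subgroup X)) {x x' : X} (hx : x ∈ A)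
    (hx' : x' ∈ A) (hxs : x ^ s = 1) (hxs' : x' ^ s = 1) (hx1 : x ≠ 1) : ∃ a ∈ A, ∃ i : ℕ, a * x' * a⁻¹ = x ^ i := by
  haveI := Fact.mk c.hs
  obtain ⟨R, hR, hle⟩ := syl_exists_le ((zpowers_le (H := A)).mpr hx) (isP_zpowers hxs)
  obtain ⟨a, ha, h2⟩ := syl_conj_le ((zpowers_le (H := A)).mpr hx') (isP_zpowers hxs') hR
  have hRs : Nat.card R ∣ s := by
    have hinj : Function.Injective (π.comp R.subtype) := by
      rw [injective_iff_map_eq_one]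
      intro r hr
      obtain ⟨k, hk⟩ := hR.isPGroup r
      have h3 : ∀ k : ℕ, ∀ w : X, w ∈ A ⊓ π.ker → w ^ s ^ k = 1 → w = 1 := by
        intro k
        induction k with
        | zero => intro w _ hw; simpa using hw
        | succ k ih =>
          intro w hw hw2
          rw [pow_succ', pow_mul] at hw2
          exact of_not_dvd c.hs hA hw (ih _ (Subgroup.pow_mem _ hw s) hw2)
      exact Subtype.ext (h3 k r ⟨hR.1 r.2, hr⟩ (by exact_mod_cast congrArg Subtype.val hk))
    have h4 : Nat.card R ∣ n.factorial := by
      have := Subgroup.card_dvd_of_injective _ hinj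
      rwa [Nat.card_perm, Nat.card_fin] at this
    rw [hR.2] at h4 ⊢
    have := (c.hs.pow_dvd_iff_le_factorization n.factorial_ne_zero).mp h4
    rw [c.fac] at this
    exact (pow_dvd_pow s this).trans (by simp)
  have hxR : zpowers x = R := by
    apply Subgroup.eq_of_le_of_card_ge hle
    rw [Nat.card_zpowers, orderOf_eq_prime hxs hx1]
    exact Nat.le_of_dvd c.hs.pos hRs
  have h5 := h2 x' (mem_zpowers x')
  rw [← hxR] at h5
  obtain ⟨i, hi⟩ := (mem_powers_iff_mem_zpowers (x := x)).mpr h5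
  exact ⟨a, ha, i, hi.symm⟩

/-- `x` is rational inside `Y` -/
def RatIn (s : ℕ) (Y : Subgroup X) (x : X) : Prop := ∀ j : ℕ, j.Coprime s → ∃ y ∈ Y, y * x = x ^ j * y

lemma Ctx.rat1 (c : Ctx n s π ι) {Y : Subgroup X} (hY : ¬ s ∣ Nat.card (Y ⊓ π.ker : Subgroup X)) (hv : ∃ y ∈ Y, π y = cyc ι) :
    ∃ x ∈ Y, x ^ s = 1 ∧ π x = cyc ι := by
  obtain ⟨y, hy, hyv⟩ := hv
  have hco : Nat.Coprime (Nat.card (Y ⊓ π.ker : Subgroup X)) s := ((Nat.Prime.coprime_iff_not_dvd c.hs).mpr hY).symm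
  obtain ⟨k, hk⟩ := Nat.exists_mul_mod_eq_one_of_coprime hco c.hs.one_lt
  have hcs : cyc ι ^ s = 1 := cyc_pow ι
  refine ⟨y ^ (Nat.card (Y ⊓ π.ker : Subgroup X) * k), Y.pow_mem hy _, ?_, ?_⟩
  · have h1 : y ^ s ∈ Y ⊓ π.ker := ⟨Y.pow_mem hy _, MonoidHom.mem_ker.mpr (by rw [map_pow, hyv, hcs])⟩
    have h2 : (y ^ s) ^ (Nat.card (Y ⊓ π.ker : Subgroup X)) = 1 := by
      exact congrArg Subtype.val (pow_card_eq_one' (x := (⟨y ^ s, h1⟩ : (Y ⊓ π.ker : Subgroup X))))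
    rw [← pow_mul, mul_comm, ← mul_assoc, pow_mul, pow_mul, h2, one_pow]
  · rw [map_pow, hyv, ← Nat.div_add_mod (_ * k) s, hk.2, pow_add, pow_mul, hcs]; simp

lemma Ctx.rat2 (c : Ctx n s π ι) {Y : Subgroup X} (hY : ¬ s ∣ Nat.card (Y ⊓ π.ker : Subgroup X)) {x y : X} (hx : x ∈ Y)
    (hxs : x ^ s = 1) (hxv : π x = cyc ι) (hy : y ∈ Y) (j : ℕ)  (h : π y * cyc ι = cyc ι ^ j * π y) :
    ∃ y' ∈ Y, y' * x = x ^ j * y' := by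
  have hv1 : cyc ι ≠ 1 := cyc_ne_one c.hs ι
  have hx1 : x ≠ 1 := by rintro rfl; exact hv1 (by rw [← hxv, map_one])
  have hpy : π (y * x * y⁻¹) = cyc ι ^ j := by
    rw [map_mul, map_mul, hxv, h]; simp
  obtain ⟨a, ha, i, hi⟩ := c.conjS (A := Y ⊓ (zpowers (cyc ι)).comap π) (x := x) (x' := y * x * y⁻¹) (by
      intro hd
      apply hY
      refine hd.trans (Subgroup.card_dvd_of_le ?_)
      exact inf_le_inf_right _ inf_le_left)
    ⟨hx, Subgroup.mem_comap.mpr (by rw [hxv]; exact mem_zpowers _)⟩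
    ⟨Y.mul_mem (Y.mul_mem hy hx) (Y.inv_mem hy), Subgroup.mem_comap.mpr (by rw [hpy]; exact ⟨j, by simp⟩)⟩ hxs
    (by rw [conj_pow, hxs]; simp) hx1
  have h1 : cyc ι ^ j = cyc ι ^ i := by
    have h2 := congrArg π hi
    rw [map_mul, map_mul, hpy, map_pow, hxv] at h2
    obtain ⟨l, hl⟩ := ha.2
    rw [← h2, map_inv, ← hl]
    simp only [← zpow_natCast, ← zpow_add, ← zpow_neg]
    congr 1; ring
  have h3 : x ^ i = x ^ j := by
    have e1 : orderOf (cyc ι) = s := orderOf_eq_prime (hp := ⟨c.hs⟩) (cyc_pow ι) hv1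
    have e2 : orderOf x = s := orderOf_eq_prime (hp := ⟨c.hs⟩) hxs hx1
    rw [pow_inj_mod, e1] at h1
    rw [pow_inj_mod, e2, h1]
  refine ⟨a * y, Y.mul_mem ha.1 hy, ?_⟩
  rw [← h3, ← hi]; group

lemma Ctx.ratCov (c : Ctx n s π ι) {Y : Subgroup X} (hY : ¬ s ∣ Nat.card (Y ⊓ π.ker : Subgroup X)) (hcov : Cov π Y) {x : X}
    (hx : x ∈ Y) (hxs : x ^ s = 1) (hxv : π x = cyc ι) : RatIn s Y x := by
  intro j hj
  obtain ⟨τ, h1, _⟩ := cyc_rat ι j hj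
  obtain ⟨y, hy, rfl⟩ := hcov τ
  exact c.rat2 hY hx hxs hxv hy j h1

lemma Ctx.ratACov (c : Ctx n s π ι) (hs2 : s + 2 ≤ n) {Y : Subgroup X} (hY : ¬ s ∣ Nat.card (Y ⊓ π.ker : Subgroup X))
    (hcov : ACov π Y) {x : X} (hx : x ∈ Y) (hxs : x ^ s = 1) (hxv : π x = cyc ι) : RatIn s Y x := by
  haveI : NeZero s := ⟨c.hs.ne_zero⟩
  intro j hj
  obtain ⟨τ, h0, h1⟩ := cyc_rat_even hs2 ι j hj
  obtain ⟨y, hy, rfl⟩ := hcov τ h0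
  exact c.rat2 hY hx hxs hxv hy j h1

lemma Ctx.cyc_mem (c : Ctx n s π ι) : cyc ι ∈ alternatingGroup (Fin n) :=
  cyc_even (c.hs.odd_of_ne_two (by have := c.s5; omega)) ι

end ctx
end Stmt15

set_option linter.style.haveILetI false
set_option linter.unusedSectionVars false
namespace Stmt15
open Module Subgroup Equiv

section ctx
variable {n s : ℕ} {X : Type*} [Group X] [Finite X] {π : X →* Perm (Fin n)} {ι : ZMod s ↪ Fin n}

/-- `G` centralizes `D ≤ G`, then `D` meets the derived group of `G` trivially on `s`-elements -/
lemma Ctx.trC (c : Ctx n s π ι) {G : Subgroup X} {z : X} (hz : ∀ g ∈ G, g * z = z * g) (hzc : z ∈ ⁅G, G⁆) (hzs : z ^ s = 1) : z = 1 := by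
  haveI := Fact.mk c.hs
  have hzG : z ∈ G := Subgroup.commutator_le_self G hzc
  obtain ⟨P⟩ : Nonempty (Sylow s G) := inferInstance
  have h1 : (⟨z, hzG⟩ : G) = 1 := by
    refine tr s P ?_ ⟨z, hzG⟩ ?_ ?_ (Subtype.ext hzs)
    · intro a ha b hb
      have := c.sab ((P : Subgroup G).map G.subtype) (P.isPGroup'.map _) a ⟨a, ha, rfl⟩ b ⟨b, hb, rfl⟩
      exact Subtype.ext this
    · intro g; exact Subtype.ext (hz g g.2)
    · have h2 : (commutator G).map G.subtype = ⁅G, G⁆ := by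
        rw [commutator_def, Subgroup.map_commutator]
        simp [← MonoidHom.range_eq_map]
      rw [← h2] at hzc
      obtain ⟨w, hw, he⟩ := hzc
      rwa [show (⟨z, hzG⟩ : G) = w from Subtype.ext he.symm]
  exact congrArg Subtype.val h1

/-- conjugation action on a normalized subgroup -/
def actN (Y D : Subgroup X) (h : Y ≤ normalizer (D : Set X)) : Y →* MulAut D :=
  (normalizerMonoidHom D).comp (inclusion h)

lemma actN_apply (Y D : Subgroup X) (h : Y ≤ normalizer (D : Set X)) (y : Y) (d : D) :
    (actN Y D h y d : X) = y * d * (y : X)⁻¹ := rfl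

lemma actN_eq_one {Y D : Subgroup X} (h : Y ≤ normalizer (D : Set X)) {y : Y} (h1 : actN Y D h y = 1) :
    ∀ d ∈ D, (y : X) * d = d * y := by
  intro d hd
  have h2 : (y : X) * d * (y : X)⁻¹ = d := by
    rw [← actN_apply Y D h y ⟨d, hd⟩, h1]; rfl
  exact mul_inv_eq_iff_eq_mul.mp h2

lemma actN_one {Y D : Subgroup X} (h : Y ≤ normalizer (D : Set X)) {y : Y} (h1 : ∀ d ∈ D, (y : X) * d = d * y) :
    actN Y D h y = 1 := by
  ext d
  rw [actN_apply, h1 d d.2]; simp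

lemma mem_cent {D : Subgroup X} {y : X} (h : ∀ d ∈ D, y * d = d * y) : y ∈ centralizer (D : Set X) :=
  mem_centralizer_iff.mpr fun d hd => (h d hd).symm

lemma RatIn.rat {Y : Subgroup X} {x : X} (h : RatIn s Y x) (hx : x ∈ Y) : Rat s (⟨x, hx⟩ : Y) := by
  intro j hj
  obtain ⟨y, hy, h1⟩ := h j hj
  exact ⟨⟨y, hy⟩, Subtype.ext h1⟩

lemma RatIn.mono {Y Z : Subgroup X} {x : X} (h : RatIn s Y x) (hle : Y ≤ Z) : RatIn s Z x := by
  intro j hj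
  obtain ⟨y, hy, h1⟩ := h j hj
  exact ⟨y, hle hy, h1⟩

lemma Ctx.oddA (c : Ctx n s π ι) {Y D : Subgroup X} (h : Y ≤ normalizer (D : Set X)) {x : X} (hx : x ∈ Y) (hxs : x ^ s = 1)
    (hr : RatIn s Y x) {q : ℕ} (hq : q.Prime) (hq2 : q ≠ 2) (hD : IsPGroup q D) (hDM : D ≤ π.ker) : ∀ d ∈ D, x * d = d * x :=
  actN_eq_one h (y := ⟨x, hx⟩) (oddAct n s c.hs c.hsn c.hn (⟨x, hx⟩ : Y) (Subtype.ext hxs) (hr.rat hx) q hq hq2 D hD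
    ((Subgroup.card_dvd_of_le hDM).trans ((dvd_mul_left _ _).trans c.hcard)) (actN Y D h))

lemma comm_cent (Y D : Subgroup X) [hc : IsCyclic D] : ⁅Y ⊓ normalizer (D : Set X), Y ⊓ normalizer (D : Set X)⁆ ≤ centralizer (D : Set X) := by
  rw [commutator_le]
  intro a ha b hb
  have h : Y ⊓ normalizer (D : Set X) ≤ normalizer (D : Set X) := inf_le_right
  have h1 : actN _ D h (⟨a, ha⟩ * ⟨b, hb⟩ * ⟨a, ha⟩⁻¹ * ⟨b, hb⟩⁻¹) = 1 := by
    apply (IsCyclic.mulAutMulEquiv D).injective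
    simp only [map_mul, map_inv, map_one]
    rw [mul_inv_eq_one, mul_inv_eq_iff_eq_mul, mul_comm]
  exact mem_cent (actN_eq_one h h1)

/-- the cover lemma -/
theorem Ctx.cover (c : Ctx n s π ι) {Y : Subgroup X} (hY : Cov π Y) :
    ∃ Y2 ≤ Y, Cov π Y2 ∧ ¬ s ∣ Nat.card (Y2 ⊓ π.ker : Subgroup X) := by
  haveI := Fact.mk c.hs
  obtain ⟨D, hD⟩ := syl_exists s (Y ⊓ π.ker)
  set Y1 := Y ⊓ normalizer (D : Set X) with hY1
  have hcov1 : Cov π Y1 := frat_cov hY hD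
  haveI hcyc : IsCyclic D := by
    have h1 : (Nat.card (Y ⊓ π.ker : Subgroup X)).factorization s ≤ 1 :=
      ((Nat.factorization_le_iff_dvd Nat.card_pos.ne' Nat.card_pos.ne').mpr (Subgroup.card_dvd_of_le inf_le_right) s).trans c.facM
    have h2 := hD.2
    interval_cases h : (Nat.card (Y ⊓ π.ker : Subgroup X)).factorization s
    · rw [pow_zero] at h2
      haveI := (Nat.card_eq_one_iff_unique.mp h2).1
      exact isCyclic_of_subsingleton
    · exact isCyclic_of_prime_card (p := s) (by simpa using h2)
  set G := Y1 ⊓ centralizer (D : Set X) with hG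
  have hGcov : ACov π G := (cov_comm c.hn hcov1).mono (le_inf (Subgroup.commutator_le_self _) (comm_cent Y D))
  set Q := ⁅G, G⁆ with hQ
  have hQcov : ACov π Q := acov_comm c.hn hGcov
  have hQG : Q ≤ G := Subgroup.commutator_le_self G
  have hGn : ∀ y ∈ Y1, ∀ g ∈ G, y * g * y⁻¹ ∈ G := by
    intro y hy g hg
    refine ⟨Y1.mul_mem (Y1.mul_mem hy hg.1) (Y1.inv_mem hy), ?_⟩
    refine mem_cent fun d hd => ?_
    have hd' : y⁻¹ * d * y ∈ D := by
      have := (mem_normalizer_iff.mp ((normalizer (D : Set X)).inv_mem hy.2) d).mp hd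
      simpa using this
    have := mem_centralizer_iff.mp hg.2 _ hd'
    have h2 := congrArg (fun z => y * z * y⁻¹) this
    simp only [mul_assoc, mul_inv_cancel_left, mul_inv_cancel, mul_one] at h2 ⊢
    exact h2.symm
  have hQn : ∀ y ∈ Y1, ∀ g ∈ Q, y * g * y⁻¹ ∈ Q := by
    intro y hy
    have h1 : cj y G ≤ G := by
      rintro _ ⟨g, hg, rfl⟩; exact hGn y hy g hg
    have h2 : cj y Q ≤ Q := by
      rw [cj, hQ, Subgroup.map_commutator]
      exact Subgroup.commutator_mono h1 h1
    intro g hg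
    exact h2 (cj_mem hg)
  have hQs : ∀ w ∈ Q, π w = 1 → w ^ s = 1 → w = 1 := by
    intro w hw hw1 hws
    have hwG := hQG hw
    have hwD : w ∈ D := by
      refine mem_of_norm hD (P := zpowers w) (zpowers_le.mpr ⟨hwG.1.1, hw1⟩) (isP_zpowers hws) (zpowers_le.mpr hwG.1.2) (mem_zpowers w)
    refine c.trC (G := G) ?_ hw hws
    intro g hg
    exact (mem_centralizer_iff.mp hg.2 w hwD).symm
  -- a 2-element covering a transposition
  have h01 : (⟨0, by have := c.hn; omega⟩ : Fin n) ≠ ⟨1, by have := c.hn; omega⟩ := by simp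
  set τ : Perm (Fin n) := swap ⟨0, by have := c.hn; omega⟩ ⟨1, by have := c.hn; omega⟩ with hτ
  have hττ : τ * τ = 1 := swap_mul_self _ _
  obtain ⟨y0, hy0, hy0τ⟩ := hcov1 τ
  obtain ⟨k, o, ho, hko⟩ := Nat.exists_eq_two_pow_mul_odd (orderOf_pos y0).ne'
  set t := y0 ^ o with ht
  have htY : t ∈ Y1 := Y1.pow_mem hy0 o
  have htk : t ^ (2 ^ k) = 1 := by
    rw [ht, ← pow_mul, mul_comm, ← hko, pow_orderOf_eq_one]
  have htτ : π t = τ := by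
    rw [ht, map_pow, hy0τ]
    obtain ⟨m, rfl⟩ := ho
    rw [pow_succ, pow_mul, pow_two, hττ, one_pow, one_mul]
  have hTn : zpowers t ≤ normalizer (Q : Set X) := by
    rw [zpowers_le, mem_normalizer_iff]
    exact conj_mem_iff_of_finite t (hQn t htY)
  refine ⟨QT Q (zpowers t) hTn, ?_, ?_, ?_⟩
  · rintro _ ⟨q, hq, w, hw, rfl⟩
    exact Y.mul_mem (hQG hq).1.1 ((zpowers_le.mpr htY.1) hw)
  · intro σ
    by_cases hσ : σ ∈ alternatingGroup (Fin n)
    · obtain ⟨q, hq, rfl⟩ := hQcov σ hσ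
      exact ⟨q, ⟨q, hq, 1, one_mem _, by simp⟩, rfl⟩
    · obtain ⟨q, hq, h⟩ := hQcov (σ * τ) (by
        rw [Equiv.Perm.mem_alternatingGroup, Equiv.Perm.sign_mul, Equiv.Perm.sign_swap h01]
        rw [Equiv.Perm.mem_alternatingGroup] at hσ
        rcases Int.units_eq_one_or (Equiv.Perm.sign σ) with h | h
        · exact absurd h hσ
        · rw [h]; simp)
      refine ⟨q * t, ⟨q, hq, t, mem_zpowers t, rfl⟩, ?_⟩
      rw [map_mul, h, htτ, mul_assoc, hττ, mul_one]
  · apply not_dvd_of c.hs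
    rintro w ⟨⟨q, hq, u, hu, hw⟩, hwM⟩ hws
    have hpw : ∀ m : ℕ, ∃ q' ∈ Q, w ^ m = q' * u ^ m := by
      intro m
      induction m with
      | zero => exact ⟨1, Q.one_mem, by simp⟩
      | succ m ih =>
        obtain ⟨q', hq', h1⟩ := ih
        have hum : u ^ m ∈ normalizer (Q : Set X) := Subgroup.pow_mem _ (hTn hu) m
        refine ⟨q' * (u ^ m * q * (u ^ m)⁻¹), Q.mul_mem hq' ((mem_normalizer_iff.mp hum q).mp hq), ?_⟩
        rw [pow_succ, h1, hw]
        group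
    obtain ⟨q', hq', h1⟩ := hpw (2 ^ k)
    have hu2 : u ^ (2 ^ k) = 1 := by
      obtain ⟨i, rfl⟩ := mem_zpowers_iff.mp hu
      rw [← zpow_natCast, ← zpow_mul, mul_comm, zpow_mul, zpow_natCast, htk, one_zpow]
    rw [hu2, mul_one] at h1
    have hco : Nat.Coprime (2 ^ k) s := by
      apply Nat.Coprime.pow_left
      rw [Nat.coprime_primes Nat.prime_two c.hs]
      have := c.s5; omega
    obtain ⟨m, hm⟩ := Nat.exists_mul_mod_eq_one_of_coprime hco c.hs.one_lt
    have hwQ : w ∈ Q := by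
      have h2 : w ^ (2 ^ k * m) = w := by
        rw [← Nat.div_add_mod (2 ^ k * m) s, hm.2, pow_add, pow_mul, hws]; simp
      rw [← h2, pow_mul, h1]
      exact Q.pow_mem hq' m
    exact hQs w hwQ hwM hws

theorem Ctx.coverX (c : Ctx n s π ι) {Y : Subgroup X} (hY : Cov π Y) :
    ∃ Y2 ≤ Y, Cov π Y2 ∧ ¬ s ∣ Nat.card (Y2 ⊓ π.ker : Subgroup X) ∧ ∃ x ∈ Y2, x ^ s = 1 ∧ π x = cyc ι ∧ RatIn s Y2 x := by
  obtain ⟨Y2, hle, hcov, hnd⟩ := c.cover hY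
  obtain ⟨x, hx, hxs, hxv⟩ := c.rat1 hnd (hcov _)
  exact ⟨Y2, hle, hcov, hnd, x, hx, hxs, hxv, c.ratCov hnd hcov hx hxs hxv⟩

lemma Ctx.ne (c : Ctx n s π ι) {x : X} (hx : π x = cyc ι) : π x ≠ 1 := hx ▸ cyc_ne_one c.hs ι

lemma Ctx.covTop (c : Ctx n s π ι) : Cov π (⊤ : Subgroup X) := fun τ => by
  obtain ⟨y, hy⟩ := c.hπ τ
  exact ⟨y, trivial, hy⟩

lemma cent_norm {D : Subgroup X} {y w : X} (hy : y ∈ normalizer (D : Set X)) (hw : w ∈ centralizer (D : Set X)) :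
    y * w * y⁻¹ ∈ centralizer (D : Set X) := by
  refine mem_cent fun d hd => ?_
  have hd' : y⁻¹ * d * y ∈ D := by
    have := (mem_normalizer_iff.mp ((normalizer (D : Set X)).inv_mem hy) d).mp hd
    simpa using this
  have := mem_centralizer_iff.mp hw _ hd'
  have h2 := congrArg (fun z => y * z * y⁻¹) this
  simp only [mul_assoc, mul_inv_cancel_left, mul_inv_cancel, mul_one] at h2 ⊢
  exact h2.symm

/-- if some covering `Y` normalizes `R` and some `x ∈ Y` over an `s`-cycle centralizes, then the centralizer covers -/
lemma Ctx.acovC (c : Ctx n s π ι) {Y R : Subgroup X} (hY : Cov π Y) (hYR : Y ≤ normalizer (R : Set X)) {x : X} (hx : x ∈ Y)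
    (hxv : π x = cyc ι) (hxR : ∀ d ∈ R, x * d = d * x) : ACov π (Y ⊓ centralizer (R : Set X)) :=
  acov_of_norm c.hn hY (fun _ hy _ hw => ⟨Y.mul_mem (Y.mul_mem hy hw.1) (Y.inv_mem hy), cent_norm (hYR hy) hw.2⟩)
    (x := x) ⟨hx, mem_cent hxR⟩ (c.ne hxv)

theorem Ctx.gOdd (c : Ctx n s π ι) {q : ℕ} (hq : q.Prime) (hq2 : q ≠ 2) {R : Subgroup X} (hR : Syl q π.ker R) :
    ACov π (centralizer (R : Set X)) := by
  haveI := Fact.mk hq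
  have h1 : Cov π (⊤ ⊓ normalizer (R : Set X)) := frat_cov c.covTop (by simpa using hR)
  obtain ⟨Y, hle, hcov, hnd, x, hx, hxs, hxv, hr⟩ := c.coverX h1
  have hYR : Y ≤ normalizer (R : Set X) := hle.trans inf_le_right
  exact (c.acovC hcov hYR hx hxv (c.oddA hYR hx hxs hr hq hq2 hR.isPGroup hR.1)).mono inf_le_right

end ctx
end Stmt15

set_option linter.style.haveILetI false
set_option linter.unusedSectionVars false
namespace Stmt15
open Module Subgroup Equiv

lemma dAct (s : ℕ) (hs : s.Prime) (hs2 : s ≠ 2) {Y : Type*} [Group Y] (V : Type*) [CommGroup V] [Finite V] (hV : ∀ v : V, v ^ 2 = 1)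
    (ρ : Y →* MulAut V) (hirr : Irr ρ) (k : ℕ) (hk : Nat.card V = 2 ^ k) (hks : k < 2 * (s - 1)) (x : Y) (hxs : x ^ s = 1)
    (hx : ρ x ≠ 1) (D : Set (MulAut V)) (hDn : ∀ y, ∀ d ∈ D, ρ y * d * (ρ y)⁻¹ ∈ D) (hodd : ∀ d ∈ D, ∃ o : ℕ, Odd o ∧ d ^ o = 1)
    (hDx : ∀ d ∈ D, d * ρ x = ρ x * d)
    (hrat : ∀ j : ℕ, j.Coprime s → ∃ y, y * x = x ^ j * y ∧ ∀ d ∈ D, d * ρ y = ρ y * d) : ∀ d ∈ D, d = 1 := by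
  letI := elMod 2 V hV
  haveI : FiniteDimensional (ZMod 2) (Ad V) := Module.Finite.of_finite
  set U : Subgroup V := Subgroup.closure {u | ∃ d ∈ D, ∃ v, u = d v * v⁻¹} with hU
  have hUinv : Inv ρ U := by
    intro y w hw
    have h1 : U ≤ U.comap (ρ y).toMonoidHom := by
      rw [hU, closure_le]
      rintro _ ⟨d, hd, v, rfl⟩
      refine subset_closure ⟨_, hDn y d hd, ρ y v, ?_⟩
      simp [MulAut.mul_apply]
    exact h1 hw
  rcases hirr U inferInstance hUinv with h | h
  · intro d hd
    ext v
    have h1 : d v * v⁻¹ ∈ U := subset_closure ⟨d, hd, v, rfl⟩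
    rw [h, mem_bot, mul_inv_eq_one] at h1
    exact h1
  · exfalso
    have hex : ∃ d ∈ D, ∃ v, ρ x (d v * v⁻¹) ≠ d v * v⁻¹ := by
      by_contra hcon
      push Not at hcon
      apply hx
      ext v
      have h1 : U ≤ (MonoidHom.eqLocus (ρ x).toMonoidHom (MonoidHom.id V)) := by
        rw [hU, closure_le]
        rintro _ ⟨d, hd, v, rfl⟩
        exact hcon d hd v
      exact h1 (h ▸ mem_top v)
    obtain ⟨d, hd, v, hv⟩ := hex
    obtain ⟨o, ho, hdo⟩ := hodd d hd
    have h2 := e2 (V := Ad V) s hs hs2 (toEnd 2 V (ρ x)) (toEnd 2 V d)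
      (by rw [← map_pow, ← map_pow, hxs, map_one, map_one]) o ho (by rw [← map_pow, hdo, map_one])
      (by rw [← map_mul, ← map_mul, hDx d hd]) (by
        intro h0
        apply hv
        have h3 := LinearMap.congr_fun h0 (toAd v)
        have h4 : toEnd 2 V (ρ x) (toAd (d v * v⁻¹)) - toAd (d v * v⁻¹) = 0 := by
          rw [toAd_mul, toAd_inv, ← toEnd_apply 2 V d, ← sub_eq_add_neg]
          simpa using h3
        rw [sub_eq_zero, toEnd_apply] at h4
        exact toAd_inj h4) (by
        intro j hj
        obtain ⟨y, hy, hyd⟩ := hrat j hj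
        refine ⟨toEnd 2 V (ρ y), toEnd_apply_inj 2 V _, ?_, ?_⟩
        · rw [← map_mul, ← map_mul, hy]; simp only [map_mul, map_pow]
        · rw [← map_mul, ← map_mul, hyd d hd])
    have h3 := card_Ad 2 V
    rw [hk] at h3
    have := Nat.pow_right_injective le_rfl h3
    omega

section ctx
variable {n s : ℕ} {X : Type*} [Group X] [Finite X] {π : X →* Perm (Fin n)} {ι : ZMod s ↪ Fin n}

lemma Ctx.two (c : Ctx n s π ι) {R Y D : Subgroup X} (hR : Syl 2 π.ker R) (hY : Cov π Y) (hYs : ¬ s ∣ Nat.card (Y ⊓ π.ker : Subgroup X))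
    (hYR : Y ≤ normalizer (R : Set X)) (hYD : Y ≤ normalizer (D : Set X)) {q : ℕ} (hq : q.Prime) (hq2 : q ≠ 2) (hD : IsPGroup q D)
    (hDM : D ≤ π.ker) (hDR : D ≤ normalizer (R : Set X)) {x : X} (hx : x ∈ Y) (hxs : x ^ s = 1) (hxv : π x = cyc ι)
    (hr : RatIn s Y x) (hxR : ¬ ∀ r ∈ R, x * r = r * x) :
    (∀ a ∈ R, ∀ b ∈ R, a * b = b * a) ∧ (∀ d ∈ D, ∀ r ∈ R, d * r = r * d) := by
  haveI : Fact (Nat.Prime 2) := ⟨Nat.prime_two⟩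
  have hs2 : s ≠ 2 := by have := c.s5; omega
  have hn := c.hn
  set ρ := actN Y R hYR with hρ
  set xY : Y := ⟨x, hx⟩ with hxY
  have hxYs : xY ^ s = 1 := Subtype.ext hxs
  have hρx : ρ xY ≠ 1 := fun h => hxR (actN_eq_one hYR h)
  obtain ⟨V, i1, i2, ρ', hV, hirr, hρ'x, hcVR, hiso⟩ := red 2 s c.hs hs2 xY hxYs _ R hR.isPGroup ρ hρx rfl
  obtain ⟨k, hk, hsk⟩ := e1G 2 s c.hs hs2 xY hxYs (hr.rat hx) V hV ρ' hρ'x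
  obtain ⟨b, hb⟩ := hR.isPGroup.exists_card_eq
  have hb1 : 2 ^ (b + 1) ∣ n.factorial := by
    rw [pow_succ', ← hb]
    exact (Nat.mul_dvd_mul_left 2 (Subgroup.card_dvd_of_le hR.1)).trans c.hcard
  have hbn : b + 1 < n := by
    have := vle 2 n (b + 1) Nat.prime_two (by omega) hb1
    omega
  have hkb : k ≤ b := by
    rw [hk, hb] at hcVR
    exact (Nat.pow_le_pow_iff_right (by norm_num)).mp hcVR
  have hsn2 : s + 2 ≤ n := by
    rcases c.hsc with h | h | ⟨h, h'⟩
    · exact h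
    · omega
    · exact absurd ((pow_dvd_pow 2 (by omega)).trans hb1) h'
  have hk2 : k < 2 * (s - 1) := by have := c.hsn; omega
  have hJn : ∀ y ∈ Y, ∀ r ∈ Y ⊓ π.ker, y * r * y⁻¹ ∈ Y ⊓ π.ker := fun y hy r hr =>
    ⟨Y.mul_mem (Y.mul_mem hy hr.1) (Y.inv_mem hy), (inferInstance : π.ker.Normal).conj_mem r hr.2 y⟩
  -- 2-subgroups of J1 lie in R
  have hTR : ∀ T : Subgroup X, T ≤ Y ⊓ π.ker → IsPGroup 2 T → T ≤ R := fun T hT hT2 =>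
    mem_of_norm hR (hT.trans inf_le_right) hT2 ((hT.trans inf_le_left).trans hYR)
  -- R ∩ Y acts trivially
  haveI hVnt : Nontrivial V := by
    by_contra h
    rw [not_nontrivial_iff_subsingleton] at h
    exact hρ'x (by ext r; exact Subsingleton.elim _ _)
  have hRY : ∀ r : Y, (r : X) ∈ R → ρ' r = 1 := by
    set F : Subgroup V :=
      { carrier := {v | ∀ r : Y, (r : X) ∈ R → ρ' r v = v}
        one_mem' := fun r _ => map_one _
        mul_mem' := fun {a b} ha hb r hr => by rw [map_mul, ha r hr, hb r hr]
        inv_mem' := fun {a} ha r hr => by rw [map_inv, ha r hr] } with hF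
    have hFi : Inv ρ' F := by
      intro y v hv r hr
      have h1 : ((y⁻¹ * r * y : Y) : X) ∈ R := by
        have := (mem_normalizer_iff.mp ((normalizer (R : Set X)).inv_mem (hYR y.2)) (r : X)).mp hr
        simpa using this
      have h2 := hv _ h1
      have h3 := congrArg (ρ' y) h2
      rw [← MulAut.mul_apply, ← map_mul] at h3
      have h4 : y * (y⁻¹ * r * y) = r * y := by group
      rw [h4, map_mul, MulAut.mul_apply] at h3
      exact h3
    rcases hirr F inferInstance hFi with h | h
    · exfalso
      set T : Subgroup Y := R.subgroupOf Y with hT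
      have hT2 : IsPGroup 2 T := hR.isPGroup.comap_of_injective Y.subtype Y.subtype_injective
      letI : MulAction T V := MulAction.compHom V ((ρ'.comp T.subtype))
      obtain ⟨v, hv, hv1⟩ := hT2.exists_fixed_point_of_prime_dvd_card_of_fixed_point V
        (by rw [hk]; exact dvd_pow_self 2 (by have := c.s5; omega)) (a := (1 : V)) (by
          intro t
          exact map_one (ρ' t))
      have : v ∈ F := by
        intro r hr
        exact hv ⟨r, hr⟩
      rw [h, mem_bot] at this
      exact hv1 this.symm
    · intro r hr
      ext v
      have : v ∈ F := h ▸ mem_top v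
      exact this r hr
  -- J1 commutes with x on V
  set B : Subgroup X := (Subgroup.comap ρ' (centralizer {ρ' xY})).map Y.subtype with hB
  have hJB : Y ⊓ π.ker ≤ B := by
    apply le_of_syl
    intro p hp
    haveI := Fact.mk hp
    obtain ⟨Dp, hDp⟩ := syl_exists p (Y ⊓ π.ker)
    by_cases hp2 : p = 2
    · subst hp2
      refine ⟨Dp, hDp, fun t ht => ?_⟩
      have htY : t ∈ Y := (hDp.1 ht).1
      refine ⟨⟨t, htY⟩, ?_, rfl⟩
      have htR := hTR Dp hDp.1 hDp.isPGroup ht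
      refine mem_comap.mpr ?_
      rw [hRY ⟨t, htY⟩ htR]
      exact one_mem _
    · have hcov := frat_cov hY hDp
      have hnd : ¬ s ∣ Nat.card ((Y ⊓ normalizer (Dp : Set X)) ⊓ π.ker : Subgroup X) := fun h =>
        hYs (h.trans (Subgroup.card_dvd_of_le (inf_le_inf_right _ inf_le_left)))
      obtain ⟨z, hz, hzs, hzv⟩ := c.rat1 hnd (hcov _)
      have hzr := c.ratCov hnd hcov hz hzs hzv
      have hzD := c.oddA inf_le_right hz hzs hzr hp hp2 hDp.isPGroup (hDp.1.trans inf_le_right)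
      have hz1 : z ≠ 1 := by
        rintro rfl; exact c.ne hzv (map_one π)
      obtain ⟨a, ha, i, hai⟩ := c.conjS hYs hz.1 hx hzs hxs hz1
      refine ⟨cj a⁻¹ Dp, syl_cj hDp _ (hJn _ (Y.inv_mem ha)), fun t ht => ?_⟩
      have htJ : t ∈ Y ⊓ π.ker := (syl_cj hDp _ (hJn _ (Y.inv_mem ha))).1 ht
      refine ⟨⟨t, htJ.1⟩, ?_, rfl⟩
      rw [mem_cj, inv_inv] at ht
      have h1 : Commute (z ^ i) (a * t * a⁻¹) := (show Commute z _ from hzD _ ht).pow_left i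
      rw [← hai] at h1
      have h2 : x * t = t * x := by
        have h3 := congrArg (fun w => a⁻¹ * w * a) h1.eq
        simpa [mul_assoc] using h3
      refine mem_comap.mpr ?_
      rw [mem_centralizer_singleton_iff, ← map_mul, ← map_mul]
      congr 1
      exact Subtype.ext h2.symm
  -- the subgroup commuting with J1 on V
  set Jn : Set (MulAut V) := {d | ∃ j : Y, π j = 1 ∧ d = ρ' j} with hJnd
  set C : Subgroup X := (Subgroup.comap ρ' (centralizer Jn)).map Y.subtype with hC
  have hCY : C ≤ Y := map_subtype_le _
  have hmemC : ∀ y : Y, (y : X) ∈ C ↔ ∀ j : Y, π j = 1 → ρ' j * ρ' y = ρ' y * ρ' j := by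
    intro y
    constructor
    · rintro ⟨y', hy', he⟩
      rw [show y = y' from Subtype.ext he.symm]
      intro j hj
      exact mem_centralizer_iff.mp hy' _ ⟨j, hj, rfl⟩
    · intro h
      refine ⟨y, ?_, rfl⟩
      refine mem_comap.mpr ?_
      rw [mem_centralizer_iff]
      rintro _ ⟨j, hj, rfl⟩
      exact h j hj
  have hxC : x ∈ C := by
    refine (hmemC xY).mpr fun j hj => ?_
    obtain ⟨j', hj', he⟩ := hJB (show (j : X) ∈ Y ⊓ π.ker from ⟨j.2, hj⟩)
    rw [show j = j' from Subtype.ext he.symm]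
    exact mem_centralizer_singleton_iff.mp hj'
  have hCn : ∀ y ∈ Y, ∀ w ∈ C, y * w * y⁻¹ ∈ C := by
    intro y hy w hw
    have h1 := (hmemC ⟨w, hCY hw⟩).mp hw
    refine (hmemC (⟨y, hy⟩ * ⟨w, hCY hw⟩ * ⟨y, hy⟩⁻¹)).mpr fun j hj => ?_
    have h2 := h1 (⟨y, hy⟩⁻¹ * j * ⟨y, hy⟩) (by simp [hj])
    have h3 := congrArg (fun z => ρ' ⟨y, hy⟩ * z * (ρ' ⟨y, hy⟩)⁻¹) h2
    simp only [map_mul, map_inv, mul_assoc, mul_inv_cancel_left, mul_inv_cancel, mul_one] at h3 ⊢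
    exact h3
  have hCcov : ACov π C := acov_of_norm c.hn hY hCn hxC (c.ne hxv)
  have hCs : ¬ s ∣ Nat.card (C ⊓ π.ker : Subgroup X) := fun h =>
    hYs (h.trans (Subgroup.card_dvd_of_le (inf_le_inf_right _ hCY)))
  have hCr := c.ratACov hsn2 hCs hCcov hxC hxs hxv
  -- J1 trivial on V
  have hJ1 : ∀ d ∈ Jn, d = 1 := by
    refine dAct s c.hs hs2 V hV ρ' hirr k hk hk2 xY hxYs hρ'x Jn ?_ ?_ ?_ ?_
    · rintro y _ ⟨j, hj, rfl⟩
      exact ⟨y * j * y⁻¹, by simp [hj], by simp⟩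
    · rintro _ ⟨j, hj, rfl⟩
      obtain ⟨a, o, ho, hao⟩ := Nat.exists_eq_two_pow_mul_odd (orderOf_pos j).ne'
      refine ⟨o, ho, ?_⟩
      rw [← map_pow]
      apply hRY
      have h1 : IsPGroup 2 (zpowers ((j ^ o : Y) : X)) := by
        apply IsPGroup.of_card (n := a)
        rw [Nat.card_zpowers, Subgroup.orderOf_coe, orderOf_pow, hao]
        rw [Nat.gcd_mul_left_left, Nat.mul_div_cancel _ ho.pos]
      refine hTR _ ?_ h1 (mem_zpowers _)
      rw [zpowers_le]
      refine ⟨(j ^ o).2, ?_⟩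
      change π _ = 1
      simp [hj]
    · rintro _ ⟨j, hj, rfl⟩
      exact (hmemC xY).mp hxC j hj
    · intro j hj
      obtain ⟨y, hy, h1⟩ := hCr j hj
      refine ⟨⟨y, hCY hy⟩, Subtype.ext h1, ?_⟩
      rintro _ ⟨i, hi, rfl⟩
      exact (hmemC ⟨y, hCY hy⟩).mp hy i hi
  -- V is a module for the symmetric group
  have hsurj : Function.Surjective (π.comp Y.subtype) := by
    intro τ
    obtain ⟨y, hy, h⟩ := hY τ
    exact ⟨⟨y, hy⟩, h⟩
  have hker : (π.comp Y.subtype).ker ≤ ρ'.ker := fun j hj => hJ1 _ ⟨j, hj, rfl⟩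
  let ρ'' : Perm (Fin n) →* MulAut V := MonoidHom.liftOfSurjective (π.comp Y.subtype) hsurj ⟨ρ', hker⟩
  have hρ'' : ∀ y : Y, ρ'' (π y) = ρ' y := by
    intro y
    exact MonoidHom.liftOfRightInverse_comp_apply _ _ (Function.rightInverse_surjInv hsurj) ⟨ρ', hker⟩ y
  have hkn : n - 2 ≤ k := by
    letI := elMod 2 V hV
    haveI : FiniteDimensional (ZMod 2) (Ad V) := Module.Finite.of_finite
    have h3 := card_Ad 2 V
    rw [hk] at h3
    have h4 := Nat.pow_right_injective le_rfl h3
    rw [h4]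
    refine wagner (V := Ad V) c.hn ((toEnd 2 V).comp ρ'') s c.hs c.s5 ι (by omega) ?_
    intro h5
    apply hρ'x
    rw [← hρ'' xY]
    change ρ'' (π x) = 1
    rw [hxv]
    exact toEnd_inj 2 V (h5.trans (map_one _).symm)
  have hcardeq : Nat.card V = Nat.card R := by
    rw [hk, hb]; congr 1; omega
  obtain ⟨e, he⟩ := hiso hcardeq
  have hRc : ∀ a ∈ R, ∀ b ∈ R, a * b = b * a := by
    intro a ha b hb
    have : (⟨a, ha⟩ : R) * ⟨b, hb⟩ = ⟨b, hb⟩ * ⟨a, ha⟩ := by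
      apply e.injective
      rw [map_mul, map_mul, mul_comm]
    exact congrArg Subtype.val this
  refine ⟨hRc, ?_⟩
  -- now D
  let α : normalizer (R : Set X) →* MulAut V := (MulAut.congr e).toMonoidHom.comp (normalizerMonoidHom R)
  have hα : ∀ y : Y, α ⟨y, hYR y.2⟩ = ρ' y := by
    intro y
    ext v
    have := he y (e.symm v)
    rw [e.apply_symm_apply] at this
    rw [← this]; rfl
  have hxD := c.oddA hYD hx hxs hr hq hq2 hD hDM
  have hC2cov := c.acovC hY hYD hx hxv hxD
  have hC2s : ¬ s ∣ Nat.card ((Y ⊓ centralizer (D : Set X)) ⊓ π.ker : Subgroup X) := fun h =>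
    hYs (h.trans (Subgroup.card_dvd_of_le (inf_le_inf_right _ inf_le_left)))
  have hC2r := c.ratACov hsn2 hC2s hC2cov ⟨hx, mem_cent hxD⟩ hxs hxv
  have hDV : ∀ d ∈ {d | ∃ δ : normalizer (R : Set X), (δ : X) ∈ D ∧ d = α δ}, d = 1 := by
    refine dAct s c.hs hs2 V hV ρ' hirr k hk hk2 xY hxYs hρ'x _ ?_ ?_ ?_ ?_
    · rintro y _ ⟨δ, hδ, rfl⟩
      refine ⟨⟨y, hYR y.2⟩ * δ * ⟨y, hYR y.2⟩⁻¹, (mem_normalizer_iff.mp (hYD y.2) _).mp hδ, ?_⟩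
      rw [map_mul, map_mul, map_inv, hα]
    · rintro _ ⟨δ, hδ, rfl⟩
      obtain ⟨a, ha⟩ := hD ⟨δ, hδ⟩
      refine ⟨q ^ a, (hq.odd_of_ne_two hq2).pow, ?_⟩
      rw [← map_pow, show δ ^ q ^ a = 1 from Subtype.ext (congrArg Subtype.val ha :), map_one]
    · rintro _ ⟨δ, hδ, rfl⟩
      rw [← hα, ← map_mul, ← map_mul]
      congr 1
      exact Subtype.ext (hxD _ hδ).symm
    · intro j hj
      obtain ⟨y, hy, h1⟩ := hC2r j hj
      refine ⟨⟨y, hy.1⟩, Subtype.ext h1, ?_⟩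
      rintro _ ⟨δ, hδ, rfl⟩
      rw [← hα, ← map_mul, ← map_mul]
      congr 1
      exact Subtype.ext (mem_centralizer_iff.mp hy.2 _ hδ)
  intro d hd r hr
  have h1 := hDV _ ⟨⟨d, hDR hd⟩, hd, rfl⟩
  have h2 : normalizerMonoidHom R ⟨d, hDR hd⟩ = 1 := (MulAut.congr e).injective (h1.trans (map_one _).symm)
  have h3 : d * r * d⁻¹ = r := by
    have := congrArg (fun z => ((z ⟨r, hr⟩ : R) : X)) h2
    exact this
  exact mul_inv_eq_iff_eq_mul.mp h3

theorem Ctx.gTwo (c : Ctx n s π ι) {R : Subgroup X} (hR : Syl 2 π.ker R) :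
    ACov π (centralizer (R : Set X)) ∨ π.ker ⊓ normalizer (R : Set X) ≤ centralizer (R : Set X) := by
  haveI : Fact (Nat.Prime 2) := ⟨Nat.prime_two⟩
  by_cases hA : ACov π (centralizer (R : Set X))
  · exact Or.inl hA
  right
  have key : ∀ q : ℕ, q.Prime → q ≠ 2 → ∃ D, Syl q (π.ker ⊓ normalizer (R : Set X)) D ∧ (∀ a ∈ R, ∀ b ∈ R, a * b = b * a) ∧
      (∀ d ∈ D, ∀ r ∈ R, d * r = r * d) := by
    intro q hq hq2
    haveI := Fact.mk hq
    obtain ⟨D, hD⟩ := syl_exists q (π.ker ⊓ normalizer (R : Set X))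
    have h1 : Cov π (⊤ ⊓ normalizer (R : Set X)) := frat_cov c.covTop (by simpa using hR)
    rw [top_inf_eq] at h1
    have h2 := frat_cov h1 (D := D) (by rwa [inf_comm] at hD)
    obtain ⟨Y, hle, hcov, hnd, x, hx, hxs, hxv, hr⟩ := c.coverX h2
    have hYR : Y ≤ normalizer (R : Set X) := hle.trans inf_le_left
    have hYD : Y ≤ normalizer (D : Set X) := hle.trans inf_le_right
    refine ⟨D, hD, c.two hR hcov hnd hYR hYD hq hq2 hD.isPGroup (hD.1.trans inf_le_left) (hD.1.trans inf_le_right) hx hxs hxv hr ?_⟩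
    intro hxR
    exact hA ((c.acovC hcov hYR hx hxv hxR).mono inf_le_right)
  apply le_of_syl
  intro q hq
  by_cases hq2 : q = 2
  · subst hq2
    refine ⟨R, hR.mono (le_inf hR.1 le_normalizer) inf_le_left hq, fun a ha => ?_⟩
    obtain ⟨D, _, h, _⟩ := key 3 Nat.prime_three (by norm_num)
    exact mem_cent fun d hd => h a ha d hd
  · obtain ⟨D, hD, _, h⟩ := key q hq hq2
    exact ⟨D, hD, fun d hd => mem_cent (h d hd)⟩

end ctx
end Stmt15

set_option linter.style.haveILetI false
set_option linter.unusedSectionVars false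
namespace Stmt15
open Module Subgroup Equiv

section ctx
variable {n s : ℕ} {X : Type*} [Group X] [Finite X] {π : X →* Perm (Fin n)} {ι : ZMod s ↪ Fin n}

lemma burnside {p : ℕ} [hp : Fact p.Prime] {H P : Subgroup X} (hP : Syl p H P) (h : H ⊓ normalizer (P : Set X) ≤ centralizer (P : Set X)) :
    ∃ K ≤ H, (∀ g ∈ H, g ∈ K ↔ ¬ p ∣ orderOf g) ∧ Nat.card K * Nat.card P = Nat.card H := by
  set T := hP.toSylow with hT
  have hmem : ∀ g : H, g ∈ (T : Subgroup H) ↔ (g : X) ∈ P := fun g => Iff.rfl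
  have hN : normalizer ((T : Subgroup H) : Set H) ≤ centralizer ((T : Subgroup H) : Set H) := by
    intro g hg
    have h1 : (g : X) ∈ H ⊓ normalizer (P : Set X) := by
      refine ⟨g.2, mem_normalizer_iff.mpr ?_⟩
      apply conj_mem_iff_of_finite
      intro r hr
      exact (hmem _).mp ((mem_normalizer_iff.mp hg ⟨r, hP.1 hr⟩).mp ((hmem _).mpr hr))
    have h2 := mem_centralizer_iff.mp (h h1)
    refine mem_centralizer_iff.mpr fun r hr => Subtype.ext (h2 r hr)
  set φ := MonoidHom.transferSylow T hN with hφ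
  have hc := MonoidHom.ker_transferSylow_isComplement' T hN
  have hnd := MonoidHom.not_dvd_card_ker_transferSylow T hN
  refine ⟨φ.ker.map H.subtype, map_subtype_le _, ?_, ?_⟩
  · intro g hg
    have h3 : g ∈ φ.ker.map H.subtype ↔ (⟨g, hg⟩ : H) ∈ φ.ker := by
      constructor
      · rintro ⟨g', hg', he⟩
        rwa [show (⟨g, hg⟩ : H) = g' from Subtype.ext he.symm]
      · intro h; exact ⟨_, h, rfl⟩
    rw [h3]
    have ho : orderOf g = orderOf (⟨g, hg⟩ : H) := (Subgroup.orderOf_mk g hg).symm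
    rw [ho]
    constructor
    · intro h4 h5
      exact hnd (h5.trans (Subgroup.orderOf_dvd_natCard _ h4))
    · intro h4
      have h5 : orderOf (φ ⟨g, hg⟩) ∣ orderOf (⟨g, hg⟩ : H) := orderOf_map_dvd φ _
      obtain ⟨k, hk⟩ := (IsPGroup.iff_orderOf.mp T.isPGroup') (φ ⟨g, hg⟩)
      rw [MonoidHom.mem_ker, ← orderOf_eq_one_iff, hk]
      rw [hk] at h5
      rcases Nat.eq_zero_or_pos k with rfl | hk0
      · simp
      · exact absurd ((dvd_pow_self p hk0.ne').trans h5) h4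
  · rw [card_map_subtype, ← card_subgroupOf hP.1]
    exact hc.card_mul_card

lemma Ctx.lq (c : Ctx n s π ι) {P : Subgroup X} (hP : Syl s π.ker P) :
    ∀ w ∈ ⁅centralizer (P : Set X), centralizer (P : Set X)⁆, π w = 1 → w ^ s = 1 → w = 1 := by
  haveI := Fact.mk c.hs
  intro w hw hw1 hws
  have hwC : w ∈ centralizer (P : Set X) := commutator_le_self _ hw
  have hwN : zpowers w ≤ normalizer (P : Set X) := zpowers_le.mpr (centralizer_le_normalizer (P : Set X) hwC)
  have hwP : w ∈ P := mem_of_norm hP (zpowers_le.mpr hw1) (isP_zpowers hws) hwN (mem_zpowers w)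
  exact c.trC (fun g hg => (mem_centralizer_iff.mp hg w hwP).symm) hw hws

lemma Ctx.lq' (c : Ctx n s π ι) {P : Subgroup X} (hP : Syl s π.ker P) :
    ¬ s ∣ Nat.card (⁅centralizer (P : Set X), centralizer (P : Set X)⁆ ⊓ π.ker : Subgroup X) :=
  not_dvd_of c.hs fun w hw hws => c.lq hP w hw.1 hw.2 hws

lemma Ctx.l0 (c : Ctx n s π ι) {P R : Subgroup X} (hP : Syl s π.ker P)
    (h : ACov π (centralizer (R : Set X) ⊓ centralizer (P : Set X))) :
    ∃ w ∈ ⁅centralizer (P : Set X), centralizer (P : Set X)⁆, w ^ s = 1 ∧ w ≠ 1 ∧ w ∈ centralizer (R : Set X) := by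
  set A := ⁅centralizer (R : Set X) ⊓ centralizer (P : Set X), centralizer (R : Set X) ⊓ centralizer (P : Set X)⁆ with hA
  have hAQ : A ≤ ⁅centralizer (P : Set X), centralizer (P : Set X)⁆ := commutator_mono inf_le_right inf_le_right
  have hAC : A ≤ centralizer (R : Set X) := (commutator_le_self _).trans inf_le_left
  obtain ⟨w, hw, hws, hwv⟩ := c.rat1 (Y := A) (fun hd => c.lq' hP (hd.trans (Subgroup.card_dvd_of_le (inf_le_inf_right _ hAQ))))
    (acov_comm c.hn h _ c.cyc_mem)
  refine ⟨w, hAQ hw, hws, ?_, hAC hw⟩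
  rintro rfl
  exact c.ne hwv (map_one π)

lemma Ctx.cycP (c : Ctx n s π ι) {P : Subgroup X} (hP : Syl s π.ker P) : IsCyclic P := by
  haveI := Fact.mk c.hs
  have h1 := c.facM
  have h2 := hP.2
  interval_cases h : (Nat.card π.ker).factorization s
  · rw [pow_zero] at h2
    haveI := (Nat.card_eq_one_iff_unique.mp h2).1
    exact isCyclic_of_subsingleton
  · exact isCyclic_of_prime_card (p := s) (by simpa using h2)

lemma Ctx.powP (c : Ctx n s π ι) {P : Subgroup X} (hP : Syl s π.ker P) {p : X} (hp : p ∈ P) : p ^ s = 1 := by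
  have h1 : orderOf p ∣ Nat.card P := Subgroup.orderOf_dvd_natCard P hp
  rw [hP.2] at h1
  have h2 : orderOf p ∣ s := h1.trans ((pow_dvd_pow s c.facM).trans (by simp))
  exact orderOf_dvd_iff_pow_eq_one.mp h2

lemma Ctx.l1 (c : Ctx n s π ι) {P R : Subgroup X} (hP : Syl s π.ker P) (hPR : P ≤ centralizer (R : Set X))
    (hg : ACov π (centralizer (R : Set X))) : ACov π (centralizer (R : Set X) ⊓ centralizer (P : Set X)) := by
  haveI := Fact.mk c.hs
  haveI := c.cycP hP
  have h1 := frat_acov hg (D := P) (hP.mono (le_inf hPR hP.1) inf_le_right c.hs)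
  exact (acov_comm c.hn h1).mono (le_inf ((commutator_le_self _).trans inf_le_left) (comm_cent _ P))

lemma Ctx.l2 (c : Ctx n s π ι) {P R : Subgroup X} (hP : Syl s π.ker P) (hPR : P ≤ normalizer (R : Set X))
    (hnd : ∀ w ∈ P, w ∈ centralizer (R : Set X) → w = 1)
    (hg : ACov π (centralizer (R : Set X))) : ACov π (centralizer (R : Set X) ⊓ centralizer (P : Set X)) := by
  haveI := Fact.mk c.hs
  have hPn : P ≤ normalizer ((centralizer (R : Set X) : Subgroup X) : Set X) := by
    intro p hp
    rw [mem_normalizer_iff]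
    exact conj_mem_iff_of_finite p fun r hr => cent_norm (hPR hp) hr
  set A := QT (centralizer (R : Set X)) P hPn with hA
  have hCA : centralizer (R : Set X) ≤ A := fun x hx => ⟨x, hx, 1, P.one_mem, by simp⟩
  have hPA : P ≤ A := fun x hx => ⟨1, one_mem _, x, hx, by simp⟩
  have h1 := frat_acov (hg.mono hCA) (D := P) (hP.mono (le_inf hPA hP.1) inf_le_right c.hs)
  intro τ ht
  obtain ⟨y, ⟨⟨x, hx, p, hp, rfl⟩, hyN⟩, rfl⟩ := h1 τ ht
  have hxN : x ∈ normalizer (P : Set X) := by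
    have := (normalizer (P : Set X)).mul_mem hyN (inv_mem (le_normalizer hp))
    simpa using this
  refine ⟨x, ⟨hx, mem_cent fun d hd => ?_⟩, by rw [map_mul, (show π p = 1 from hP.1 hp), mul_one]⟩
  have h2 : x * d * x⁻¹ * d⁻¹ = 1 := by
    apply hnd
    · exact P.mul_mem ((mem_normalizer_iff.mp hxN d).mp hd) (P.inv_mem hd)
    · have h3 : d * x⁻¹ * d⁻¹ ∈ centralizer (R : Set X) := cent_norm (hPR hd) (inv_mem hx)
      have := mul_mem hx h3
      simpa [mul_assoc] using this
  rw [mul_inv_eq_one, mul_inv_eq_iff_eq_mul] at h2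
  exact h2

lemma Ctx.l3 (c : Ctx n s π ι) {P R : Subgroup X} (hP : Syl s π.ker P) (hPA : ACov π (centralizer (P : Set X))) {q : ℕ} (hq : q.Prime)
    (hqs : q ≠ s) (hR : Syl q π.ker R) (hP1 : P ≠ ⊥)
    (hnd : ∀ w ∈ π.ker, w ∈ normalizer (R : Set X) → w ^ s = 1 → w = 1) {w : X} (hwR : w ∈ centralizer (R : Set X))
    (hwP : w ∈ centralizer (P : Set X)) (hws : w ^ s = 1) (hw1 : π w ≠ 1) :
    w ∈ ⁅centralizer (P : Set X), centralizer (P : Set X)⁆ := by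
  haveI := Fact.mk c.hs
  haveI := Fact.mk hq
  set G1 := centralizer (P : Set X) with hG1
  set Q := ⁅G1, G1⁆ with hQ
  by_contra hwQ
  have hG1n : ∀ b ∈ normalizer (P : Set X), ∀ u ∈ Q, b * u * b⁻¹ ∈ Q := by
    intro y hy
    have h1 : cj y G1 ≤ G1 := by
      rintro _ ⟨g, hg, rfl⟩; exact cent_norm hy hg
    have h2 : cj y Q ≤ Q := by
      rw [cj, hQ, Subgroup.map_commutator]
      exact Subgroup.commutator_mono h1 h1
    intro g hg
    exact h2 (cj_mem hg)
  obtain ⟨σ, hσ, hσs, hσv⟩ := c.rat1 (c.lq' hP) (acov_comm c.hn hPA _ c.cyc_mem)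
  obtain ⟨S, hS, hwS⟩ := syl_exists_le (H := G1) (zpowers_le.mpr hwP) (isP_zpowers hws)
  obtain ⟨a, ha, haS⟩ := syl_conj_le (H := G1) (zpowers_le.mpr (commutator_le_self G1 hσ)) (isP_zpowers hσs) hS
  set u := a * σ * a⁻¹ with hu
  have huS : u ∈ S := haS σ (mem_zpowers σ)
  have huQ : u ∈ Q := hG1n a (centralizer_le_normalizer _ ha) σ hσ
  have hwS : w ∈ S := hwS (mem_zpowers w)
  have hu1 : π u ≠ 1 := by
    rw [hu, map_mul, map_mul, map_inv, hσv]
    intro h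
    rw [mul_inv_eq_one, mul_eq_left] at h
    exact cyc_ne_one c.hs ι h
  -- π u is a power of π w
  have hcardS : Nat.card (S.map π) ∣ s := by
    obtain ⟨k, hk⟩ := (hS.isPGroup.map π).exists_card_eq
    have h1 : Nat.card (S.map π) ∣ n.factorial := by
      have := Subgroup.card_subgroup_dvd_card (S.map π)
      rwa [Nat.card_perm, Nat.card_fin] at this
    rw [hk] at h1 ⊢
    have := (c.hs.pow_dvd_iff_le_factorization n.factorial_ne_zero).mp h1
    rw [c.fac] at this
    exact (pow_dvd_pow s this).trans (by simp)
  have hws' : (π w) ^ s = 1 := by rw [← map_pow, hws, map_one]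
  have hz : zpowers (π w) = S.map π := by
    apply Subgroup.eq_of_le_of_card_ge (zpowers_le.mpr (Subgroup.mem_map_of_mem π hwS))
    rw [Nat.card_zpowers, orderOf_eq_prime hws' hw1]
    exact Nat.le_of_dvd c.hs.pos hcardS
  have hui : π u ∈ zpowers (π w) := by rw [hz]; exact ⟨u, huS, rfl⟩
  obtain ⟨i, hi⟩ := (mem_powers_iff_mem_zpowers).mpr hui
  have hi : π w ^ i = π u := hi
  set p := (w ^ i)⁻¹ * u with hp
  have hpS : p ∈ S := S.mul_mem (S.inv_mem (S.pow_mem hwS i)) huS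
  have hpP : p ∈ P := by
    refine mem_of_norm hP (P := S ⊓ π.ker) inf_le_right (hS.isPGroup.to_le inf_le_left) ?_ ⟨hpS, ?_⟩
    · exact (inf_le_left.trans hS.1).trans (centralizer_le_normalizer _)
    · change π _ = 1
      rw [hp, map_mul, map_inv, map_pow, hi, inv_mul_cancel]
  have hup : u = w ^ i * p := by rw [hp]; group
  have hco : Nat.Coprime i s := by
    rw [Nat.coprime_comm, Nat.Prime.coprime_iff_not_dvd c.hs]
    rintro ⟨j, rfl⟩
    rw [pow_mul, hws', one_pow] at hi
    exact hu1 hi.symm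
  have hp1 : p ≠ 1 := by
    intro h
    rw [h, mul_one] at hup
    obtain ⟨m, hm⟩ := Nat.exists_mul_mod_eq_one_of_coprime hco c.hs.one_lt
    apply hwQ
    have h2 : w ^ (i * m) = w := by
      rw [← Nat.div_add_mod (i * m) s, hm.2, pow_add, pow_mul, hws]; simp
    rw [← h2, pow_mul, ← hup]
    exact Q.pow_mem huQ m
  have hpz : zpowers p = P := by
    apply Subgroup.eq_of_le_of_card_ge (zpowers_le.mpr hpP)
    rw [Nat.card_zpowers, orderOf_eq_prime (c.powP hP hpP) hp1, hP.2]
    exact Nat.le_of_dvd c.hs.pos ((pow_dvd_pow s c.facM).trans (by simp))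
  -- Burnside in B
  set B := π.ker ⊓ centralizer {w} with hB
  have hPB : P ≤ B := fun r hr => ⟨hP.1 hr, mem_centralizer_singleton_iff.mpr (mem_centralizer_iff.mp hwP r hr)⟩
  have hRB : R ≤ B := fun r hr => ⟨hR.1 hr, mem_centralizer_singleton_iff.mpr (mem_centralizer_iff.mp hwR r hr)⟩
  have hNB : B ⊓ normalizer (P : Set X) ≤ centralizer (P : Set X) := by
    rintro b ⟨hbB, hbN⟩
    have hbw : b * w = w * b := mem_centralizer_singleton_iff.mp hbB.2
    have hbp : b * p * b⁻¹ ∈ P := (mem_normalizer_iff.mp hbN p).mp hpP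
    have h1 : b * u * b⁻¹ * u⁻¹ = b * p * b⁻¹ * p⁻¹ := by
      have h2 : b * w ^ i = w ^ i * b := (show Commute b w from hbw).pow_right i
      have h3 : Commute (w ^ i) (b * p * b⁻¹ * p⁻¹) :=
        (show Commute w _ from (mem_centralizer_iff.mp hwP _ (P.mul_mem hbp (P.inv_mem hpP))).symm).pow_left i
      have h3' := h3.eq
      rw [hup, mul_inv_rev, ← mul_assoc b, h2]
      calc w ^ i * b * p * b⁻¹ * (p⁻¹ * (w ^ i)⁻¹) = (w ^ i * (b * p * b⁻¹ * p⁻¹)) * (w ^ i)⁻¹ := by group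
        _ = _ := by rw [h3']; group
    have h4 : b * p * b⁻¹ * p⁻¹ = 1 := by
      have hmP := P.mul_mem hbp (P.inv_mem hpP)
      refine c.lq hP _ ?_ (hP.1 hmP) (c.powP hP hmP)
      rw [← h1]
      exact Q.mul_mem (hG1n b hbN u huQ) (Q.inv_mem huQ)
    rw [mul_inv_eq_one, mul_inv_eq_iff_eq_mul] at h4
    refine mem_cent fun d hd => ?_
    rw [← hpz] at hd
    obtain ⟨j, rfl⟩ := mem_zpowers_iff.mp hd
    exact ((show Commute b p from h4).zpow_right j).eq
  obtain ⟨U, hUB, hU, hUc⟩ := burnside (hP.mono hPB inf_le_left c.hs) hNB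
  have hRU : R ≤ U := by
    intro r hr
    rw [hU r (hRB hr)]
    intro hd
    have h1 := hd.trans (Subgroup.orderOf_dvd_natCard R hr)
    rw [hR.2] at h1
    exact hqs ((Nat.prime_dvd_prime_iff_eq c.hs hq).mp (c.hs.dvd_of_dvd_pow h1)).symm
  obtain ⟨v, hv, hvN⟩ := frattini (hR.mono hRU (hUB.trans inf_le_left) hq) p (by
    intro r hr
    have hB' : p * r * p⁻¹ ∈ B := B.mul_mem (B.mul_mem (hPB hpP) (hUB hr)) (B.inv_mem (hPB hpP))
    rw [hU _ hB']
    rw [show orderOf (p * r * p⁻¹) = orderOf r from by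
      rw [← MulAut.conj_apply]; exact orderOf_injective (MulAut.conj p).toMonoidHom (MulAut.conj p).injective r]
    exact (hU r (hUB hr)).mp hr)
  have hvB : v * p ∈ B := B.mul_mem (hUB hv) (hPB hpP)
  have hvU : v * p ∉ U := by
    intro h
    have : p ∈ U := by
      have := U.mul_mem (U.inv_mem hv) h
      simpa using this
    rw [hU p (hPB hpP), orderOf_eq_prime (c.powP hP hpP) hp1] at this
    exact this dvd_rfl
  rw [hU _ hvB, not_not] at hvU
  obtain ⟨m, hm⟩ := hvU
  have h6 := hnd ((v * p) ^ m) (pow_mem hvB.1 m) (pow_mem hvN m) (by rw [← pow_mul, mul_comm, ← hm, pow_orderOf_eq_one])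
  have h7 := orderOf_dvd_of_pow_eq_one h6
  rw [hm] at h7
  have hm0 : 0 < m := by
    rcases Nat.eq_zero_or_pos m with rfl | h
    · have := orderOf_pos (v * p); omega
    · exact h
  have := Nat.le_of_dvd hm0 h7
  have := c.hs.two_le
  nlinarith

lemma cent_cj {R : Subgroup X} {m w : X} (h : w ∈ centralizer (R : Set X)) : m * w * m⁻¹ ∈ centralizer (cj m R : Set X) := by
  refine mem_cent fun d hd => ?_
  rw [mem_cj] at hd
  have h1 := mem_centralizer_iff.mp h _ hd
  have h2 := congrArg (fun z => m * z * m⁻¹) h1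
  simp only [mul_assoc, mul_inv_cancel_left, mul_inv_cancel, mul_one] at h2 ⊢
  exact h2.symm

lemma norm_cj {R : Subgroup X} {m w : X} (h : w ∈ normalizer (R : Set X)) : m * w * m⁻¹ ∈ normalizer (cj m R : Set X) := by
  rw [mem_normalizer_iff] at *
  intro d
  rw [mem_cj, mem_cj, h]
  simp only [mul_assoc, mul_inv_rev, inv_inv, inv_mul_cancel_left, inv_mul_cancel, mul_one]

theorem Ctx.line (c : Ctx n s π ι) (hsM : s ∣ Nat.card π.ker)
    (hgood : ∀ q : ℕ, q.Prime → ∀ R, Syl q π.ker R → ACov π (centralizer (R : Set X))) :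
    ∃ σ : X, π σ = cyc ι ∧ ∀ m ∈ π.ker, σ * m = m * σ := by
  haveI := Fact.mk c.hs
  obtain ⟨P, hP⟩ := syl_exists s π.ker
  have hfM : (Nat.card π.ker).factorization s = 1 := by
    have h0 : s ^ 1 ∣ Nat.card π.ker := by rw [pow_one]; exact hsM
    have h1 := (c.hs.pow_dvd_iff_le_factorization Nat.card_pos.ne').mp h0
    have := c.facM; omega
  have hPc : Nat.card P = s := by rw [hP.2, hfM, pow_one]
  have hP1 : P ≠ ⊥ := by
    rintro rfl
    rw [Subgroup.card_bot] at hPc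
    have := c.hs.two_le; omega
  set Q := ⁅centralizer (P : Set X), centralizer (P : Set X)⁆ with hQ
  have hPA := hgood s c.hs P hP
  obtain ⟨σ, hσ, hσs, hσv⟩ := c.rat1 (c.lq' hP) (acov_comm c.hn hPA _ c.cyc_mem)
  have hMn : ∀ a : X, ∀ r ∈ π.ker, a * r * a⁻¹ ∈ π.ker := fun a r hr => (inferInstance : π.ker.Normal).conj_mem r hr a
  -- conjugating an order s element of M into P
  have hconj : ∀ p ∈ π.ker, p ^ s = 1 → p ≠ 1 → ∃ m ∈ π.ker, ∀ r ∈ P, ∃ i : ℤ, r = m * p ^ i * m⁻¹ := by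
    intro p hp hps hp1
    have h1 : Syl s π.ker (zpowers p) := ⟨zpowers_le.mpr hp, by rw [Nat.card_zpowers, orderOf_eq_prime hps hp1, hfM, pow_one]⟩
    obtain ⟨m, hm, h2⟩ := syl_conj hP h1
    refine ⟨m⁻¹, inv_mem hm, fun r hr => ?_⟩
    obtain ⟨i, hi⟩ := mem_zpowers_iff.mp ((h2 r).mp hr)
    exact ⟨i, by rw [hi]; group⟩
  have claim : ∀ q : ℕ, q.Prime → q ≠ s → ∃ R, Syl q π.ker R ∧ ∃ w ∈ Q, w ^ s = 1 ∧ w ≠ 1 ∧ w ∈ centralizer (R : Set X) := by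
    intro q hq hqs
    haveI := Fact.mk hq
    by_cases hA : ∃ R, Syl q π.ker R ∧ P ≤ centralizer (R : Set X)
    · obtain ⟨R, hR, hPR⟩ := hA
      exact ⟨R, hR, c.l0 hP (c.l1 hP hPR (hgood q hq R hR))⟩
    have hA' : ∀ R, Syl q π.ker R → ∀ w ∈ π.ker, w ∈ centralizer (R : Set X) → w ^ s = 1 → w = 1 := by
      intro R hR w hw hwC hws
      by_contra hw1
      obtain ⟨m, hm, h⟩ := hconj w hw hws hw1
      apply hA
      refine ⟨cj m R, syl_cj hR m (hMn m), fun r hr => ?_⟩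
      obtain ⟨i, rfl⟩ := h r hr
      exact cent_cj (zpow_mem hwC i)
    by_cases hB : ∃ R, Syl q π.ker R ∧ P ≤ normalizer (R : Set X)
    · obtain ⟨R, hR, hPR⟩ := hB
      exact ⟨R, hR, c.l0 hP (c.l2 hP hPR (fun w hw hwC => hA' R hR w (hP.1 hw) hwC (c.powP hP hw)) (hgood q hq R hR))⟩
    have hB' : ∀ R, Syl q π.ker R → ∀ w ∈ π.ker, w ∈ normalizer (R : Set X) → w ^ s = 1 → w = 1 := by
      intro R hR w hw hwC hws
      by_contra hw1
      obtain ⟨m, hm, h⟩ := hconj w hw hws hw1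
      apply hB
      refine ⟨cj m R, syl_cj hR m (hMn m), fun r hr => ?_⟩
      obtain ⟨i, rfl⟩ := h r hr
      exact norm_cj (zpow_mem hwC i)
    obtain ⟨R0, hR0⟩ := syl_exists q π.ker
    obtain ⟨w, hw, hws, hwv⟩ := c.rat1 (Y := centralizer (R0 : Set X))
      (not_dvd_of c.hs fun w hw hws => hA' R0 hR0 w hw.2 hw.1 hws) (hgood q hq R0 hR0 _ c.cyc_mem)
    obtain ⟨S, hS, hwS⟩ := syl_exists_le (H := (⊤ : Subgroup X)) le_top (isP_zpowers hws)
    have hwS := hwS (mem_zpowers w)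
    have hSp : ∃ p ∈ S, p ∈ π.ker ∧ p ^ s = 1 ∧ p ≠ 1 := by
      by_contra hcon
      push Not at hcon
      have hinj : Function.Injective (π.comp S.subtype) := by
        rw [injective_iff_map_eq_one]
        intro r hr
        obtain ⟨k, hk⟩ := hS.isPGroup r
        have h3 : ∀ k : ℕ, ∀ w : X, w ∈ S ⊓ π.ker → w ^ s ^ k = 1 → w = 1 := by
          intro k
          induction k with
          | zero => intro w _ hw; simpa using hw
          | succ k ih =>
            intro w hw hw2
            rw [pow_succ', pow_mul] at hw2
            exact hcon w hw.1 hw.2 (ih _ (Subgroup.pow_mem _ hw s) hw2)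
        exact Subtype.ext (h3 k r ⟨r.2, hr⟩ (by exact_mod_cast congrArg Subtype.val hk))
      have h4 : Nat.card S ∣ n.factorial := by
        have := Subgroup.card_dvd_of_injective _ hinj
        rwa [Nat.card_perm, Nat.card_fin] at this
      rw [hS.2, Subgroup.card_top, c.cardX, Nat.factorization_mul n.factorial_ne_zero Nat.card_pos.ne', Finsupp.add_apply, c.fac, hfM] at h4
      have := (c.hs.pow_dvd_iff_le_factorization n.factorial_ne_zero).mp h4
      rw [c.fac] at this
      omega
    obtain ⟨p, hpS, hpM, hps, hp1⟩ := hSp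
    have hwp : w * p = p * w := c.sab S hS.isPGroup w hwS p hpS
    obtain ⟨m, hm, h⟩ := hconj p hpM hps hp1
    have hR := syl_cj hR0 m (hMn m)
    have hw'1 : π (m * w * m⁻¹) ≠ 1 := by
      rw [map_mul, map_mul, map_inv, (show π m = 1 from hm)]
      simpa using c.ne hwv
    refine ⟨cj m R0, hR, m * w * m⁻¹, ?_, by rw [conj_pow, hws]; simp, ?_, cent_cj hw⟩
    · refine c.l3 hP hPA hq hqs hR hP1 (hB' _ hR) (cent_cj hw) ?_ (by rw [conj_pow, hws]; simp) hw'1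
      refine mem_cent fun d hd => ?_
      obtain ⟨i, rfl⟩ := h d hd
      have h1 := ((show Commute w p from hwp).zpow_right i).eq
      have h2 := congrArg (fun z => m * z * m⁻¹) h1
      simpa [mul_assoc] using h2
    · intro h
      exact hw'1 (by rw [h, map_one])
  refine ⟨σ, hσv, ?_⟩
  have hle : π.ker ≤ centralizer {σ} := by
    apply le_of_syl
    intro q hq
    by_cases hqs : q = s
    · subst hqs
      refine ⟨P, hP, fun r hr => mem_centralizer_singleton_iff.mpr ?_⟩
      exact mem_centralizer_iff.mp (commutator_le_self _ hσ) r hr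
    · obtain ⟨R, hR, w, hwQ, hws, hw1, hwR⟩ := claim q hq hqs
      obtain ⟨a, ha, i, hi⟩ := c.conjS (c.lq' hP) hwQ hσ hws hσs hw1
      refine ⟨cj a⁻¹ R, syl_cj hR _ (hMn _), fun r hr => mem_centralizer_singleton_iff.mpr ?_⟩
      rw [mem_cj, inv_inv] at hr
      have h1 : Commute (w ^ i) (a * r * a⁻¹) := (show Commute w _ from (mem_centralizer_iff.mp hwR _ hr).symm).pow_left i
      rw [← hi] at h1
      have h3 := congrArg (fun w => a⁻¹ * w * a) h1.eq
      have h2 : σ * r = r * σ := by simpa [mul_assoc] using h3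
      exact h2.symm
  intro m hm
  exact (mem_centralizer_singleton_iff.mp (hle hm)).symm

end ctx
end Stmt15

set_option linter.style.haveILetI false
set_option linter.unusedSectionVars false
set_option linter.unusedSimpArgs false
namespace Stmt15
open Module Subgroup Equiv

/-- three-cycles -/
def tc {α : Type*} [DecidableEq α] (p q b : α) : Perm α := swap p q * swap q b

lemma via_swap {α β : Type*} [DecidableEq α] [DecidableEq β] (θ : α ↪ β) (i j : α) :
    Equiv.Perm.viaEmbeddingHom θ (swap i j) = swap (θ i) (θ j) := by
  ext a
  rw [Equiv.Perm.viaEmbeddingHom_apply]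
  by_cases ha : a ∈ Set.range θ
  · obtain ⟨x, rfl⟩ := ha
    rw [Equiv.Perm.viaEmbedding_apply, swap_apply_def, swap_apply_def]
    simp only [θ.injective.eq_iff]
    split_ifs <;> rfl
  · rw [Equiv.Perm.viaEmbedding_apply_of_notMem _ _ _ ha, swap_apply_of_ne_of_ne]
    · rintro rfl; exact ha ⟨_, rfl⟩
    · rintro rfl; exact ha ⟨_, rfl⟩

lemma via_tc {α β : Type*} [DecidableEq α] [DecidableEq β] (θ : α ↪ β) (i j k : α) :
    Equiv.Perm.viaEmbeddingHom θ (tc i j k) = tc (θ i) (θ j) (θ k) := by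
  rw [tc, map_mul, via_swap, via_swap, tc]

lemma conj_tc {α : Type*} [DecidableEq α] (c : Perm α) (i j k : α) : c * tc i j k * c⁻¹ = tc (c i) (c j) (c k) := by
  rw [tc, tc, swap_apply_apply, swap_apply_apply]; group

lemma klein {G : Type*} [Group G] [Finite G] (H : Subgroup G) (v w : G) (hv : v ∈ H) (hw : w ∈ H) (hv2 : v * v = 1) (hw2 : w * w = 1)
    (hc : v * w = w * v) (hv1 : v ≠ 1) (hw1 : w ≠ 1) (hne : v ≠ w) : 4 ∣ Nat.card H := by
  let K : Subgroup G :=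
    { carrier := {1, v, w, v * w}
      one_mem' := by simp
      mul_mem' := by
        have e1 : v * (v * w) = w := by rw [← mul_assoc, hv2, one_mul]
        have e2 : w * (v * w) = v := by rw [hc, ← mul_assoc, hw2, one_mul]
        have e3 : v * w * v = w := by rw [hc, mul_assoc, hv2, mul_one]
        have e4 : v * w * w = v := by rw [mul_assoc, hw2, mul_one]
        have e5 : v * w * (v * w) = 1 := by rw [mul_assoc, e2, hv2]
        clear hne hv1 hw1
        rintro a b (rfl | rfl | rfl | rfl) (rfl | rfl | rfl | rfl) <;> simp [hv2, hw2, e1, e2, e3, e4, e5, ← hc]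
      inv_mem' := by
        have e1 : v⁻¹ = v := inv_eq_of_mul_eq_one_left hv2
        have e2 : w⁻¹ = w := inv_eq_of_mul_eq_one_left hw2
        rintro a (rfl | rfl | rfl | rfl) <;> simp [e1, e2, ← hc] }
  have hK : Nat.card K = 4 := by
    change Nat.card (({1, v, w, v * w} : Set G)) = 4
    classical
    have : ({1, v, w, v * w} : Set G) = (({1, v, w, v * w} : Finset G) : Set G) := by simp
    rw [Nat.card_coe_set_eq, this, Set.ncard_coe_finset]
    rw [Finset.card_insert_of_notMem, Finset.card_insert_of_notMem, Finset.card_insert_of_notMem, Finset.card_singleton]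
    · simp [hv1]
    · simp only [Finset.mem_insert, Finset.mem_singleton, not_or]
      exact ⟨hne, fun h => hw1 (by simpa using h)⟩
    · simp only [Finset.mem_insert, Finset.mem_singleton, not_or]
      refine ⟨hv1.symm, hw1.symm, fun h => hne ?_⟩
      calc v = v * w * w := by rw [mul_assoc, hw2, mul_one]
        _ = w := by rw [← h, one_mul]
  rw [← hK]
  apply Subgroup.card_dvd_of_le
  rintro a (rfl | rfl | rfl | rfl)
  · exact H.one_mem
  · exact hv
  · exact hw
  · exact H.mul_mem hv hw

lemma klein_via {α β : Type*} [Finite β] (θ : α ↪ β) (H : Subgroup (Perm β)) (v w : Perm α)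
    (hv : Equiv.Perm.viaEmbeddingHom θ v ∈ H) (hw : Equiv.Perm.viaEmbeddingHom θ w ∈ H) (h : v * v = 1 ∧ w * w = 1 ∧
     v * w = w * v ∧ v ≠ 1 ∧ w ≠ 1 ∧ v ≠ w) : 4 ∣ Nat.card H := by
  have hi := Equiv.Perm.viaEmbeddingHom_injective θ
  obtain ⟨h1, h2, h3, h4, h5, h6⟩ := h
  refine klein H _ _ hv hw ?_ ?_ ?_ ?_ ?_ ?_
  · rw [← map_mul, h1, map_one]
  · rw [← map_mul, h2, map_one]
  · rw [← map_mul, h3, map_mul]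
  · exact fun h => h4 (hi (by rw [h, map_one]))
  · exact fun h => h5 (hi (by rw [h, map_one]))
  · exact fun h => h6 (hi h)

lemma overlap2 {β : Type*} [DecidableEq β] [Finite β] (H : Subgroup (Perm β)) (p q b d : β) (h : [p, q, b, d].Nodup)
    (hx : tc p q b ∈ H) (hy : tc p q d ∈ H) : 4 ∣ Nat.card H := by
  let θ : Fin 4 ↪ β := ⟨[p, q, b, d].get, List.nodup_iff_injective_get.mp h⟩
  have e1 : Equiv.Perm.viaEmbeddingHom θ (tc 0 1 2) ∈ H := by rw [via_tc]; exact hx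
  have e2 : Equiv.Perm.viaEmbeddingHom θ (tc 0 1 3) ∈ H := by rw [via_tc]; exact hy
  refine klein_via θ H (tc 0 1 2 * tc 0 1 3) (tc 0 1 2 * tc 0 1 2 * tc 0 1 3 * tc 0 1 2 * tc 0 1 2) ?_ ?_ (by decide)
  · rw [map_mul]; exact mul_mem e1 e2
  · simp only [map_mul]; exact mul_mem (mul_mem (mul_mem (mul_mem e1 e1) e2) e1) e1

lemma overlap1 {β : Type*} [DecidableEq β] [Finite β] (H : Subgroup (Perm β)) (p a b c d : β) (h : [p, a, b, c, d].Nodup)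
    (hx : tc p a b ∈ H) (hy : tc p c d ∈ H) : 4 ∣ Nat.card H := by
  let θ : Fin 5 ↪ β := ⟨[p, a, b, c, d].get, List.nodup_iff_injective_get.mp h⟩
  have e1 : Equiv.Perm.viaEmbeddingHom θ (tc 0 1 2) ∈ H := by rw [via_tc]; exact hx
  have e2 : Equiv.Perm.viaEmbeddingHom θ (tc 0 3 4) ∈ H := by rw [via_tc]; exact hy
  refine klein_via θ H (tc 0 1 2 * tc 0 3 4 * tc 0 1 2 * tc 0 3 4 * tc 0 3 4) (tc 0 3 4 * tc 0 1 2 * tc 0 3 4 * tc 0 3 4 * tc 0 1 2) ?_ ?_ (by decide)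
  · simp only [map_mul]; exact mul_mem (mul_mem (mul_mem (mul_mem e1 e2) e1) e2) e2
  · simp only [map_mul]; exact mul_mem (mul_mem (mul_mem (mul_mem e2 e1) e2) e2) e1

lemma tc_rot {β : Type*} [DecidableEq β] (p q b : β) (h : [p, q, b].Nodup) : tc p q b = tc q b p := by
  let θ : Fin 3 ↪ β := ⟨[p, q, b].get, List.nodup_iff_injective_get.mp h⟩
  have h1 := congrArg (Equiv.Perm.viaEmbeddingHom θ) (show tc (0 : Fin 3) 1 2 = tc 1 2 0 by decide)
  rw [via_tc, via_tc] at h1; exact h1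

lemma tc_inv {β : Type*} [DecidableEq β] (p q b : β) (h : [p, q, b].Nodup) : (tc p q b)⁻¹ = tc q p b := by
  let θ : Fin 3 ↪ β := ⟨[p, q, b].get, List.nodup_iff_injective_get.mp h⟩
  have h1 := congrArg (Equiv.Perm.viaEmbeddingHom θ) (show (tc (0 : Fin 3) 1 2)⁻¹ = tc 1 0 2 by decide)
  rw [map_inv, via_tc, via_tc] at h1; exact h1

lemma tc_all {β : Type*} [DecidableEq β] (H : Subgroup (Perm β)) (p q b : β) (h : [p, q, b].Nodup)
    (hx : tc p q b ∈ H) : ∀ x ∈ ({p, q, b} : Finset β), ∀ y ∈ ({p, q, b} : Finset β), ∀ z ∈ ({p, q, b} : Finset β),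
      x ≠ y → x ≠ z → y ≠ z → tc x y z ∈ H := by
  have h1 : tc q b p ∈ H := tc_rot p q b h ▸ hx
  have h' : [q, b, p].Nodup := by simp at h ⊢; tauto
  have h2 : tc b p q ∈ H := tc_rot q b p h' ▸ h1
  have h'' : [b, p, q].Nodup := by simp at h ⊢; tauto
  have i1 := tc_inv p q b h ▸ inv_mem hx
  have i2 := tc_inv _ _ _ h' ▸ inv_mem h1
  have i3 := tc_inv _ _ _ h'' ▸ inv_mem h2
  intro x hx y hy z hz
  simp only [Finset.mem_insert, Finset.mem_singleton] at hx hy hz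
  rcases hx with rfl | rfl | rfl <;> rcases hy with rfl | rfl | rfl <;> rcases hz with rfl | rfl | rfl <;> simp [*]

lemma overlap {β : Type*} [DecidableEq β] [Finite β] (H : Subgroup (Perm β)) (T T' : Finset β) (hT : T.card = 3) (hT' : T'.card = 3)
    (h : ∀ x ∈ T, ∀ y ∈ T, ∀ z ∈ T, x ≠ y → x ≠ z → y ≠ z → tc x y z ∈ H)
    (h' : ∀ x ∈ T', ∀ y ∈ T', ∀ z ∈ T', x ≠ y → x ≠ z → y ≠ z → tc x y z ∈ H) (hne : T ≠ T') (hd : (T ∩ T').Nonempty) :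
    4 ∣ Nat.card H := by
  have c1 := Finset.card_inter_add_card_sdiff T T'
  have c2 := Finset.card_inter_add_card_sdiff T' T
  rw [Finset.inter_comm] at c2
  have c3 : (T ∩ T').card ≠ 3 := by
    intro h3
    apply hne
    have a1 := Finset.eq_of_subset_of_card_le (Finset.inter_subset_left (s₁ := T) (s₂ := T')) (by omega)
    have a2 := Finset.eq_of_subset_of_card_le (Finset.inter_subset_right (s₁ := T) (s₂ := T')) (by omega)
    exact a1.symm.trans a2
  have c4 := hd.card_pos
  have c5 : (T ∩ T').card = 1 ∨ (T ∩ T').card = 2 := by omega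
  rcases c5 with c5 | c5
  · obtain ⟨p, hp⟩ := Finset.card_eq_one.mp c5
    obtain ⟨a, b, hab, hT1⟩ := Finset.card_eq_two.mp (show (T \ T').card = 2 by omega)
    obtain ⟨c, d, hcd, hT2⟩ := Finset.card_eq_two.mp (show (T' \ T).card = 2 by omega)
    have mp : p ∈ T ∩ T' := by rw [hp]; simp
    have ma : a ∈ T \ T' := by rw [hT1]; simp
    have mb : b ∈ T \ T' := by rw [hT1]; simp
    have mc : c ∈ T' \ T := by rw [hT2]; simp
    have md : d ∈ T' \ T := by rw [hT2]; simp
    simp only [Finset.mem_inter, Finset.mem_sdiff] at mp ma mb mc md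
    refine overlap1 H p a b c d ?_ (h p mp.1 a ma.1 b mb.1 ?_ ?_ hab) (h' p mp.2 c mc.1 d md.1 ?_ ?_ hcd)
    · simp only [List.nodup_cons, List.mem_cons, List.not_mem_nil, or_false, not_or, not_false_eq_true, List.nodup_nil, and_true]
      refine ⟨⟨?_, ?_, ?_, ?_⟩, ⟨hab, ?_, ?_⟩, ⟨?_, ?_⟩, hcd⟩ <;> grind
    all_goals grind
  · obtain ⟨p, q, hpq, hT0⟩ := Finset.card_eq_two.mp c5
    obtain ⟨b, hT1⟩ := Finset.card_eq_one.mp (show (T \ T').card = 1 by omega)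
    obtain ⟨d, hT2⟩ := Finset.card_eq_one.mp (show (T' \ T).card = 1 by omega)
    have mp : p ∈ T ∩ T' := by rw [hT0]; simp
    have mq : q ∈ T ∩ T' := by rw [hT0]; simp
    have mb : b ∈ T \ T' := by rw [hT1]; simp
    have md : d ∈ T' \ T := by rw [hT2]; simp
    simp only [Finset.mem_inter, Finset.mem_sdiff] at mp mq mb md
    refine overlap2 H p q b d ?_ (h p mp.1 q mq.1 b mb.1 hpq ?_ ?_) (h' p mp.2 q mq.2 d md.1 hpq ?_ ?_)
    · simp only [List.nodup_cons, List.mem_cons, List.not_mem_nil, or_false, not_or, not_false_eq_true, List.nodup_nil, and_true]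
      refine ⟨⟨hpq, ?_, ?_⟩, ⟨?_, ?_⟩, ?_⟩ <;> grind
    all_goals grind

/-- fixed point argument -/
lemma pconj {G : Type*} [Group G] [Finite G] (q : ℕ) [Fact q.Prime] (H E : Subgroup G) (hE : IsPGroup q E) (hq : ¬ q ∣ H.index) :
    ∃ g : G, ∀ e ∈ E, g * e * g⁻¹ ∈ H := by
  obtain ⟨x, hx⟩ := hE.nonempty_fixed_point_of_prime_not_dvd_card (G ⧸ H) hq
  obtain ⟨g, rfl⟩ := QuotientGroup.mk_surjective x
  refine ⟨g⁻¹, fun e he => ?_⟩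
  have h1 := hx ⟨e⁻¹, inv_mem he⟩
  have h2 : ((e⁻¹ * g : G) : G ⧸ H) = (g : G ⧸ H) := h1
  rw [QuotientGroup.eq] at h2
  simpa [mul_assoc] using h2

/-- the elementary abelian 3-group -/
def tri (k : ℕ) : (Fin k → Multiplicative (ZMod 3)) →* Perm (Fin k × ZMod 3) where
  toFun a := ⟨fun x => (x.1, x.2 + (a x.1).toAdd), fun x => (x.1, x.2 - (a x.1).toAdd), fun x => by simp, fun x => by simp⟩
  map_one' := by ext x <;> simp
  map_mul' a b := by 
    ext x
    · simp
    · change x.2 + ((a x.1).toAdd + (b x.1).toAdd) = x.2 + (b x.1).toAdd + (a x.1).toAdd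
      ring

lemma tri_single (k : ℕ) (i : Fin k) : tri k (Pi.mulSingle i (Multiplicative.ofAdd 1)) = tc (i, 0) (i, 1) (i, 2) := by
  ext1 x
  obtain ⟨j, x⟩ := x
  by_cases h : j = i
  · subst h
    have : tri k (Pi.mulSingle j (Multiplicative.ofAdd 1)) (j, x) = (j, x + 1) := by simp [tri]
    rw [this]
    have h3 : x = 0 ∨ x = 1 ∨ x = 2 := by clear this; revert x; decide
    have h01 : (0 : ZMod 3) ≠ 1 := by decide
    have h02 : (0 : ZMod 3) ≠ 2 := by decide
    have h12 : (1 : ZMod 3) ≠ 2 := by decide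
    rcases h3 with rfl | rfl | rfl
    · simp [tc, swap_apply_def, h01, h02, h12, h02.symm, h01.symm, h12.symm]
    · simp [tc, swap_apply_def, h01, h02, h12, h02.symm, h01.symm, h12.symm]; rfl
    · simp [tc, swap_apply_def, h01, h02, h12, h02.symm, h01.symm, h12.symm]; rfl
  · have : tri k (Pi.mulSingle i (Multiplicative.ofAdd 1)) (j, x) = (j, x) := by simp [tri, Pi.mulSingle_apply, h]
    rw [this]
    simp [tc, swap_apply_def, h]

end Stmt15

set_option linter.style.haveILetI false
set_option linter.unusedSectionVars false
namespace Stmt15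
open Module Subgroup Equiv

lemma key3 : ∀ b : Multiplicative (ZMod 3), b ^ (3 ^ 1) = 1 := by decide

lemma h35a {n : ℕ} (H : Subgroup (Perm (Fin n))) (h3 : ¬ 3 ∣ H.index) :
    ∃ e : Fin (n / 3) × ZMod 3 ↪ Fin n, ∀ i, tc (e (i, 0)) (e (i, 1)) (e (i, 2)) ∈ H := by
  haveI : Fact (Nat.Prime 3) := ⟨by norm_num⟩
  let e0 : Fin (n / 3) × Fin 3 ↪ Fin n :=
    (finProdFinEquiv (m := n / 3) (n := 3)).toEmbedding.trans (Fin.castLEEmb (Nat.div_mul_le_self n 3))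
  let e : Fin (n / 3) × ZMod 3 ↪ Fin n := e0
  have hE : IsPGroup 3 ((Equiv.Perm.viaEmbeddingHom e).comp (tri (n / 3))).range := by
    have h1 : IsPGroup 3 (Fin (n / 3) → Multiplicative (ZMod 3)) := by
      intro a
      refine ⟨1, ?_⟩
      funext i
      change (a i) ^ (3 ^ 1) = 1
      exact key3 (a i)
    exact h1.of_surjective _ (MonoidHom.rangeRestrict_surjective _)
  obtain ⟨g, hg⟩ := pconj 3 H _ hE h3
  refine ⟨e.trans g.toEmbedding, fun i => ?_⟩
  have := hg _ ⟨Pi.mulSingle i (Multiplicative.ofAdd 1), rfl⟩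
  rw [MonoidHom.comp_apply, tri_single, via_tc, conj_tc] at this
  exact this

lemma h35b {n : ℕ} (hn : 5 ≤ n) (H : Subgroup (Perm (Fin n))) (h5 : ¬ 5 ∣ H.index) :
    ∃ (c : Perm (Fin n)) (ι : ZMod 5 ↪ Fin n), c ∈ H ∧ (∀ j, c (ι j) = ι (j + 1)) ∧ ∀ a, a ∉ Set.range ι → c a = a := by
  haveI : Fact (Nat.Prime 5) := ⟨by norm_num⟩
  let ι0 : Fin 5 ↪ Fin n := Fin.castLEEmb hn
  let ι : ZMod 5 ↪ Fin n := ι0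
  have hE : IsPGroup 5 (zpowers (cyc ι)) := by
    rintro ⟨a, i, rfl⟩
    refine ⟨1, Subtype.ext ?_⟩
    change ((cyc ι) ^ i) ^ (5 ^ 1) = 1
    rw [pow_one, ← zpow_natCast, zpow_comm, zpow_natCast, cyc_pow, one_zpow]
  obtain ⟨g, hg⟩ := pconj 5 H _ hE h5
  refine ⟨g * cyc ι * g⁻¹, ι.trans g.toEmbedding, hg _ (mem_zpowers _), fun j => ?_, fun a ha => ?_⟩
  · simp [cyc_apply]
  · rw [Perm.mul_apply, Perm.mul_apply, cyc_fix]
    · simp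
    · rintro ⟨j, hj⟩
      refine ha ⟨j, ?_⟩
      simp [hj]

theorem h35 {n : ℕ} (hn : 5 ≤ n) (H : Subgroup (Perm (Fin n))) (k : ℕ) (hk : H.index = 2 ^ k) (h4 : ¬ 4 ∣ Nat.card H) : False := by
  have h3 : ¬ 3 ∣ H.index := by
    rw [hk]; intro h; exact absurd (Nat.Prime.dvd_of_dvd_pow (by norm_num) h) (by norm_num)
  have h5 : ¬ 5 ∣ H.index := by
    rw [hk]; intro h; exact absurd (Nat.Prime.dvd_of_dvd_pow (by norm_num) h) (by norm_num)
  obtain ⟨e, he⟩ := h35a H h3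
  obtain ⟨c, ι, hc, hc1, hc2⟩ := h35b hn H h5
  set F : Finset (Fin n) := Finset.univ.map ι with hF
  have hFc : F.card = 5 := by rw [hF, Finset.card_map, Finset.card_univ, ZMod.card]
  obtain ⟨a, ha1, ha2⟩ : ∃ a, a ∈ Finset.univ.map e ∧ a ∈ F := by
    by_contra hcon
    push Not at hcon
    have hd : Disjoint (Finset.univ.map e) F := Finset.disjoint_left.mpr hcon
    have h1 := Finset.card_le_univ (Finset.univ.map e ∪ F)
    rw [Finset.card_union_of_disjoint hd, hFc, Finset.card_map, Finset.card_univ, Fintype.card_prod, Fintype.card_fin,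
      Fintype.card_fin, ZMod.card] at h1
    omega
  obtain ⟨⟨i, x⟩, -, hix⟩ := Finset.mem_map.mp ha1
  set T : Finset (Fin n) := {e (i, 0), e (i, 1), e (i, 2)} with hT
  have h01 : (0 : ZMod 3) ≠ 1 := by decide
  have h02 : (0 : ZMod 3) ≠ 2 := by decide
  have h12 : (1 : ZMod 3) ≠ 2 := by decide
  have hnd : [e (i, 0), e (i, 1), e (i, 2)].Nodup := by simp [h01, h02, h12]
  have hTc : T.card = 3 := by
    rw [hT]; exact Finset.card_eq_three.mpr ⟨_, _, _, by simp [h01], by simp [h02], by simp [h12], rfl⟩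
  have haT : a ∈ T := by
    have h3 : x = 0 ∨ x = 1 ∨ x = 2 := by clear hix; revert x; decide
    rw [← hix]
    rcases h3 with rfl | rfl | rfl <;> simp [hT]
  have hnd' : [c (e (i, 0)), c (e (i, 1)), c (e (i, 2))].Nodup := by simp [h01, h02, h12]
  have hT' : T.map c.toEmbedding = {c (e (i, 0)), c (e (i, 1)), c (e (i, 2))} := by
    rw [hT]; simp
  have hce : tc (c (e (i, 0))) (c (e (i, 1))) (c (e (i, 2))) ∈ H := by
    rw [← conj_tc]; exact mul_mem (mul_mem hc (he i)) (inv_mem hc)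
  apply h4
  refine overlap H T (T.map c.toEmbedding) hTc (by rw [Finset.card_map, hTc]) (tc_all H _ _ _ hnd (he i)) ?_ ?_ ?_
  · rw [hT']; exact tc_all H _ _ _ hnd' hce
  · intro heq
    have hcl : ∀ b ∈ T, c b ∈ T := by
      intro b hb
      rw [heq]; exact Finset.mem_map_of_mem _ hb
    obtain ⟨j, -, hj⟩ := Finset.mem_map.mp ha2
    have hall : ∀ m : ℕ, ι (j + m) ∈ T := by
      intro m
      induction m with
      | zero => simpa [hj] using haT
      | succ m ih =>
        have := hcl _ ih
        rwa [hc1, add_assoc, ← Nat.cast_succ] at this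
    have hFT : F ⊆ T := by
      intro b hb
      obtain ⟨l, -, rfl⟩ := Finset.mem_map.mp hb
      have := hall (l - j).val
      rwa [ZMod.natCast_zmod_val, add_sub_cancel] at this
    have := Finset.card_le_card hFT
    omega
  · by_contra hem
    rw [Finset.not_nonempty_iff_eq_empty] at hem
    have hdis : Disjoint T (T.map c.toEmbedding) := Finset.disjoint_iff_inter_eq_empty.mpr hem
    have hTF : T ⊆ F := by
      intro b hb
      by_contra hbF
      have h1 : c b = b := hc2 b (fun ⟨l, hl⟩ => hbF (by rw [hF]; exact Finset.mem_map.mpr ⟨l, Finset.mem_univ _, hl⟩))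
      refine Finset.disjoint_left.mp hdis hb ?_
      have := Finset.mem_map_of_mem c.toEmbedding hb
      rwa [show c.toEmbedding b = b from h1] at this
    have hTF' : T.map c.toEmbedding ⊆ F := by
      intro b hb
      obtain ⟨d, hd, rfl⟩ := Finset.mem_map.mp hb
      obtain ⟨l, -, rfl⟩ := Finset.mem_map.mp (hTF hd)
      exact Finset.mem_map.mpr ⟨l + 1, Finset.mem_univ _, (hc1 l).symm⟩
    have := Finset.card_le_card (Finset.union_subset hTF hTF')
    rw [Finset.card_union_of_disjoint hdis, Finset.card_map] at this
    omega

end Stmt15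

set_option linter.style.haveILetI false
set_option linter.unusedSectionVars false
namespace Stmt15
open Module Subgroup Equiv

/-- preimage of an invariant subgroup under a crossed bijection -/
def pre {G N : Type*} [Group G] [Group N] (f : G →* MulAut N) (g : G → N)
    (hfg : ∀ σ τ, g (σ * τ) = g σ * f σ (g τ)) (K : Subgroup N) (hK : ∀ σ, ∀ x ∈ K, f σ x ∈ K) : Subgroup G where
  carrier := {σ | g σ ∈ K}
  one_mem' := by
    have := hfg 1 1
    simp only [mul_one, map_one, MulAut.one_apply, left_eq_mul] at this
    change g 1 ∈ K
    rw [this]; exact K.one_mem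
  mul_mem' := by
    intro a b ha hb
    change g (a * b) ∈ K
    rw [hfg]; exact K.mul_mem ha (hK _ _ hb)
  inv_mem' := by
    intro a ha
    change g a⁻¹ ∈ K
    have h1 := hfg 1 1
    simp only [mul_one, map_one, MulAut.one_apply, left_eq_mul] at h1
    have h2 := hfg a⁻¹ a
    rw [inv_mul_cancel, h1] at h2
    rw [eq_inv_of_mul_eq_one_left h2.symm]
    exact K.inv_mem (hK _ _ ha)

lemma mem_pre {G N : Type*} [Group G] [Group N] (f : G →* MulAut N) (g : G → N)
    (hfg : ∀ σ τ, g (σ * τ) = g σ * f σ (g τ)) (K : Subgroup N) (hK : ∀ σ, ∀ x ∈ K, f σ x ∈ K) (σ : G) :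
    σ ∈ pre f g hfg K hK ↔ g σ ∈ K := Iff.rfl

lemma card_pre {G N : Type*} [Group G] [Group N] (f : G →* MulAut N) (g : G → N)
    (hfg : ∀ σ τ, g (σ * τ) = g σ * f σ (g τ)) (K : Subgroup N) (hK : ∀ σ, ∀ x ∈ K, f σ x ∈ K) (hg : Function.Bijective g) :
    Nat.card (pre f g hfg K hK) = Nat.card K :=
  Nat.card_congr ((Equiv.ofBijective g hg).subtypeEquiv (fun σ => mem_pre f g hfg K hK σ))

lemma char_inv {N : Type*} [Group N] (M : Subgroup N) (hM : M.Characteristic) (a : MulAut N) : ∀ x ∈ M, a x ∈ M := by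
  intro x hx
  have := hM.fixed a
  rw [← this] at hx
  exact hx

/-- induced action on the quotient -/
def quotAct {G N : Type*} [Group G] [Group N] (f : G →* MulAut N) (M : Subgroup N) [M.Normal] (hM : M.Characteristic) :
    G →* MulAut (N ⧸ M) where
  toFun σ := QuotientGroup.congr M M (f σ) (characteristic_iff_map_eq.mp hM (f σ))
  map_one' := by
    ext x
    obtain ⟨x, rfl⟩ := QuotientGroup.mk_surjective x
    simp
  map_mul' a b := by
    ext x
    obtain ⟨x, rfl⟩ := QuotientGroup.mk_surjective x
    rw [map_mul]; rfl

lemma quotAct_mk {G N : Type*} [Group G] [Group N] (f : G →* MulAut N) (M : Subgroup N) [M.Normal] (hM : M.Characteristic) (σ : G) (x : N) :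
    quotAct f M hM σ (x : N ⧸ M) = ((f σ x : N) : N ⧸ M) := rfl

/-- action by restriction -/
def rsAct {G N : Type*} [Group G] [Group N] (f : G →* MulAut N) (M : Subgroup N) (hM : M.Characteristic) :
    G →* MulAut M where
  toFun σ :=
    { toFun := fun x => ⟨f σ x, char_inv M hM _ _ x.2⟩
      invFun := fun x => ⟨(f σ)⁻¹ x, char_inv M hM _ _ x.2⟩
      left_inv := fun x => by simp
      right_inv := fun x => by simp
      map_mul' := fun x y => by ext; simp }
  map_one' := by ext x; simp
  map_mul' a b := by ext x; simp

lemma rsAct_coe {G N : Type*} [Group G] [Group N] (f : G →* MulAut N) (M : Subgroup N) (hM : M.Characteristic) (σ : G) (x : M) :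
    ((rsAct f M hM σ x : M) : N) = f σ x := rfl

lemma exists_elem {N : Type*} [Group N] [Finite N] (M : Subgroup N) (hMchar : M.Characteristic) (hMproper : M ≠ ⊤)
    (hMcomm : commutator N ≤ M)
    (hMmax : ∀ M' : Subgroup N, M'.Characteristic → M' ≠ ⊤ → M ≤ M' → M' = M) : ∃ p : ℕ, p.Prime ∧ ∀ x : N, x ^ p ∈ M := by
  have hidx : M.index ≠ 1 := fun h => hMproper (index_eq_one.mp h)
  obtain ⟨p, hp, hpd⟩ := Nat.exists_prime_and_dvd hidx
  haveI := Fact.mk hp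
  have hcomm : ∀ a b : N, ((a * b : N) : N ⧸ M) = ((b * a : N) : N ⧸ M) := by
    intro a b
    rw [QuotientGroup.eq]
    apply hMcomm
    have h1 : (a * b)⁻¹ * (b * a) = b⁻¹ * a⁻¹ * b⁻¹⁻¹ * a⁻¹⁻¹ := by group
    rw [h1]
    exact commutator_mem_commutator (mem_top b⁻¹) (mem_top a⁻¹)
  letI : CommGroup (N ⧸ M) := { (inferInstance : Group (N ⧸ M)) with
    mul_comm := by
      intro a b
      obtain ⟨a, rfl⟩ := QuotientGroup.mk_surjective a
      obtain ⟨b, rfl⟩ := QuotientGroup.mk_surjective b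
      exact hcomm a b }
  let M' : Subgroup N := ((powMonoidHom p : (N ⧸ M) →* (N ⧸ M)).ker).comap (QuotientGroup.mk' M)
  have hmem : ∀ x, x ∈ M' ↔ x ^ p ∈ M := by
    intro x
    change ((x : N ⧸ M)) ^ p = 1 ↔ _
    rw [← QuotientGroup.mk_pow, QuotientGroup.eq_one_iff]
  refine ⟨p, hp, ?_⟩
  by_contra hcon
  have h1 : M' = M := by
    apply hMmax
    · apply characteristic_iff_comap_le.mpr
      intro ϕ x hx
      have h2 := (hmem _).mp (mem_comap.mp hx)
      rw [hmem]
      have h3 := char_inv M hMchar ϕ.symm _ h2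
      simpa using h3
    · intro htop
      exact hcon fun x => (hmem x).mp (htop ▸ mem_top x)
    · intro x hx
      exact (hmem x).mpr (M.pow_mem hx p)
  obtain ⟨v, hv⟩ := exists_prime_orderOf_dvd_card' (G := N ⧸ M) p hpd
  obtain ⟨x, rfl⟩ := QuotientGroup.mk_surjective v
  have h2 : x ∈ M' := by
    rw [hmem, ← QuotientGroup.eq_one_iff, QuotientGroup.mk_pow, ← hv, pow_orderOf_eq_one]
  rw [h1, ← QuotientGroup.eq_one_iff] at h2
  rw [h2, orderOf_one] at hv
  exact hp.one_lt.ne hv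

end Stmt15

set_option linter.style.haveILetI false
set_option linter.unusedSectionVars false
namespace Stmt15
open Module Subgroup Equiv

@[reducible] def commQ {N : Type*} [Group N] (M : Subgroup N) [M.Normal] (hMcomm : commutator N ≤ M) : CommGroup (N ⧸ M) :=
  { (inferInstance : Group (N ⧸ M)) with
    mul_comm := by
      intro a b
      obtain ⟨a, rfl⟩ := QuotientGroup.mk_surjective a
      obtain ⟨b, rfl⟩ := QuotientGroup.mk_surjective b
      change ((a * b : N) : N ⧸ M) = ((b * a : N) : N ⧸ M)
      rw [QuotientGroup.eq]
      apply hMcomm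
      have h1 : (a * b)⁻¹ * (b * a) = b⁻¹ * a⁻¹ * b⁻¹⁻¹ * a⁻¹⁻¹ := by group
      rw [h1]
      exact commutator_mem_commutator (mem_top b⁻¹) (mem_top a⁻¹) }

/-- abstract form of the first part -/
lemma part1a {n s : ℕ} (hn : 5 ≤ n) (hs : s.Prime) (hsn : n + 2 ≤ 2 * s) (ι : ZMod s ↪ Fin n)
    (V : Type*) [CommGroup V] [Finite V] (p : ℕ) (hp : p.Prime) (hV : ∀ v : V, v ^ p = 1)
    (φ : Perm (Fin n) →* MulAut V) (g : Perm (Fin n) → V) (hfg : ∀ σ τ, g (σ * τ) = g σ * φ σ (g τ))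
    (H : Subgroup (Perm (Fin n))) (hH : ∀ σ, σ ∈ H ↔ g σ = 1) (hcard : Nat.card H * Nat.card V = n.factorial)
    (hHt : H ≠ ⊤) : H = alternatingGroup (Fin n) := by
  haveI := Fact.mk hp
  have hcP : Nat.card (Perm (Fin n)) = n.factorial := by rw [Nat.card_perm, Nat.card_fin]
  have hindex : H.index = Nat.card V := by
    have h1 := H.card_mul_index
    rw [hcP, ← hcard] at h1
    exact Nat.eq_of_mul_eq_mul_left Nat.card_pos h1
  have h5 : 5 ≤ s := by
    have h4 : s ≠ 4 := by rintro rfl; exact absurd hs (by decide)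
    omega
  have htriv : φ (cyc ι) = 1 := by
    by_cases hp2 : p = 2
    · subst hp2
      by_contra hne
      letI := elMod 2 V hV
      haveI : FiniteDimensional (ZMod 2) (Ad V) := Module.Finite.of_finite
      have hc := card_Ad 2 V
      have hd : 2 ^ finrank (ZMod 2) (Ad V) ∣ n.factorial := by
        rw [← hc, ← hcard]; exact dvd_mul_left _ _
      have h1 := vle 2 n _ hp (by omega) hd
      have h2 : n - 2 ≤ finrank (ZMod 2) (Ad V) := by
        refine wagner hn ((toEnd 2 V).comp φ) s hs h5 ι (by omega) ?_
        intro h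
        apply hne
        apply toEnd_inj 2 V
        rw [map_one]; exact h
      refine h35 hn H (finrank (ZMod 2) (Ad V)) (by rw [hindex, hc]) ?_
      intro h4
      have h6 : 2 ^ (finrank (ZMod 2) (Ad V) + 2) ∣ n.factorial := by
        rw [← hcard, hc, pow_add, mul_comm]
        exact mul_dvd_mul h4 dvd_rfl
      have h7 := vle 2 n _ hp (by omega) h6
      omega
    · have hpg : IsPGroup p V := fun v => ⟨1, by rw [pow_one]; exact hV v⟩
      refine oddAct n s hs hsn hn (cyc ι) (cyc_pow ι) ?_ p hp hp2 V hpg (by rw [← hcard]; exact dvd_mul_left _ _) φ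
      intro j hj
      obtain ⟨y, hy, -⟩ := cyc_rat ι j hj
      exact ⟨y, hy⟩
  have hker : alternatingGroup (Fin n) ≤ φ.ker := alt_le hn φ.ker (cyc ι) (MonoidHom.mem_ker.mpr htriv) (cyc_ne_one hs ι)
  have hle : alternatingGroup (Fin n) ≤ H := by
    rw [← commutator_alternatingGroup_eq_self (α := Fin n) (by simpa using hn)]
    rw [Subgroup.commutator_le]
    intro a ha b hb
    let ψ : alternatingGroup (Fin n) →* V := MonoidHom.mk' (fun a => g a) (by
      intro a b
      change g (a * b) = _
      rw [hfg, MonoidHom.mem_ker.mp (hker a.2)]; rfl)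
    rw [hH]
    have : ψ ((⟨a, ha⟩ : alternatingGroup (Fin n)) * ⟨b, hb⟩ * ⟨a, ha⟩⁻¹ * ⟨b, hb⟩⁻¹) = 1 := by
      rw [map_mul, map_mul, map_mul, map_inv, map_inv, mul_comm (ψ _) (ψ _), mul_inv_cancel_right, mul_inv_cancel]
    exact this
  haveI : Nontrivial (Fin n) := Fin.nontrivial_iff_two_le.mpr (by omega)
  have hi2 : (alternatingGroup (Fin n)).index = 2 := alternatingGroup.index_eq_two
  have h1 := Subgroup.index_dvd_of_le hle
  rw [hi2] at h1
  have h2 : H.index ≠ 1 := fun h => hHt (index_eq_one.mp h)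
  rcases (Nat.dvd_prime Nat.prime_two).mp h1 with h3 | h3
  · exact absurd h3 h2
  · exact Equiv.Perm.eq_alternatingGroup_of_index_eq_two h3

theorem part1 {n s : ℕ} (hn : 5 ≤ n) (hs : s.Prime) (hsn : n + 2 ≤ 2 * s) (ι : ZMod s ↪ Fin n) (N : Type*) [Group N]
    (hcard : Nat.card N = n.factorial)
    (f : Equiv.Perm (Fin n) →* MulAut N) (g : Equiv.Perm (Fin n) → N)
    (hg : Function.Bijective g)
    (hfg : ∀ σ τ : Equiv.Perm (Fin n), g (σ * τ) = g σ * f σ (g τ))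
    (M : Subgroup N) (hMchar : M.Characteristic) (hMproper : M ≠ ⊤)
    (hMcomm : commutator N ≤ M)
    (hMmax : ∀ M' : Subgroup N, M'.Characteristic → M' ≠ ⊤ → M ≤ M' → M' = M) :
    pre f g hfg M (fun σ => char_inv M hMchar (f σ)) = alternatingGroup (Fin n) := by
  haveI : Finite N := Nat.finite_of_card_ne_zero (by rw [hcard]; exact n.factorial_ne_zero)
  obtain ⟨p, hp, hpM⟩ := exists_elem M hMchar hMproper hMcomm hMmax
  letI := commQ M hMcomm
  refine part1a hn hs hsn ι (N ⧸ M) p hp ?_ (quotAct f M hMchar) (fun σ => (g σ : N ⧸ M)) ?_ _ ?_ ?_ ?_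
  · intro v
    obtain ⟨x, rfl⟩ := QuotientGroup.mk_surjective v
    exact (QuotientGroup.eq_one_iff _).mpr (hpM x)
  · intro σ τ
    rw [hfg]; rfl
  · intro σ
    rw [mem_pre]
    exact (QuotientGroup.eq_one_iff _).symm
  · rw [card_pre f g hfg M _ hg, ← hcard]
    exact M.card_mul_index
  · intro h
    apply hMproper
    rw [eq_top_iff]
    intro x _
    obtain ⟨σ, rfl⟩ := hg.2 x
    exact (mem_pre f g hfg M (fun σ => char_inv M hMchar (f σ)) σ).mp (h ▸ mem_top σ)

end Stmt15

set_option linter.style.haveILetI false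
set_option linter.unusedSectionVars false
namespace Stmt15
open Module Subgroup Equiv

lemma case_b {n s : ℕ} (N : Type*) [Group N] [Finite N] 
    (hcard : Nat.card N = n.factorial)
    (f : Equiv.Perm (Fin n) →* MulAut N) (g : Equiv.Perm (Fin n) → N)
    (hg : Function.Bijective g)
    (hfg : ∀ σ τ : Equiv.Perm (Fin n), g (σ * τ) = g σ * f σ (g τ))
    (M : Subgroup N) (hM2 : 2 * Nat.card M = n.factorial) (hMchar : M.Characteristic) {X : Type*} [Group X] [Finite X]
    (π : X →* Perm (Fin n)) (inl : M →* X) (hinl : Function.Injective inl) (hr : inl.range = π.ker) (ι : ZMod s ↪ Fin n)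
    (c : Ctx n s π ι) (R : Subgroup X) (hR : Syl 2 π.ker R) (h : π.ker ⊓ normalizer (R : Set X) ≤ centralizer (R : Set X)) : False := by
  haveI : Fact (Nat.Prime 2) := ⟨Nat.prime_two⟩
  obtain ⟨K, hK, hK1, hK2⟩ := burnside hR h
  let KN : Subgroup N := (K.comap inl).map M.subtype
  have hmem : ∀ x : N, x ∈ KN ↔ x ∈ M ∧ ¬ 2 ∣ orderOf x := by
    intro x
    constructor
    · rintro ⟨y, hy, rfl⟩
      refine ⟨y.2, ?_⟩
      have h1 : inl y ∈ K := mem_comap.mp hy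
      have h2 := (hK1 _ (hK h1)).mp h1
      rw [orderOf_injective inl hinl] at h2
      rw [Subgroup.coe_subtype, Subgroup.orderOf_coe]; exact h2
    · rintro ⟨hx, hx2⟩
      refine ⟨⟨x, hx⟩, mem_comap.mpr ?_, rfl⟩
      have h1 : inl ⟨x, hx⟩ ∈ π.ker := by rw [← hr]; exact ⟨_, rfl⟩
      rw [hK1 _ h1, orderOf_injective inl hinl, Subgroup.orderOf_mk]
      exact hx2
  have hKcard : Nat.card KN = Nat.card K := by
    have h1 : Nat.card KN = Nat.card (K.comap inl) :=
      Subgroup.card_map_of_injective (M.subtype_injective)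
    rw [h1, ← Subgroup.card_map_of_injective hinl, Subgroup.map_comap_eq, hr, inf_eq_right.mpr hK]
  have hKinv : ∀ σ, ∀ x ∈ KN, f σ x ∈ KN := by
    intro σ x hx
    rw [hmem] at *
    exact ⟨char_inv M hMchar _ _ hx.1, by
      have := orderOf_injective (f σ).toMonoidHom (f σ).injective x
      change ¬ 2 ∣ orderOf ((f σ).toMonoidHom x)
      rw [this]; exact hx.2⟩
  have hodd : ¬ 2 ∣ Nat.card K := by
    intro hd
    obtain ⟨x, hx⟩ := exists_prime_orderOf_dvd_card' (G := K) 2 hd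
    have h1 := (hK1 _ (hK x.2)).mp x.2
    rw [Subgroup.orderOf_coe, hx] at h1
    exact h1 dvd_rfl
  have hcM : Nat.card M = Nat.card π.ker := by
    rw [← hr]; exact Nat.card_congr (MonoidHom.ofInjective hinl).toEquiv
  have hcp := card_pre f g hfg KN hKinv hg
  rw [hKcard] at hcp
  refine h35 c.hn (pre f g hfg KN hKinv) ((Nat.card π.ker).factorization 2 + 1) ?_ ?_
  · have h1 := (pre f g hfg KN hKinv).card_mul_index
    rw [hcp, Nat.card_perm, Nat.card_fin, ← hM2, hcM] at h1
    apply Nat.eq_of_mul_eq_mul_left (Nat.card_pos (α := K))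
    rw [h1, pow_succ, ← hR.2, ← mul_assoc, hK2, mul_comm]
  · rw [hcp]
    intro h4
    exact hodd ((by norm_num : 2 ∣ 4).trans h4)

lemma case_a {n : ℕ} (hn : 5 ≤ n) (M : Type*) [Group M] [Finite M] (hM : Nat.card M = Nat.card (alternatingGroup (Fin n)))
    (φ : alternatingGroup (Fin n) →* MulAut M) (g : alternatingGroup (Fin n) → M) (hg : Function.Bijective g)
    (hfg : ∀ σ τ, g (σ * τ) = g σ * φ σ (g τ)) (hinn : ∀ a, ∃ m : M, ∀ x, φ a x = m * x * m⁻¹) :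
    Nonempty (M ≃* alternatingGroup (Fin n)) := by
  haveI := alternatingGroup.isSimpleGroup (α := Fin n) (by simpa using hn)
  rcases (inferInstance : φ.ker.Normal).eq_bot_or_eq_top with h | h
  · have hinj : Function.Injective φ := (MonoidHom.ker_eq_bot_iff φ).mp h
    have hle : φ.range ≤ (MulAut.conj (G := M)).range := by
      rintro _ ⟨a, rfl⟩
      obtain ⟨m, hm⟩ := hinn a
      refine ⟨m, ?_⟩
      ext x
      rw [MulAut.conj_apply, hm]
    have hc1 : Nat.card φ.range = Nat.card (alternatingGroup (Fin n)) :=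
      (Nat.card_congr (MonoidHom.ofInjective hinj).toEquiv).symm
    have hsurj := MonoidHom.rangeRestrict_surjective (MulAut.conj (G := M))
    have hc2 : Nat.card (MulAut.conj (G := M)).range ≤ Nat.card M := Nat.card_le_card_of_surjective _ hsurj
    have heq : φ.range = (MulAut.conj (G := M)).range := by
      apply Subgroup.eq_of_le_of_card_ge hle
      rw [hc1, ← hM]; exact hc2
    have hc3 : Nat.card M = Nat.card (MulAut.conj (G := M)).range := by rw [← heq, hc1, hM]
    have hbij : Function.Bijective (MulAut.conj (G := M)).rangeRestrict := by
      rw [Nat.bijective_iff_surjective_and_card]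
      exact ⟨hsurj, hc3⟩
    exact ⟨(MulEquiv.ofBijective _ hbij).trans ((MulEquiv.subgroupCongr heq.symm).trans (MonoidHom.ofInjective hinj).symm)⟩
  · have h1 : ∀ a, φ a = 1 := fun a => MonoidHom.mem_ker.mp (h ▸ mem_top a)
    let ψ : alternatingGroup (Fin n) →* M := MonoidHom.mk' g (by intro a b; rw [hfg, h1]; rfl)
    exact ⟨(MulEquiv.ofBijective ψ hg).symm⟩

theorem main (n : ℕ) (hn : 5 ≤ n) (N : Type*) [Group N]
    (hcard : Nat.card N = n.factorial)
    (f : Equiv.Perm (Fin n) →* MulAut N) (g : Equiv.Perm (Fin n) → N)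
    (hg : Function.Bijective g)
    (hfg : ∀ σ τ : Equiv.Perm (Fin n), g (σ * τ) = g σ * f σ (g τ))
    (M : Subgroup N) (hMchar : M.Characteristic) (hMproper : M ≠ ⊤)
    (hMcomm : commutator N ≤ M)
    (hMmax : ∀ M' : Subgroup N, M'.Characteristic → M' ≠ ⊤ → M ≤ M' → M' = M) :
    g ⁻¹' (M : Set N) = (alternatingGroup (Fin n) : Set _) ∧ Set.BijOn g (alternatingGroup (Fin n) : Set _) (M : Set N) ∧ Nonempty (M ≃* alternatingGroup (Fin n)) := by
  haveI : Finite N := Nat.finite_of_card_ne_zero (by rw [hcard]; exact n.factorial_ne_zero)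
  obtain ⟨s, hs, hsn, hle, hsc⟩ := s0 n hn
  haveI : NeZero s := ⟨hs.ne_zero⟩
  obtain ⟨ι⟩ : Nonempty (ZMod s ↪ Fin n) := by
    apply Function.Embedding.nonempty_of_card_le
    rw [ZMod.card, Fintype.card_fin]; exact hle
  have hpre := part1 hn hs hsn ι N hcard f g hg hfg M hMchar hMproper hMcomm hMmax
  have hmem : ∀ σ, σ ∈ alternatingGroup (Fin n) ↔ g σ ∈ M := by
    intro σ; rw [← hpre]; rfl
  have hset : g ⁻¹' (M : Set N) = (alternatingGroup (Fin n) : Set (Perm (Fin n))) := by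
    ext σ; exact (hmem σ).symm
  refine ⟨hset, ?_, ?_⟩
  · rw [← hset]
    refine ⟨Set.mapsTo_preimage g _, hg.1.injOn, ?_⟩
    intro x hx
    obtain ⟨σ, rfl⟩ := hg.2 x
    exact ⟨σ, hx, rfl⟩
  have hMc : Nat.card M = Nat.card (alternatingGroup (Fin n)) := by
    rw [← card_pre f g hfg M (fun σ => char_inv M hMchar (f σ)) hg, hpre]
  haveI : Nontrivial (Fin n) := Fin.nontrivial_iff_two_le.mpr (by omega)
  have hM2 : 2 * Nat.card M = n.factorial := by
    rw [hMc, two_mul_nat_card_alternatingGroup, Nat.card_perm, Nat.card_fin]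
  let φ := rsAct f M hMchar
  let π : M ⋊[φ] Perm (Fin n) →* Perm (Fin n) := SemidirectProduct.rightHom
  let inl : M →* M ⋊[φ] Perm (Fin n) := SemidirectProduct.inl
  have hinl : Function.Injective inl := SemidirectProduct.inl_injective
  have hr : inl.range = π.ker := SemidirectProduct.range_inl_eq_ker_rightHom
  haveI : Finite (M ⋊[φ] Perm (Fin n)) := Finite.of_equiv _ SemidirectProduct.equivProd.symm
  have hcM : Nat.card M = Nat.card π.ker := by
    rw [← hr]; exact Nat.card_congr (MonoidHom.ofInjective hinl).toEquiv
  have c : Ctx n s π ι :=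
    ⟨hn, hs, hsn, hle, hsc, SemidirectProduct.rightHom_surjective, by rw [← hcM, hM2]⟩
  have hsM : s ∣ Nat.card π.ker := by
    have h1 : s ∣ 2 * Nat.card π.ker := by
      rw [← hcM, hM2]; exact (Nat.Prime.dvd_factorial hs).mpr hle
    refine (hs.dvd_mul.mp h1).resolve_left ?_
    intro h2
    have := Nat.le_of_dvd (by norm_num) h2
    have := c.s5
    omega
  obtain ⟨σ, hσ, hσ2⟩ := c.line hsM (by
    intro q hq R hR
    by_cases hq2 : q = 2
    · subst hq2
      rcases c.gTwo hR with h | h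
      · exact h
      · exact (case_b N hcard f g hg hfg M hM2 hMchar π inl hinl hr ι c R hR h).elim
    · exact c.gOdd hq hq2 hR)
  have hZ : alternatingGroup (Fin n) ≤ (centralizer (π.ker : Set (M ⋊[φ] Perm (Fin n)))).map π := by
    haveI : (centralizer (π.ker : Set (M ⋊[φ] Perm (Fin n)))).Normal := inferInstance
    haveI := Subgroup.Normal.map this π c.hπ
    refine alt_le hn _ (cyc ι) ?_ (cyc_ne_one hs ι)
    rw [← hσ]
    refine Subgroup.mem_map_of_mem π ?_
    rw [Subgroup.mem_centralizer_iff]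
    intro m hm
    exact (hσ2 m hm).symm
  refine case_a hn M hMc (φ.comp (alternatingGroup (Fin n)).subtype) (fun a => ⟨g a, (hmem a).mp a.2⟩) ?_ ?_ ?_
  · constructor
    · intro a b hab
      exact Subtype.ext (hg.1 (congrArg Subtype.val hab))
    · rintro ⟨x, hx⟩
      obtain ⟨σ, rfl⟩ := hg.2 x
      exact ⟨⟨σ, (hmem σ).mpr hx⟩, rfl⟩
  · intro a b
    exact Subtype.ext (hfg a b)
  · intro a
    obtain ⟨y, hy, hya⟩ := Subgroup.mem_map.mp (hZ a.2)
    rw [Subgroup.mem_centralizer_iff] at hy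
    refine ⟨y.left⁻¹, fun x => ?_⟩
    have h1 := hy (inl x) (by
      have : inl x ∈ π.ker := by rw [← hr]; exact ⟨x, rfl⟩
      exact this)
    have h2 := congrArg SemidirectProduct.left h1
    have h3 : y.right = a := hya
    simp only [SemidirectProduct.mul_left, inl, SemidirectProduct.left_inl, SemidirectProduct.right_inl, map_one, MulAut.one_apply, h3] at h2
    change φ a x = _
    rw [inv_inv, mul_assoc, h2, inv_mul_cancel_left]

end Stmt15

theorem stmt_15 (n : ℕ) (hn : 5 ≤ n) (N : Type*) [Group N]
    (hcard : Nat.card N = n.factorial) (hnonperf : commutator N ≠ ⊤)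
    (f : Equiv.Perm (Fin n) →* MulAut N) (g : Equiv.Perm (Fin n) → N)
    (hg : Function.Bijective g)
    (hfg : ∀ σ τ : Equiv.Perm (Fin n), g (σ * τ) = g σ * f σ (g τ))
    (M : Subgroup N) (hMchar : M.Characteristic) (hMproper : M ≠ ⊤)
    (hMcomm : commutator N ≤ M)
    (hMmax : ∀ M' : Subgroup N, M'.Characteristic → M' ≠ ⊤ → M ≤ M' → M' = M) :
    g ⁻¹' (M : Set N) = (alternatingGroup (Fin n) : Set (Equiv.Perm (Fin n))) ∧
      Set.BijOn g (alternatingGroup (Fin n) : Set (Equiv.Perm (Fin n))) (M : Set N) ∧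
      Nonempty (M ≃* alternatingGroup (Fin n)) := by
  exact Stmt15.main n hn N hcard f g hg hfg M hMchar hMproper hMcomm hMmax
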